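/- Key iterative lemma in Hölder domains (Lemma 3.1): Let α∈(1/2,1] and K>0. There exist constants C₀>0, β>1, c>0 and r₀∈(0,1) depending only on n, λ, Λ, α and K such that the following holds for every 0<r≤r₀, with γ=β(1−1/α)<0 and f(r)=exp(C₀ r^γ). Assume [g]_{C^{α,α/(1+α)}} ≤ K, and let w be a solution of w_t = Lw in 𝒞_r^− whose negative part w⁻ vanishes continuously on Γ. If w ≥ f(r) on 𝒜_r and w ≥ −1 on 𝒞_r^−, then, setting a=exp(−c r^{1−β}), one has w ≥ f(r/2)·a on 𝒜_{r/2} and w ≥ −a on 𝒞_{r/2}^−. -/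

import Mathlib

noncomputable section
open scoped BigOperators
open Classical

abbrev Spc (m : ℕ) := EuclideanSpace ℝ (Fin (m + 1))
abbrev Spc' (m : ℕ) := EuclideanSpace ℝ (Fin m)

/-- The horizontal coordinates `x' ∈ ℝ^{n-1}` of a point `x ∈ ℝⁿ`. -/
def xprime {m : ℕ} (x : Spc m) : Spc' m :=
  (WithLp.equiv 2 _).symm fun i => x i.castSucc

/-- The last (vertical) coordinate `x_n` of a point `x ∈ ℝⁿ`. -/
def xlast {m : ℕ} (x : Spc m) : ℝ := x (Fin.last m)

/-- Build a point of `ℝⁿ` from `x' ∈ ℝ^{n-1}` and the vertical coordinate. -/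
def mkPt {m : ℕ} (x' : Spc' m) (xn : ℝ) : Spc m :=
  (WithLp.equiv 2 _).symm fun i => if h : i = Fin.last m then xn else x' (i.castPred h)

/-- The `i`-th standard basis vector. -/
def eVec (m : ℕ) (i : Fin (m + 1)) : Spc m := EuclideanSpace.single i 1

/-- The entry `∂²u/∂xᵢ∂xⱼ` of the spatial Hessian of `u(x,t)` at `p = (x,t)`. -/
def sHess {m : ℕ} (u : Spc m × ℝ → ℝ) (p : Spc m × ℝ) (i j : Fin (m + 1)) : ℝ :=
  fderiv ℝ (fun y => fderiv ℝ (fun z => u (z, p.2)) y (eVec m j)) p.1 (eVec m i)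

/-- The operator `Lu = tr(A(x) D²ₓu)` at the point `p = (x,t)`. -/
def Lop {m : ℕ} (A : Spc m → Matrix (Fin (m + 1)) (Fin (m + 1)) ℝ)
    (u : Spc m × ℝ → ℝ) (p : Spc m × ℝ) : ℝ :=
  ∑ i, ∑ j, A p.1 i j * sHess u p j i

/-- Uniform ellipticity with symmetric coefficients: `λ|ξ|² ≤ ξ·A(x)ξ ≤ Λ|ξ|²`. -/
def IsElliptic {m : ℕ} (lam Lam : ℝ)
    (A : Spc m → Matrix (Fin (m + 1)) (Fin (m + 1)) ℝ) : Prop :=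
  (∀ x, (A x).IsSymm) ∧
  ∀ (x ξ : Spc m),
    lam * ‖ξ‖ ^ 2 ≤ ∑ i, ∑ j, ξ i * A x i j * ξ j ∧
      ∑ i, ∑ j, ξ i * A x i j * ξ j ≤ Lam * ‖ξ‖ ^ 2

/-- `u` is (pointwise) a solution of `u_t = Lu` on `Ω`: twice continuously
differentiable in `x`, differentiable in `t`, with `∂ₜu = tr(A(x)D²ₓu)`. -/
def SolvesL {m : ℕ} (A : Spc m → Matrix (Fin (m + 1)) (Fin (m + 1)) ℝ)
    (u : Spc m × ℝ → ℝ) (Ω : Set (Spc m × ℝ)) : Prop :=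
  ∀ p ∈ Ω, ContDiffAt ℝ 2 (fun y => u (y, p.2)) p.1 ∧
    HasDerivAt (fun s => u (p.1, s)) (Lop A u p) p.2

/-- `u` is a pointwise subsolution: `u_t ≤ Lu` on `Ω`. -/
def SubSolvesL {m : ℕ} (A : Spc m → Matrix (Fin (m + 1)) (Fin (m + 1)) ℝ)
    (u : Spc m × ℝ → ℝ) (Ω : Set (Spc m × ℝ)) : Prop :=
  ∀ p ∈ Ω, ContDiffAt ℝ 2 (fun y => u (y, p.2)) p.1 ∧
    DifferentiableAt ℝ (fun s => u (p.1, s)) p.2 ∧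
    deriv (fun s => u (p.1, s)) p.2 ≤ Lop A u p

/-- `u` solves the heat equation `∂ₜu = Δu` on `Ω`. -/
def SolvesHeat {m : ℕ} (u : Spc m × ℝ → ℝ) (Ω : Set (Spc m × ℝ)) : Prop :=
  ∀ p ∈ Ω, ContDiffAt ℝ 2 (fun y => u (y, p.2)) p.1 ∧
    HasDerivAt (fun s => u (p.1, s)) (∑ i, sHess u p i i) p.2

/-- The graph `Γ = {x_n = g(x',t)}`. -/
def graphSet {m : ℕ} (g : Spc' m → ℝ → ℝ) : Set (Spc m × ℝ) :=
  {p | xlast p.1 = g (xprime p.1) p.2}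

/-- The cylinder `𝒞_r` of size `r` on top of the graph of `g`. -/
def Cyl {m : ℕ} (g : Spc' m → ℝ → ℝ) (r : ℝ) : Set (Spc m × ℝ) :=
  {p | ‖xprime p.1‖ < r ∧ -r ^ 2 < p.2 ∧ p.2 < r ^ 2 ∧
    g (xprime p.1) p.2 < xlast p.1 ∧ xlast p.1 < g (xprime p.1) p.2 + r}

/-- The point `Ē = ((0', g(0',1/2) + 1/2), 1/2)`. -/
def Ebar {m : ℕ} (g : Spc' m → ℝ → ℝ) : Spc m × ℝ := (mkPt 0 (g 0 (1 / 2) + 1 / 2), 1 / 2)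

/-- The point `E̲ = ((0', g(0',−1/2) + 1/2), −1/2)`. -/
def Eund {m : ℕ} (g : Spc' m → ℝ → ℝ) : Spc m × ℝ := (mkPt 0 (g 0 (-(1 / 2)) + 1 / 2), -(1 / 2))

/-- `u` vanishes continuously on `Γ`: `u(Q) → 0` as `Q → P` within `Ω`,
for every `P ∈ Γ` in the closure of `Ω`. -/
def VanishesOn {m : ℕ} (u : Spc m × ℝ → ℝ) (Ω Γ : Set (Spc m × ℝ)) : Prop :=
  ∀ P ∈ Γ ∩ closure Ω, Filter.Tendsto u (nhdsWithin P Ω) (nhds 0)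

/-- `[g]_{C^{α,β}} ≤ K`. -/
def HolderSemi {m : ℕ} (α β K : ℝ) (g : Spc' m → ℝ → ℝ) : Prop :=
  ∀ x' y' t s, |g x' t - g y' s| ≤ K * (‖x' - y'‖ ^ α + |t - s| ^ β)

/-- The backward-in-time cylinder `𝒞_r^−` (Lipschitz setting, parabolic scaling). -/
def CylB {m : ℕ} (g : Spc' m → ℝ → ℝ) (r : ℝ) : Set (Spc m × ℝ) :=
  {p | (∀ i : Fin m, -r < xprime p.1 i ∧ xprime p.1 i < r) ∧ -r ^ 2 < p.2 ∧ p.2 ≤ 0 ∧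
    g (xprime p.1) p.2 < xlast p.1 ∧ xlast p.1 < g (xprime p.1) p.2 + r}

/-- The set `𝒜_r` of points of `𝒞_r^−` at height at least `δr` above `Γ`. -/
def ASet {m : ℕ} (g : Spc' m → ℝ → ℝ) (δ r : ℝ) : Set (Spc m × ℝ) :=
  {p ∈ CylB g r | g (xprime p.1) p.2 + δ * r ≤ xlast p.1}

/-- The backward-in-time cylinder `𝒞_r^−` (Hölder setting, time interval `(−r,0]`). -/
def CylBH {m : ℕ} (g : Spc' m → ℝ → ℝ) (r : ℝ) : Set (Spc m × ℝ) :=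
  {p | (∀ i : Fin m, -r < xprime p.1 i ∧ xprime p.1 i < r) ∧ -r < p.2 ∧ p.2 ≤ 0 ∧
    g (xprime p.1) p.2 < xlast p.1 ∧ xlast p.1 < g (xprime p.1) p.2 + r}

/-- The set `𝒜_r` of points of the Hölder cylinder `𝒞_r^−` at height at least `r^β` above `Γ`. -/
def ASetH {m : ℕ} (g : Spc' m → ℝ → ℝ) (β r : ℝ) : Set (Spc m × ℝ) :=
  {p ∈ CylBH g r | g (xprime p.1) p.2 + r ^ β ≤ xlast p.1}

/-- The height `h_Γ(x,t) = x_n − g(x',t)` above the graph. -/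
def hGamma {m : ℕ} (g : Spc' m → ℝ → ℝ) (p : Spc m × ℝ) : ℝ :=
  xlast p.1 - g (xprime p.1) p.2

/-- An abstract parabolic maximum principle: a function which is upper semicontinuous forward in
time cannot reach the level `θ` if from each maximum of a time slice above that level one can move
to an earlier point which is still above the level. -/
theorem lt_of_forall_slice_max {X : Type*} [TopologicalSpace X] {S : Set (X × ℝ)}
    (hS : IsCompact S) {v : X × ℝ → ℝ} {θ : ℝ}
    (husc : ∀ p ∈ S, ∀ c, v p < c → ∀ᶠ q in nhdsWithin p (S ∩ {q | p.2 ≤ q.2}), v q < c)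
    (hstep : ∀ p ∈ S, θ ≤ v p → (∀ q ∈ S, q.2 = p.2 → v q ≤ v p) →
      ∃ q ∈ S, q.2 < p.2 ∧ θ ≤ v q) :
    ∀ p ∈ S, v p < θ := by
  by_contra! hcon
  obtain ⟨p₀, hp₀, hθ₀⟩ := hcon
  set B : Set (X × ℝ) := {q | q ∈ S ∧ θ ≤ v q} with hB
  have hBS : B ⊆ S := fun q hq => hq.1
  have hne : (Prod.snd '' B).Nonempty := ⟨_, p₀, ⟨hp₀, hθ₀⟩, rfl⟩
  have hbdd : BddBelow (Prod.snd '' B) :=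
    ((hS.image continuous_snd).bddBelow).mono (Set.image_mono hBS)
  set T := sInf (Prod.snd '' B) with hT
  have hTle : ∀ q ∈ B, T ≤ q.2 := fun q hq => csInf_le hbdd ⟨q, hq, rfl⟩
  have hfreq : ∃ᶠ s in nhds T, s ∈ Prod.snd '' B :=
    mem_closure_iff_frequently.1 (csInf_mem_closure hne hbdd)
  have hNe : (Filter.comap Prod.snd (nhds T) ⊓ Filter.principal B).NeBot := by
    rw [← Filter.frequently_mem_iff_neBot]
    refine Filter.frequently_iff.2 fun {U} hU => ?_
    obtain ⟨V, hV, hVU⟩ := hU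
    obtain ⟨s, hs, q, hq, rfl⟩ := Filter.frequently_iff.1 hfreq hV
    exact ⟨q, hVU hs, hq⟩
  obtain ⟨p, hpS, hp⟩ := hS (f := Filter.comap Prod.snd (nhds T) ⊓ Filter.principal B)
    (inf_le_right.trans (Filter.principal_mono.2 hBS))
  have hp' : (nhds p ⊓ (Filter.comap Prod.snd (nhds T) ⊓ Filter.principal B)).NeBot := hp
  have hpT : p.2 = T := by
    have h1 : Filter.Tendsto Prod.snd
        (nhds p ⊓ (Filter.comap Prod.snd (nhds T) ⊓ Filter.principal B)) (nhds p.2) :=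
      (continuous_snd.tendsto p).mono_left inf_le_left
    have h2 : Filter.Tendsto Prod.snd
        (nhds p ⊓ (Filter.comap Prod.snd (nhds T) ⊓ Filter.principal B)) (nhds T) :=
      Filter.tendsto_comap.mono_left (inf_le_right.trans inf_le_left)
    exact tendsto_nhds_unique h1 h2
  have hpθ : θ ≤ v p := by
    by_contra! hlt
    have h1 := husc p hpS θ hlt
    have h2 : nhds p ⊓ (Filter.comap Prod.snd (nhds T) ⊓ Filter.principal B) ≤
        nhdsWithin p (S ∩ {q | p.2 ≤ q.2}) := by
      refine inf_le_inf le_rfl (inf_le_right.trans (Filter.principal_mono.2 fun q hq => ?_))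
      exact ⟨hBS hq, by rw [Set.mem_ofPred_eq, hpT]; exact hTle q hq⟩
    have h3 : ∀ᶠ q in nhds p ⊓ (Filter.comap Prod.snd (nhds T) ⊓ Filter.principal B), q ∈ B :=
      (inf_le_right.trans inf_le_right : _ ≤ Filter.principal B) (Filter.mem_principal_self B)
    have h4 := Filter.Eventually.and (Filter.Eventually.filter_mono h2 h1) h3
    obtain ⟨q, hq1, hq2⟩ := h4.exists
    exact absurd hq1 (not_lt.2 hq2.2)
  have hslice : IsCompact (S ∩ {q | q.2 = T}) :=
    hS.inter_right (isClosed_eq continuous_snd continuous_const)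
  have hus : UpperSemicontinuousOn v (S ∩ {q | q.2 = T}) := by
    rw [upperSemicontinuousOn_iff]
    intro q hq
    rw [upperSemicontinuousWithinAt_iff]
    intro c hc
    refine Filter.Eventually.filter_mono (nhdsWithin_mono _ ?_) (husc q hq.1 c hc)
    rintro z ⟨hz1, hz2⟩
    exact ⟨hz1, by rw [Set.mem_ofPred_eq] at hz2 ⊢; rw [hz2, hq.2]⟩
  obtain ⟨p', hp', hmax⟩ := UpperSemicontinuousOn.exists_isMaxOn
    (s := S ∩ {q | q.2 = T}) ⟨p, hpS, hpT⟩ hslice hus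
  have hle : ∀ q ∈ S, q.2 = T → v q ≤ v p' := fun q h1 h2 =>
    isMaxOn_iff.1 hmax q ⟨h1, h2⟩
  obtain ⟨q, hqS, hqlt, hqθ⟩ := hstep p' hp'.1 (hpθ.trans (hle p hpS hpT))
    (fun q h1 h2 => hle q h1 (h2.trans hp'.2))
  rw [hp'.2] at hqlt
  exact absurd (hTle q ⟨hqS, hqθ⟩) (not_le.2 hqlt)

/-- The trace of the product of a positive semidefinite matrix and a matrix with nonpositive
quadratic form is nonpositive. -/
theorem sum_mul_nonpos_of_posSemidef {ι : Type*} [Fintype ι] {M H : Matrix ι ι ℝ}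
    (hM : M.IsSymm) (hM0 : ∀ ξ : ι → ℝ, 0 ≤ ∑ i, ∑ j, ξ i * M i j * ξ j)
    (hH : ∀ ξ : ι → ℝ, ∑ i, ∑ j, ξ i * ξ j * H i j ≤ 0) :
    ∑ i, ∑ j, M i j * H j i ≤ 0 := by
  have hps : M.PosSemidef := by
    refine Matrix.PosSemidef.of_dotProduct_mulVec_nonneg ?_ fun x => ?_
    · rw [Matrix.IsHermitian, Matrix.conjTranspose_eq_transpose_of_trivial]; exact hM
    · have := hM0 x
      simp only [dotProduct, Matrix.mulVec, star_trivial, Finset.mul_sum]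
      simpa only [mul_assoc] using this
  obtain ⟨B, hB⟩ : ∃ B : Matrix ι ι ℝ, M = star B * B := by
    open scoped MatrixOrder in
    exact CStarAlgebra.nonneg_iff_eq_star_mul_self.mp hps.nonneg
  have hMij : ∀ i j, M i j = ∑ k, B k i * B k j := by
    intro i j
    rw [hB, Matrix.mul_apply]
    simp [Matrix.star_apply]
  have : ∑ i, ∑ j, M i j * H j i = ∑ k, ∑ j, ∑ i, B k j * B k i * H j i := by
    simp only [hMij, Finset.sum_mul]
    rw [Finset.sum_comm]
    calc _ = ∑ j, ∑ k, ∑ i, B k i * B k j * H j i :=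
          Finset.sum_congr rfl fun j _ => Finset.sum_comm
      _ = ∑ k, ∑ j, ∑ i, B k i * B k j * H j i := Finset.sum_comm
      _ = _ := by simp only [mul_comm]
  rw [this]
  exact Finset.sum_nonpos fun k _ => hH (B k)

section Hessian

variable {m : ℕ}

/-- The entry `∂²F/∂xᵢ∂xⱼ` of the Hessian of a function of the space variable. -/
def hessEntry (F : Spc m → ℝ) (x : Spc m) (i j : Fin (m + 1)) : ℝ :=
  fderiv ℝ (fun y => fderiv ℝ F y (eVec m j)) x (eVec m i)

/-- The operator `tr(M D²F)`. -/
def traceHess (M : Matrix (Fin (m + 1)) (Fin (m + 1)) ℝ) (F : Spc m → ℝ) (x : Spc m) : ℝ :=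
  ∑ i, ∑ j, M i j * hessEntry F x j i

theorem Lop_eq_traceHess (A : Spc m → Matrix (Fin (m + 1)) (Fin (m + 1)) ℝ)
    (u : Spc m × ℝ → ℝ) (p : Spc m × ℝ) :
    Lop A u p = traceHess (A p.1) (fun z => u (z, p.2)) p.1 := rfl

theorem differentiableAt_fderiv_of_contDiffAt {F : Spc m → ℝ} {x : Spc m}
    (hF : ContDiffAt ℝ 2 F x) : DifferentiableAt ℝ (fderiv ℝ F) x :=
  (hF.fderiv_right (m := 1) (by norm_num)).differentiableAt (by norm_num)

theorem hessEntry_eq {F : Spc m → ℝ} {x : Spc m} (hF : ContDiffAt ℝ 2 F x)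
    (i j : Fin (m + 1)) :
    hessEntry F x i j = fderiv ℝ (fderiv ℝ F) x (eVec m i) (eVec m j) := by
  have h := (differentiableAt_fderiv_of_contDiffAt hF).hasFDerivAt
  have h2 := h.clm_apply (hasFDerivAt_const (eVec m j) x)
  rw [hessEntry, h2.fderiv]
  simp

theorem hessEntry_symm {F : Spc m → ℝ} {x : Spc m} (hF : ContDiffAt ℝ 2 F x)
    (i j : Fin (m + 1)) : hessEntry F x i j = hessEntry F x j i := by
  rw [hessEntry_eq hF, hessEntry_eq hF]
  exact (hF.isSymmSndFDerivAt (by simp)).eq _ _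

theorem sum_smul_eVec (ξ : Fin (m + 1) → ℝ) :
    ∑ i, ξ i • eVec m i = WithLp.toLp 2 ξ := by
  ext k
  simp [eVec, Pi.single_apply]

theorem sum_hessEntry_eq {F : Spc m → ℝ} {x : Spc m} (hF : ContDiffAt ℝ 2 F x)
    (ξ : Fin (m + 1) → ℝ) :
    ∑ i, ∑ j, ξ i * ξ j * hessEntry F x i j =
      fderiv ℝ (fderiv ℝ F) x (WithLp.toLp 2 ξ) (WithLp.toLp 2 ξ) := by
  rw [← sum_smul_eVec]
  simp only [map_sum, map_smul, sum_apply, smul_apply,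
    smul_eq_mul, hessEntry_eq hF, Finset.mul_sum]
  rw [Finset.sum_comm]
  exact Finset.sum_congr rfl fun i _ => Finset.sum_congr rfl fun j _ => by ring

theorem hessEntry_congr {F G : Spc m → ℝ} {x : Spc m} (h : F =ᶠ[nhds x] G)
    (i j : Fin (m + 1)) : hessEntry F x i j = hessEntry G x i j := by
  have h1 : (fun y => fderiv ℝ F y (eVec m j)) =ᶠ[nhds x] fun y => fderiv ℝ G y (eVec m j) :=
    (h.fderiv (𝕜 := ℝ)).mono fun y hy => by simp only [hy]
  rw [hessEntry, hessEntry, h1.fderiv_eq]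

theorem hessEntry_sub {F G : Spc m → ℝ} {x : Spc m} (hF : ContDiffAt ℝ 2 F x)
    (hG : ContDiffAt ℝ 2 G x) (i j : Fin (m + 1)) :
    hessEntry (fun y => F y - G y) x i j = hessEntry F x i j - hessEntry G x i j := by
  have h1 : fderiv ℝ (fun y => F y - G y) =ᶠ[nhds x] fun y => fderiv ℝ F y - fderiv ℝ G y := by
    filter_upwards [hF.eventually (by simp), hG.eventually (by simp)] with y h1 h2
    exact fderiv_fun_sub (h1.differentiableAt (by norm_num)) (h2.differentiableAt (by norm_num))
  rw [hessEntry_eq (hF.sub hG), hessEntry_eq hF, hessEntry_eq hG, h1.fderiv_eq,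
    fderiv_fun_sub (differentiableAt_fderiv_of_contDiffAt hF)
      (differentiableAt_fderiv_of_contDiffAt hG)]
  simp

theorem hessEntry_add {F G : Spc m → ℝ} {x : Spc m} (hF : ContDiffAt ℝ 2 F x)
    (hG : ContDiffAt ℝ 2 G x) (i j : Fin (m + 1)) :
    hessEntry (fun y => F y + G y) x i j = hessEntry F x i j + hessEntry G x i j := by
  have h1 : fderiv ℝ (fun y => F y + G y) =ᶠ[nhds x] fun y => fderiv ℝ F y + fderiv ℝ G y := by
    filter_upwards [hF.eventually (by simp), hG.eventually (by simp)] with y h1 h2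
    exact fderiv_fun_add (h1.differentiableAt (by norm_num)) (h2.differentiableAt (by norm_num))
  rw [hessEntry_eq (hF.add hG), hessEntry_eq hF, hessEntry_eq hG, h1.fderiv_eq,
    fderiv_fun_add (differentiableAt_fderiv_of_contDiffAt hF)
      (differentiableAt_fderiv_of_contDiffAt hG)]
  simp

theorem hessEntry_const_mul (c : ℝ) {F : Spc m → ℝ} {x : Spc m} (hF : ContDiffAt ℝ 2 F x)
    (i j : Fin (m + 1)) :
    hessEntry (fun y => c * F y) x i j = c * hessEntry F x i j := by
  have h1 : fderiv ℝ (fun y => c * F y) =ᶠ[nhds x] fun y => c • fderiv ℝ F y := by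
    filter_upwards [hF.eventually (by simp)] with y h1
    exact fderiv_const_mul (h1.differentiableAt (by norm_num)) c
  rw [hessEntry_eq (contDiffAt_const.mul hF), hessEntry_eq hF, h1.fderiv_eq,
    fderiv_fun_const_smul (differentiableAt_fderiv_of_contDiffAt hF)]
  simp

theorem hessEntry_const (c : ℝ) (x : Spc m) (i j : Fin (m + 1)) :
    hessEntry (fun _ : Spc m => c) x i j = 0 := by
  simp [hessEntry]

variable (M : Matrix (Fin (m + 1)) (Fin (m + 1)) ℝ)

theorem traceHess_sub {F G : Spc m → ℝ} {x : Spc m} (hF : ContDiffAt ℝ 2 F x)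
    (hG : ContDiffAt ℝ 2 G x) :
    traceHess M (fun y => F y - G y) x = traceHess M F x - traceHess M G x := by
  simp only [traceHess, hessEntry_sub hF hG, mul_sub, Finset.sum_sub_distrib]

theorem traceHess_add {F G : Spc m → ℝ} {x : Spc m} (hF : ContDiffAt ℝ 2 F x)
    (hG : ContDiffAt ℝ 2 G x) :
    traceHess M (fun y => F y + G y) x = traceHess M F x + traceHess M G x := by
  simp only [traceHess, hessEntry_add hF hG, mul_add, Finset.sum_add_distrib]

theorem traceHess_const_mul (c : ℝ) {F : Spc m → ℝ} {x : Spc m} (hF : ContDiffAt ℝ 2 F x) :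
    traceHess M (fun y => c * F y) x = c * traceHess M F x := by
  simp only [traceHess, hessEntry_const_mul c hF, Finset.mul_sum]
  exact Finset.sum_congr rfl fun i _ => Finset.sum_congr rfl fun j _ => by ring

theorem traceHess_const (c : ℝ) (x : Spc m) : traceHess M (fun _ : Spc m => c) x = 0 := by
  simp [traceHess, hessEntry_const]

theorem traceHess_congr {F G : Spc m → ℝ} {x : Spc m} (h : F =ᶠ[nhds x] G) :
    traceHess M F x = traceHess M G x := by
  simp only [traceHess, hessEntry_congr h]

theorem traceHess_sum {ι : Type*} (s : Finset ι) {F : ι → Spc m → ℝ} {x : Spc m}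
    (hF : ∀ k ∈ s, ContDiffAt ℝ 2 (F k) x) :
    traceHess M (fun y => ∑ k ∈ s, F k y) x = ∑ k ∈ s, traceHess M (F k) x := by
  induction s using Finset.induction_on with
  | empty => simpa using traceHess_const M 0 x
  | insert a s ha ih =>
    simp only [Finset.sum_insert ha]
    rw [traceHess_add M (hF a (Finset.mem_insert_self _ _))
      (ContDiffAt.sum fun k hk => hF k (Finset.mem_insert_of_mem hk)),
      ih fun k hk => hF k (Finset.mem_insert_of_mem hk)]

/-- The second order necessary condition at a local maximum. -/
theorem fderiv_fderiv_nonpos_of_isLocalMax {F : Spc m → ℝ} {x : Spc m}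
    (hF : ContDiffAt ℝ 2 F x) (hmax : IsLocalMax F x) (v : Spc m) :
    fderiv ℝ (fderiv ℝ F) x v v ≤ 0 := by
  by_contra! hpos
  have hline : ∀ s : ℝ, HasDerivAt (fun s : ℝ => x + s • v) v s := fun s => by
    simpa using ((hasDerivAt_id s).smul_const v).const_add x
  have hcont : Continuous fun s : ℝ => x + s • v := by fun_prop
  have htend : Filter.Tendsto (fun s : ℝ => x + s • v) (nhds 0) (nhds x) := by
    simpa using hcont.tendsto 0
  have hd1 : ∀ᶠ s in nhds (0 : ℝ),
      HasDerivAt (fun s : ℝ => F (x + s • v)) (fderiv ℝ F (x + s • v) v) s := by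
    filter_upwards [htend.eventually (hF.eventually (by simp))] with s hs
    exact (hs.differentiableAt (by norm_num)).hasFDerivAt.comp_hasDerivAt s (hline s)
  have hd1' : deriv (fun s : ℝ => F (x + s • v)) =ᶠ[nhds 0]
      fun s => fderiv ℝ F (x + s • v) v := hd1.mono fun s hs => hs.deriv
  have hx0 : x + (0 : ℝ) • v = x := by simp
  have hd2 : HasDerivAt (fun s : ℝ => fderiv ℝ F (x + s • v) v)
      (fderiv ℝ (fderiv ℝ F) x v v) 0 := by
    have h1 : HasFDerivAt (fderiv ℝ F) (fderiv ℝ (fderiv ℝ F) x) (x + (0 : ℝ) • v) := by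
      rw [hx0]; exact (differentiableAt_fderiv_of_contDiffAt hF).hasFDerivAt
    have h2 := h1.comp_hasDerivAt (0 : ℝ) (hline 0)
    simpa using h2.clm_apply (hasDerivAt_const (0 : ℝ) v)
  have hdd : deriv (deriv fun s : ℝ => F (x + s • v)) 0 = fderiv ℝ (fderiv ℝ F) x v v := by
    rw [hd1'.deriv_eq, hd2.deriv]
  have hgrad : fderiv ℝ F x = 0 := hmax.fderiv_eq_zero
  have hmin : IsLocalMin (fun s : ℝ => F (x + s • v)) 0 := by
    refine isLocalMin_of_deriv_deriv_pos (by rw [hdd]; exact hpos) ?_ ?_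
    · rw [hd1'.eq_of_nhds, hx0, hgrad]; rfl
    · exact hd1.self_of_nhds.continuousAt
  have hconst : (fun s : ℝ => F (x + s • v)) =ᶠ[nhds 0] fun _ => F x := by
    filter_upwards [hmin, htend.eventually hmax] with s h1 h2
    simp only [hx0] at h1
    exact le_antisymm h2 h1
  have h0 : deriv (fun s : ℝ => F (x + s • v)) =ᶠ[nhds 0] fun _ => 0 := by
    have := hconst.deriv
    simpa using this
  rw [← hdd, h0.deriv_eq] at hpos
  simp at hpos

theorem sum_hessEntry_nonpos_of_isLocalMax {F : Spc m → ℝ} {x : Spc m}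
    (hF : ContDiffAt ℝ 2 F x) (hmax : IsLocalMax F x) (ξ : Fin (m + 1) → ℝ) :
    ∑ i, ∑ j, ξ i * ξ j * hessEntry F x i j ≤ 0 := by
  rw [sum_hessEntry_eq hF]
  exact fderiv_fderiv_nonpos_of_isLocalMax hF hmax _

/-- Ellipticity of a single symmetric matrix. -/
structure IsEllipticMatrix (lam Lam : ℝ) (M : Matrix (Fin (m + 1)) (Fin (m + 1)) ℝ) : Prop where
  symm : M.IsSymm
  lower : ∀ ξ : Fin (m + 1) → ℝ, lam * ∑ i, ξ i ^ 2 ≤ ∑ i, ∑ j, ξ i * M i j * ξ j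
  upper : ∀ ξ : Fin (m + 1) → ℝ, ∑ i, ∑ j, ξ i * M i j * ξ j ≤ Lam * ∑ i, ξ i ^ 2

theorem IsElliptic.isEllipticMatrix {lam Lam : ℝ}
    {A : Spc m → Matrix (Fin (m + 1)) (Fin (m + 1)) ℝ} (hA : IsElliptic lam Lam A) (x : Spc m) :
    IsEllipticMatrix lam Lam (A x) where
  symm := hA.1 x
  lower ξ := by
    have := (hA.2 x (WithLp.toLp 2 ξ)).1
    simpa [EuclideanSpace.norm_sq_eq] using this
  upper ξ := by
    have := (hA.2 x (WithLp.toLp 2 ξ)).2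
    simpa [EuclideanSpace.norm_sq_eq] using this

variable {M} {lam Lam : ℝ}

/-- At a point where the Hessian is nonpositive, `tr(M D²F) ≤ λ ΔF`. -/
theorem IsEllipticMatrix.traceHess_le (hM : IsEllipticMatrix lam Lam M) {F : Spc m → ℝ}
    {x : Spc m} (hH : ∀ ξ : Fin (m + 1) → ℝ, ∑ i, ∑ j, ξ i * ξ j * hessEntry F x i j ≤ 0) :
    traceHess M F x ≤ lam * ∑ i, hessEntry F x i i := by
  have key := sum_mul_nonpos_of_posSemidef
    (M := M - lam • (1 : Matrix (Fin (m + 1)) (Fin (m + 1)) ℝ))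
    (H := fun i j => hessEntry F x i j) ?_ ?_ hH
  · have : ∑ i, ∑ j, (M - lam • (1 : Matrix (Fin (m + 1)) (Fin (m + 1)) ℝ)) i j *
      hessEntry F x j i =
        traceHess M F x - lam * ∑ i, hessEntry F x i i := by
      simp [traceHess, sub_mul, Finset.sum_sub_distrib, Matrix.one_apply, Finset.mul_sum]
    rw [this] at key
    linarith
  · exact hM.symm.sub (Matrix.isSymm_one.smul _)
  · intro ξ
    have h := hM.lower ξ
    have : ∑ i, ∑ j, ξ i * (M - lam • (1 : Matrix (Fin (m + 1)) (Fin (m + 1)) ℝ)) i j * ξ j =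
        (∑ i, ∑ j, ξ i * M i j * ξ j) - lam * ∑ i, ξ i ^ 2 := by
      simp only [Matrix.sub_apply, Matrix.smul_apply, Matrix.one_apply, smul_eq_mul, mul_ite,
        mul_one, mul_zero, mul_sub, sub_mul, Finset.sum_sub_distrib, ite_mul, zero_mul,
        Finset.sum_ite_eq, Finset.mem_univ, if_true, Finset.mul_sum]
      congr 1
      exact Finset.sum_congr rfl fun i _ => by ring
    rw [this]
    linarith

theorem IsEllipticMatrix.traceHess_nonpos (hM : IsEllipticMatrix lam Lam M) (hlam : 0 ≤ lam)
    {F : Spc m → ℝ} {x : Spc m} (hF : ContDiffAt ℝ 2 F x) (hmax : IsLocalMax F x) :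
    traceHess M F x ≤ 0 := by
  refine sum_mul_nonpos_of_posSemidef (H := fun i j => hessEntry F x i j) hM.symm (fun ξ => ?_)
    (sum_hessEntry_nonpos_of_isLocalMax hF hmax)
  exact (mul_nonneg hlam (Finset.sum_nonneg fun i _ => sq_nonneg _)).trans (hM.lower ξ)

theorem IsEllipticMatrix.diag_le (hM : IsEllipticMatrix lam Lam M) (i : Fin (m + 1)) :
    M i i ≤ Lam := by
  have := hM.upper (Pi.single i 1)
  simpa [Pi.single_apply] using this

theorem IsEllipticMatrix.sum_diag_le (hM : IsEllipticMatrix lam Lam M) :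
    ∑ i, M i i ≤ (m + 1) * Lam := by
  have := Finset.sum_le_sum fun i (_ : i ∈ Finset.univ) => hM.diag_le i
  simpa using this

end Hessian

section Quadratic

variable {m : ℕ}

theorem hasFDerivAt_norm_sub_sq (X y : Spc m) :
    HasFDerivAt (fun z : Spc m => ‖z - X‖ ^ 2) (2 • innerSL ℝ (y - X)) y := by
  simpa using ((hasFDerivAt_id y).sub_const X).norm_sq

theorem inner_eVec (z : Spc m) (i : Fin (m + 1)) : inner ℝ z (eVec m i) = z i := by
  rw [eVec, EuclideanSpace.inner_single_right]
  simp

theorem hasFDerivAt_sub_apply (X y : Spc m) (j : Fin (m + 1)) :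
    HasFDerivAt (fun z : Spc m => z j - X j) (EuclideanSpace.proj j : Spc m →L[ℝ] ℝ) y :=
  (EuclideanSpace.proj j : Spc m →L[ℝ] ℝ).hasFDerivAt.sub_const _

theorem hessEntry_norm_sub_sq (X y : Spc m) (i j : Fin (m + 1)) :
    hessEntry (fun z : Spc m => ‖z - X‖ ^ 2) y i j = if i = j then 2 else 0 := by
  have h1 : (fun y : Spc m => fderiv ℝ (fun z : Spc m => ‖z - X‖ ^ 2) y (eVec m j)) =
      fun y => 2 * (y j - X j) := by
    ext y
    rw [(hasFDerivAt_norm_sub_sq X y).fderiv]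
    simp [innerSL_apply_apply, inner_eVec]
  rw [hessEntry, h1, ((hasFDerivAt_sub_apply X y j).const_mul 2).fderiv]
  by_cases h : i = j
  · simp [h, eVec]
  · simp [h, eVec, Ne.symm h]

theorem hessEntry_norm_sub_pow_four (X y : Spc m) (i j : Fin (m + 1)) :
    hessEntry (fun z : Spc m => (‖z - X‖ ^ 2) ^ 2) y i j =
      8 * ((y i - X i) * (y j - X j)) + if i = j then 4 * ‖y - X‖ ^ 2 else 0 := by
  have h1 : (fun y : Spc m => fderiv ℝ (fun z : Spc m => (‖z - X‖ ^ 2) ^ 2) y (eVec m j)) =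
      fun y => 4 * (‖y - X‖ ^ 2 * (y j - X j)) := by
    ext y
    rw [((hasFDerivAt_norm_sub_sq X y).pow 2).fderiv]
    simp [innerSL_apply_apply, inner_eVec]
    ring
  have h2 : HasFDerivAt (fun y : Spc m => 4 * (‖y - X‖ ^ 2 * (y j - X j))) _ y :=
    ((hasFDerivAt_norm_sub_sq X y).mul (hasFDerivAt_sub_apply X y j)).const_mul 4
  rw [hessEntry, h1, h2.fderiv]
  by_cases h : i = j
  · subst h
    simp [innerSL_apply_apply, inner_eVec]
    simp [eVec]
    ring
  · simp [innerSL_apply_apply, inner_eVec, h]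
    simp [eVec, Ne.symm h]
    ring

theorem contDiff_norm_sub_sq (X : Spc m) : ContDiff ℝ 2 fun z : Spc m => ‖z - X‖ ^ 2 :=
  (contDiff_id.sub contDiff_const).norm_sq ℝ

variable (M : Matrix (Fin (m + 1)) (Fin (m + 1)) ℝ)

theorem traceHess_norm_sub_sq (X y : Spc m) :
    traceHess M (fun z : Spc m => ‖z - X‖ ^ 2) y = 2 * ∑ i, M i i := by
  simp only [traceHess, hessEntry_norm_sub_sq, mul_ite, mul_zero, Finset.sum_ite_eq',
    Finset.mem_univ, if_true, Finset.mul_sum]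
  exact Finset.sum_congr rfl fun i _ => mul_comm _ _

theorem traceHess_norm_sub_pow_four (X y : Spc m) :
    traceHess M (fun z : Spc m => (‖z - X‖ ^ 2) ^ 2) y =
      8 * (∑ i, ∑ j, (y i - X i) * M i j * (y j - X j)) + 4 * ‖y - X‖ ^ 2 * ∑ i, M i i := by
  simp only [traceHess, hessEntry_norm_sub_pow_four, mul_add, Finset.sum_add_distrib, mul_ite,
    mul_zero, Finset.sum_ite_eq', Finset.mem_univ, if_true, Finset.mul_sum]
  congr 1
  · exact Finset.sum_congr rfl fun i _ => Finset.sum_congr rfl fun j _ => by ring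
  · exact Finset.sum_congr rfl fun i _ => by ring

theorem hessEntry_inner_sub (p X y : Spc m) (i j : Fin (m + 1)) :
    hessEntry (fun z : Spc m => inner ℝ p (z - X)) y i j = 0 := by
  have h1 : (fun y : Spc m => fderiv ℝ (fun z : Spc m => inner ℝ p (z - X)) y (eVec m j)) =
      fun _ => inner ℝ p (eVec m j) := by
    ext y
    have h2 : HasFDerivAt (fun z : Spc m => inner ℝ p (z - X)) (innerSL ℝ p) y := by
      simpa [inner_sub_right] using ((innerSL ℝ p).hasFDerivAt (x := y)).sub_const (inner ℝ p X)
    rw [h2.fderiv, innerSL_apply_apply]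
  rw [hessEntry, h1]
  simp

end Quadratic

section TimeAverages

open MeasureTheory Filter Topology

variable {X : Type*} [PseudoMetricSpace X]

/-- The supremum of `y` over a small cylinder strictly to the future of `(x, s)`. -/
def futureSup (y : X → ℝ → ℝ) (x : X) (δ s : ℝ) : ℝ :=
  ⨆ i : Metric.ball x δ × Set.Ioo (0 : ℝ) δ, y i.1 (s + i.2)

variable {y : X → ℝ → ℝ} {M : ℝ}

theorem bddAbove_futureSup (hM : ∀ x s, y x s ≤ M) (x : X) (δ s : ℝ) :
    BddAbove (Set.range fun i : Metric.ball x δ × Set.Ioo (0 : ℝ) δ => y i.1 (s + i.2)) :=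
  ⟨M, by rintro _ ⟨i, rfl⟩; exact hM _ _⟩

theorem le_futureSup (hM : ∀ x s, y x s ≤ M) {x x' : X} {δ s s' : ℝ} (hx : dist x' x < δ)
    (hs : s < s') (hs' : s' < s + δ) : y x' s' ≤ futureSup y x δ s := by
  have := le_ciSup (bddAbove_futureSup hM x δ s)
    (⟨⟨x', hx⟩, ⟨s' - s, by constructor <;> linarith⟩⟩ : Metric.ball x δ × Set.Ioo (0 : ℝ) δ)
  simpa [futureSup] using this

theorem futureSup_le {x : X} {δ s c : ℝ} (hδ : 0 < δ)
    (h : ∀ x' s', dist x' x < δ → s < s' → s' < s + δ → y x' s' ≤ c) :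
    futureSup y x δ s ≤ c := by
  have : Nonempty (Metric.ball x δ × Set.Ioo (0 : ℝ) δ) :=
    ⟨⟨⟨x, Metric.mem_ball_self hδ⟩, ⟨δ / 2, by constructor <;> linarith⟩⟩⟩
  refine ciSup_le fun i => h _ _ i.1.2 ?_ ?_
  · linarith [i.2.2.1]
  · linarith [i.2.2.2]

theorem measurable_futureSup (hM : ∀ x s, y x s ≤ M) (hs : ∀ x, Continuous (y x)) (x : X)
    (δ : ℝ) : Measurable (futureSup y x δ) := by
  refine LowerSemicontinuous.measurable ?_
  refine lowerSemicontinuous_ciSup (bddAbove_futureSup hM x δ) fun i => ?_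
  have hc : Continuous fun s : ℝ => y i.1 (s + i.2) :=
    (hs _).comp (continuous_id.add continuous_const)
  exact hc.lowerSemicontinuous

theorem tendsto_futureSup (hM : ∀ x s, y x s ≤ M) (hs : ∀ x, Continuous (y x))
    (husc : ∀ x s, UpperSemicontinuousWithinAt (fun q : X × ℝ => y q.1 q.2) {q | s ≤ q.2} (x, s))
    (x : X) (s : ℝ) :
    Tendsto (fun k : ℕ => futureSup y x (1 / ((k : ℝ) + 1)) s) atTop (𝓝 (y x s)) := by
  have hpos : ∀ k : ℕ, (0 : ℝ) < 1 / ((k : ℝ) + 1) := fun k => Nat.one_div_pos_of_nat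
  rw [tendsto_order]
  constructor
  · intro c hc
    refine Eventually.of_forall fun k => ?_
    have h1 : ∀ᶠ s' in 𝓝[>] s, c < y x s' :=
      (((hs x).tendsto s).eventually (lt_mem_nhds hc)).filter_mono nhdsWithin_le_nhds
    have h2 : ∀ᶠ s' in 𝓝[>] s, s' ∈ Set.Ioo s (s + 1 / ((k : ℝ) + 1)) :=
      Ioo_mem_nhdsGT (by linarith [hpos k])
    obtain ⟨s', h3, h4⟩ := (h1.and h2).exists
    exact h3.trans_le (le_futureSup hM (by simpa using hpos k) h4.1 h4.2)
  · intro c hc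
    obtain ⟨c', hc1, hc2⟩ := exists_between hc
    have h1 := husc x s c' hc1
    obtain ⟨δ, hδ, h2⟩ := Metric.mem_nhdsWithin_iff.1 h1
    have h3 : ∀ᶠ k : ℕ in atTop, 1 / ((k : ℝ) + 1) < δ :=
      (tendsto_one_div_add_atTop_nhds_zero_nat).eventually (gt_mem_nhds hδ)
    filter_upwards [h3] with k hk
    refine (futureSup_le (hpos k) fun x' s' h4 h5 h6 => ?_).trans_lt hc2
    have : (x', s') ∈ Metric.ball (x, s) δ ∩ {q : X × ℝ | s ≤ q.2} := by
      refine ⟨?_, h5.le⟩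
      rw [Metric.mem_ball, Prod.dist_eq, max_lt_iff]
      refine ⟨h4.trans hk, ?_⟩
      rw [Real.dist_eq, abs_of_pos (by linarith)]
      simp only
      linarith
    exact (h2 this).le

/-- Time averages of a function which is separately continuous and upper semicontinuous forward in
time are controlled, uniformly in space, by its time integral. -/
theorem exists_average_le_integral [CompactSpace X] (h0 : ∀ x s, 0 ≤ y x s)
    (hM : ∀ x s, y x s ≤ M) (hs : ∀ x, Continuous (y x)) (hx : ∀ s, Continuous fun x => y x s)
    (husc : ∀ x s, UpperSemicontinuousWithinAt (fun q : X × ℝ => y q.1 q.2) {q | s ≤ q.2} (x, s))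
    {a b h ε : ℝ} (hh : 0 < h) (hε : 0 < ε) :
    ∃ N : ℕ, 0 < N ∧ ∀ x, ∀ t ∈ Set.Icc a b,
      (1 / (N : ℝ)) * ∑ i ∈ Finset.range N, y x (t - i * (h / N)) ≤
        (∫ s in (a - h)..b, y x s) / h + ε := by
  have hIcont : Continuous fun x => ∫ s in (a - h)..b, y x s := by
    refine intervalIntegral.continuous_of_dominated_interval (bound := fun _ => M)
      (fun x => (hs x).aestronglyMeasurable) (fun x => ae_of_all _ fun s _ => ?_)
      intervalIntegrable_const (ae_of_all _ fun s _ => hx s)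
    rw [Real.norm_eq_abs, abs_of_nonneg (h0 x s)]
    exact hM x s
  have hnorm : ∀ x δ s, 0 < δ → ‖futureSup y x δ s‖ ≤ M := fun x δ s hδ => by
    rw [Real.norm_eq_abs, abs_of_nonneg]
    · exact futureSup_le hδ fun _ _ _ _ _ => hM _ _
    · exact (h0 x (s + δ / 2)).trans
        (le_futureSup hM (by simpa using hδ) (by linarith) (by linarith))
  have hInt : ∀ x δ c d, 0 < δ → IntervalIntegrable (futureSup y x δ) volume c d :=
    fun x δ c d hδ => (intervalIntegrable_const (c := M)).mono_fun'
      (measurable_futureSup hM hs x δ).aestronglyMeasurable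
      (ae_of_all _ fun s => hnorm x δ s hδ)
  suffices H : ∃ N₀ : ℕ, ∀ N ≥ N₀, 0 < N → ∀ x ∈ (Set.univ : Set X), ∀ t ∈ Set.Icc a b,
      (1 / (N : ℝ)) * ∑ i ∈ Finset.range N, y x (t - i * (h / N)) ≤
        (∫ s in (a - h)..b, y x s) / h + ε by
    obtain ⟨N₀, H⟩ := H
    exact ⟨N₀ + 1, by omega, fun x t ht => H _ (by omega) (by omega) x trivial t ht⟩
  refine isCompact_univ.induction_on (p := fun U : Set X => ∃ N₀ : ℕ, ∀ N ≥ N₀, 0 < N →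
    ∀ x ∈ U, ∀ t ∈ Set.Icc a b, (1 / (N : ℝ)) * ∑ i ∈ Finset.range N, y x (t - i * (h / N)) ≤
        (∫ s in (a - h)..b, y x s) / h + ε) ⟨0, by simp⟩ ?_ ?_ ?_
  · rintro U V hUV ⟨N₀, H⟩
    exact ⟨N₀, fun N hN hN' x hxU => H N hN hN' x (hUV hxU)⟩
  · rintro U V ⟨N₁, H₁⟩ ⟨N₂, H₂⟩
    refine ⟨max N₁ N₂, fun N hN hN' x hxU => ?_⟩
    rcases hxU with h1 | h1
    · exact H₁ N (le_trans (le_max_left _ _) hN) hN' x h1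
    · exact H₂ N (le_trans (le_max_right _ _) hN) hN' x h1
  · intro x₀ _
    have hlim : Tendsto (fun k : ℕ => ∫ s in (a - h)..b, futureSup y x₀ (1 / ((k : ℝ) + 1)) s)
        atTop (𝓝 (∫ s in (a - h)..b, y x₀ s)) := by
      refine intervalIntegral.tendsto_integral_filter_of_dominated_convergence (fun _ => M)
        (Eventually.of_forall fun k => (measurable_futureSup hM hs x₀ _).aestronglyMeasurable)
        (Eventually.of_forall fun k => ae_of_all _ fun s _ => hnorm x₀ _ s ?_)
        intervalIntegrable_const
        (ae_of_all _ fun s _ => tendsto_futureSup hM hs husc x₀ s)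
      exact Nat.one_div_pos_of_nat
    obtain ⟨k, hk⟩ := (hlim.eventually
      (gt_mem_nhds (show (∫ s in (a - h)..b, y x₀ s) <
        (∫ s in (a - h)..b, y x₀ s) + h * ε / 2 by have := mul_pos hh hε; linarith))).exists
    set δ : ℝ := 1 / ((k : ℝ) + 1) with hδdef
    have hδ : 0 < δ := Nat.one_div_pos_of_nat
    have hnear : ∀ᶠ x in 𝓝 x₀, (∫ s in (a - h)..b, y x₀ s) - h * ε / 2 <
        ∫ s in (a - h)..b, y x s :=
      (hIcont.tendsto x₀).eventually (lt_mem_nhds (by have := mul_pos hh hε; linarith))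
    refine ⟨{x | dist x x₀ < δ ∧ (∫ s in (a - h)..b, y x₀ s) - h * ε / 2 <
        ∫ s in (a - h)..b, y x s}, ?_, ?_⟩
    · rw [nhdsWithin_univ]
      exact Filter.inter_mem (Metric.ball_mem_nhds x₀ hδ) hnear
    obtain ⟨N₀, hN₀⟩ := exists_nat_gt (h / δ)
    refine ⟨N₀, fun N hN hNpos x hxU t ht => ?_⟩
    have hNr : (0 : ℝ) < N := by exact_mod_cast hNpos
    have hcell : h / N < δ := by
      rw [div_lt_iff₀ hNr]
      have h1 : h / δ < N := hN₀.trans_le (by exact_mod_cast hN)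
      rw [div_lt_iff₀ hδ] at h1
      linarith
    have hcell0 : 0 < h / N := div_pos hh hNr
    have hterm : ∀ i : ℕ, y x (t - i * (h / N)) * (h / N) ≤
        ∫ s in (t - ((i + 1 : ℕ) : ℝ) * (h / N))..(t - i * (h / N)), futureSup y x₀ δ s := by
      intro i
      have hlen : t - i * (h / N) - (t - ((i + 1 : ℕ) : ℝ) * (h / N)) = h / N := by
        push_cast; ring
      have h1 : ∫ _s in (t - ((i + 1 : ℕ) : ℝ) * (h / N))..(t - i * (h / N)),
          y x (t - i * (h / N)) = y x (t - i * (h / N)) * (h / N) := by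
        rw [intervalIntegral.integral_const, hlen, smul_eq_mul, mul_comm]
      rw [← h1]
      refine intervalIntegral.integral_mono_on_of_le_Ioo (by linarith) intervalIntegrable_const
        (hInt _ _ _ _ hδ) fun s hs' => ?_
      exact le_futureSup hM hxU.1 hs'.2 (by linarith [hs'.1])
    have hsum : (∑ i ∈ Finset.range N, y x (t - i * (h / N))) * (h / N) ≤
        ∫ s in (t - h)..t, futureSup y x₀ δ s := by
      rw [Finset.sum_mul]
      refine (Finset.sum_le_sum fun i _ => hterm i).trans ?_
      have h1 := intervalIntegral.sum_integral_adjacent_intervals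
        (f := futureSup y x₀ δ) (μ := volume) (a := fun i : ℕ => t - i * (h / N)) (n := N)
        fun i _ => hInt _ _ _ _ hδ
      have h2 : ∑ i ∈ Finset.range N,
          ∫ s in (t - ((i + 1 : ℕ) : ℝ) * (h / N))..(t - i * (h / N)), futureSup y x₀ δ s =
          -∑ i ∈ Finset.range N,
            ∫ s in (t - i * (h / N))..(t - ((i + 1 : ℕ) : ℝ) * (h / N)), futureSup y x₀ δ s := by
        rw [← Finset.sum_neg_distrib]
        exact Finset.sum_congr rfl fun i _ => intervalIntegral.integral_symm _ _
      rw [h2, h1, ← intervalIntegral.integral_symm]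
      have h3 : t - (N : ℝ) * (h / N) = t - h := by field_simp
      rw [h3]
      simp
    have hbig : ∫ s in (t - h)..t, futureSup y x₀ δ s ≤
        ∫ s in (a - h)..b, futureSup y x₀ δ s := by
      refine intervalIntegral.integral_mono_interval (by linarith [ht.1]) (by linarith) ht.2 ?_
        (hInt _ _ _ _ hδ)
      refine ae_of_all _ fun s => ?_
      exact (h0 x₀ (s + δ / 2)).trans
        (le_futureSup hM (by simpa using hδ) (by linarith) (by linarith))
    have hfin : (∑ i ∈ Finset.range N, y x (t - i * (h / N))) * (h / N) ≤
        (∫ s in (a - h)..b, y x s) + h * ε := by linarith [hxU.2]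
    have h4 : (1 / (N : ℝ)) * ∑ i ∈ Finset.range N, y x (t - i * (h / N)) =
        ((∑ i ∈ Finset.range N, y x (t - i * (h / N))) * (h / N)) / h := by
      generalize ∑ i ∈ Finset.range N, y x (t - i * (h / N)) = S
      field_simp
    rw [h4, div_add' _ _ _ hh.ne']
    gcongr
    linarith

end TimeAverages

section ForwardRegularity

open Filter Topology

variable {m : ℕ} {lam Lam : ℝ} {A : Spc m → Matrix (Fin (m + 1)) (Fin (m + 1)) ℝ}

/-- The projection of the time axis onto `[t₀, t₁]`. -/
def timeClamp (t₀ t₁ s : ℝ) : ℝ := max t₀ (min s t₁)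

theorem continuous_timeClamp (t₀ t₁ : ℝ) : Continuous (timeClamp t₀ t₁) := by
  unfold timeClamp; fun_prop

theorem monotone_timeClamp (t₀ t₁ : ℝ) : Monotone (timeClamp t₀ t₁) := fun _ _ h =>
  max_le_max le_rfl (min_le_min h le_rfl)

theorem timeClamp_mem {t₀ t₁ : ℝ} (h : t₀ ≤ t₁) (s : ℝ) : timeClamp t₀ t₁ s ∈ Set.Icc t₀ t₁ :=
  ⟨le_max_left _ _, max_le h (min_le_right _ _)⟩

theorem timeClamp_of_mem {t₀ t₁ s : ℝ} (h : s ∈ Set.Icc t₀ t₁) : timeClamp t₀ t₁ s = s := by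
  rw [timeClamp, min_eq_left h.2, max_eq_right h.1]

theorem timeClamp_of_le {t₀ t₁ s : ℝ} (h : s ≤ t₀) : timeClamp t₀ t₁ s = t₀ :=
  max_eq_left ((min_le_left _ _).trans h)

theorem IsElliptic.traceHess_paraboloid_le (hA : IsElliptic lam Lam A) {k : ℝ} (hk : 0 ≤ k)
    (x x₀ : Spc m) (b : ℝ) :
    traceHess (A x) (fun z => k * (‖z - x₀‖ ^ 2 + b)) x ≤ k * (2 * (m + 1) * Lam) := by
  have h1 : ContDiffAt ℝ 2 (fun z : Spc m => ‖z - x₀‖ ^ 2) x :=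
    (contDiff_norm_sub_sq x₀).contDiffAt
  rw [traceHess_const_mul _ _ (h1.add contDiffAt_const), traceHess_add _ h1 contDiffAt_const,
    traceHess_norm_sub_sq, traceHess_const]
  have := (hA.isEllipticMatrix x).sum_diag_le
  refine mul_le_mul_of_nonneg_left ?_ hk
  linarith

set_option maxHeartbeats 400000 in
theorem le_paraboloid_of_forward_usc (hlam : 0 ≤ lam) (hLam : 0 ≤ Lam)
    (hA : IsElliptic lam Lam A) {u : Spc m × ℝ → ℝ} {x₀ : Spc m} {ρ t₀ t₁ M : ℝ} (hρ : 0 < ρ)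
    (ht : t₀ ≤ t₁) (hM : 0 < M) {F : Set (Spc m)} (hx₀ : x₀ ∈ F)
    (hu : SolvesL A u (Metric.closedBall x₀ ρ ×ˢ Set.Icc t₀ t₁))
    (hle : ∀ x ∈ Metric.closedBall x₀ ρ, ∀ t ∈ Set.Icc t₀ t₁, u (x, t) ≤ M)
    (hinit : ∀ x ∈ Metric.closedBall x₀ ρ, u (x, t₀) ≤ 0)
    (hFu : ∀ x ∈ F, ∀ t ∈ Set.Icc t₀ t₁, u (x, t) ≤ 0)
    (husc : ∀ x ∈ Metric.closedBall x₀ ρ, x ∉ F → ∀ t ∈ Set.Icc t₀ t₁,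
      UpperSemicontinuousWithinAt u {q | t ≤ q.2} (x, t)) :
    ∀ x ∈ Metric.closedBall x₀ ρ, ∀ t ∈ Set.Icc t₀ t₁,
      u (x, t) ≤ M / ρ ^ 2 * (‖x - x₀‖ ^ 2 + (2 * (m + 1) * Lam + 1) * (t - t₀)) := by
  set C : ℝ := 2 * (m + 1) * Lam + 1 with hC
  have hC0 : 0 < C := by positivity
  set k : ℝ := M / ρ ^ 2 with hk
  have hk0 : 0 < k := by positivity
  set φ : Spc m × ℝ → ℝ := fun q => k * (‖q.1 - x₀‖ ^ 2 + C * (q.2 - t₀)) with hφ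
  have hφcont : Continuous φ := by fun_prop
  set B := Metric.closedBall x₀ ρ with hB
  have hcl := timeClamp_mem ht
  set y : Spc m → ℝ → ℝ := fun x s => max (u (x, timeClamp t₀ t₁ s)) 0 with hy
  have hy0 : ∀ x s, 0 ≤ y x s := fun x s => le_max_right _ _
  have hyM : ∀ x ∈ B, ∀ s, y x s ≤ M := fun x hx s => max_le (hle x hx _ (hcl s)) hM.le
  have hyF : ∀ x ∈ F, ∀ s, y x s = 0 := fun x hx s => max_eq_right (hFu x hx _ (hcl s))
  have hyinit : ∀ x ∈ B, ∀ s ≤ t₀, y x s = 0 := fun x hx s hs => by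
    simp only [hy, timeClamp_of_le hs]; exact max_eq_right (hinit x hx)
  have hyx : ∀ s, ∀ x ∈ B, ContinuousAt (fun z => y z s) x := fun s x hx =>
    (hu (x, timeClamp t₀ t₁ s) ⟨hx, hcl s⟩).1.continuousAt.max continuousAt_const
  have hys : ∀ x ∈ B, Continuous (y x) := fun x hx => by
    refine Continuous.max (continuous_iff_continuousAt.2 fun s => ?_) continuous_const
    exact ContinuousAt.comp (g := fun s => u (x, s)) (f := timeClamp t₀ t₁)
      (hu (x, timeClamp t₀ t₁ s) ⟨hx, hcl s⟩).2.continuousAt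
      (continuous_timeClamp t₀ t₁).continuousAt
  have hyusc : ∀ x ∈ B, x ∉ F → ∀ s,
      UpperSemicontinuousWithinAt (fun q : Spc m × ℝ => y q.1 q.2) {q | s ≤ q.2} (x, s) := by
    intro x hx hxF s c hc
    have h1 : Tendsto (fun q : Spc m × ℝ => (q.1, timeClamp t₀ t₁ q.2))
        (𝓝[{q | s ≤ q.2}] (x, s))
        (𝓝[{q | timeClamp t₀ t₁ s ≤ q.2}] (x, timeClamp t₀ t₁ s)) := by
      refine tendsto_nhdsWithin_of_tendsto_nhds_of_eventually_within _ ?_ ?_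
      · have : Continuous fun q : Spc m × ℝ => (q.1, timeClamp t₀ t₁ q.2) :=
          continuous_fst.prodMk ((continuous_timeClamp t₀ t₁).comp continuous_snd)
        exact (this.tendsto (x, s)).mono_left nhdsWithin_le_nhds
      · filter_upwards [self_mem_nhdsWithin] with q hq
        exact monotone_timeClamp t₀ t₁ hq
    have hc' := max_lt_iff.1 hc
    filter_upwards [h1.eventually (husc x hx hxF _ (hcl s) c hc'.1)] with q hq
    exact max_lt hq hc'.2
  by_contra! hcon
  obtain ⟨x₁, hx₁, τ, hτ, hlt⟩ := hcon
  have hφ0 : ∀ x, ∀ t, t₀ ≤ t → 0 ≤ φ (x, t) := fun x t h =>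
    mul_nonneg hk0.le (add_nonneg (sq_nonneg _) (mul_nonneg hC0.le (sub_nonneg.2 h)))
  obtain ⟨ε, hε, hεeq⟩ : ∃ ε > 0, u (x₁, τ) = φ (x₁, τ) + 4 * ε :=
    ⟨(u (x₁, τ) - φ (x₁, τ)) / 4, div_pos (sub_pos.2 hlt) (by norm_num), by ring⟩
  have hy₁ : y x₁ τ = φ (x₁, τ) + 4 * ε := by
    simp only [hy, timeClamp_of_mem hτ, hεeq]
    exact max_eq_left (by linarith [hφ0 x₁ τ hτ.1])
  obtain ⟨h, hh, hclose⟩ : ∃ h > 0, ∀ s ∈ Set.Icc (τ - h) τ, φ (x₁, τ) + 3 * ε < y x₁ s := by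
    have h1 := ((hys x₁ hx₁).tendsto τ).eventually
      (lt_mem_nhds (show φ (x₁, τ) + 3 * ε < y x₁ τ by linarith))
    obtain ⟨δ, hδ, h2⟩ := Metric.eventually_nhds_iff.1 h1
    refine ⟨δ / 2, by positivity, fun s hs => h2 ?_⟩
    rw [Real.dist_eq, abs_lt]
    constructor <;> linarith [hs.1, hs.2]
  set I : Spc m → ℝ := fun x => ∫ s in (t₀ - h)..τ, y x s with hI
  have hIcont : ContinuousOn I B := by
    have : Continuous fun x : B => I x := by
      refine intervalIntegral.continuous_of_dominated_interval (bound := fun _ => M)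
        (fun x => (hys x x.2).aestronglyMeasurable)
        (fun x => MeasureTheory.ae_of_all _ fun s _ => ?_)
        intervalIntegrable_const (MeasureTheory.ae_of_all _ fun s _ => ?_)
      · rw [Real.norm_eq_abs, abs_of_nonneg (hy0 x s)]
        exact hyM x x.2 s
      · exact continuous_iff_continuousAt.2 fun x =>
          ContinuousAt.comp (g := fun z => y z s) (hyx s x x.2) continuous_subtype_val.continuousAt
    exact continuousOn_iff_continuous_domRestrict.2 this
  have hIF : ∀ x ∈ F, I x = 0 := fun x hx => by simp [hI, hyF x hx]
  have hIx₁ : ε * h ≤ I x₁ := by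
    have h1 : ∫ _s in (τ - h)..τ, ε = ε * h := by
      rw [intervalIntegral.integral_const, smul_eq_mul]; ring
    have h2 : ∫ _s in (τ - h)..τ, ε ≤ ∫ s in (τ - h)..τ, y x₁ s :=
      intervalIntegral.integral_mono_on (by linarith) intervalIntegrable_const
        ((hys x₁ hx₁).intervalIntegrable _ _) fun s hs => by
          linarith [hclose s hs, hφ0 x₁ τ hτ.1]
    have h3 : ∫ s in (τ - h)..τ, y x₁ s ≤ I x₁ :=
      intervalIntegral.integral_mono_interval (by linarith [hτ.1]) (by linarith) le_rfl
        (MeasureTheory.ae_of_all _ fun s => hy0 x₁ s) ((hys x₁ hx₁).intervalIntegrable _ _)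
    linarith
  set K : Set (Spc m) := B ∩ I ⁻¹' Set.Ici (ε * h) with hK
  have hKB : K ⊆ B := Set.inter_subset_left
  have hKF : ∀ x ∈ K, x ∉ F := fun x hx hxF => by
    have h1 : ε * h ≤ I x := hx.2
    rw [hIF x hxF] at h1
    have := mul_pos hε hh
    linarith
  have hKcomp : IsCompact K :=
    (isCompact_closedBall x₀ ρ).of_isClosed_subset
      (hIcont.preimage_isClosed_of_isClosed Metric.isClosed_closedBall isClosed_Ici) hKB
  have : CompactSpace K := isCompact_iff_compactSpace.1 hKcomp
  obtain ⟨N, hN, havg⟩ := exists_average_le_integral (X := K) (y := fun x s => y x s) (M := M)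
    (fun x s => hy0 x s) (fun x s => hyM x (hKB x.2) s) (fun x => hys x (hKB x.2))
    (fun s => continuous_iff_continuousAt.2 fun x => ContinuousAt.comp (g := fun z => y z s)
      (hyx s x (hKB x.2)) continuous_subtype_val.continuousAt)
    (fun x s c hc => by
      have h1 : Tendsto (fun q : K × ℝ => ((q.1 : Spc m), q.2)) (𝓝[{q | s ≤ q.2}] (x, s))
          (𝓝[{q | s ≤ q.2}] ((x : Spc m), s)) := by
        refine tendsto_nhdsWithin_of_tendsto_nhds_of_eventually_within _ ?_ ?_
        · have : Continuous fun q : K × ℝ => ((q.1 : Spc m), q.2) := by fun_prop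
          exact (this.tendsto (x, s)).mono_left nhdsWithin_le_nhds
        · filter_upwards [self_mem_nhdsWithin] with q hq using hq
      exact h1.eventually (hyusc x (hKB x.2) (hKF x x.2) s c hc))
    hh hε
  have hNr : (0 : ℝ) < N := by exact_mod_cast hN
  set δ : ℝ := h / N with hδ
  have hδ0 : 0 < δ := div_pos hh hNr
  have hsumle : ∀ x ∈ K, ∀ t ∈ Set.Icc t₀ τ,
      ∑ i ∈ Finset.range N, y x (t - i * δ) ≤ N * (I x / h + ε) := by
    intro x hx t ht'
    have h1 := havg ⟨x, hx⟩ t ht'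
    rw [one_div, inv_mul_le_iff₀ hNr] at h1
    exact h1
  have hidx : ∀ i ∈ Finset.range N, (0 : ℝ) ≤ i * δ ∧ i * δ ≤ h := by
    intro i hi
    have h1 : (i : ℝ) ≤ N := by exact_mod_cast (Finset.mem_range.1 hi).le
    refine ⟨by positivity, ?_⟩
    calc (i : ℝ) * δ ≤ N * δ := by gcongr
      _ = h := by rw [hδ]; field_simp
  set v : Spc m × ℝ → ℝ := fun q => ∑ i ∈ Finset.range N, (y q.1 (q.2 - i * δ) - φ q) with hv
  have hvsum : ∀ q, v q = (∑ i ∈ Finset.range N, y q.1 (q.2 - i * δ)) - N * φ q := fun q => by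
    simp [hv, Finset.sum_sub_distrib]
  have hS : IsCompact (K ×ˢ Set.Icc t₀ τ) := hKcomp.prod isCompact_Icc
  have hfinal := lt_of_forall_slice_max hS (v := v) (θ := N * (2 * ε)) ?_ ?_ (x₁, τ)
    ⟨⟨hx₁, hIx₁⟩, ⟨hτ.1, le_rfl⟩⟩
  · rw [hvsum] at hfinal
    have h1 : N * (φ (x₁, τ) + 3 * ε) ≤ ∑ i ∈ Finset.range N, y x₁ (τ - i * δ) := by
      have h2 : ∑ i ∈ Finset.range N, (φ (x₁, τ) + 3 * ε) ≤
          ∑ i ∈ Finset.range N, y x₁ (τ - i * δ) :=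
        Finset.sum_le_sum fun i hi => (hclose _ ⟨by linarith [(hidx i hi).2],
          by linarith [(hidx i hi).1]⟩).le
      rwa [Finset.sum_const, Finset.card_range, nsmul_eq_mul] at h2
    have := mul_pos hNr hε
    simp only at hfinal
    nlinarith
  · rintro ⟨x, t⟩ ⟨hx, ht'⟩
    have h1 : UpperSemicontinuousWithinAt v {q | t ≤ q.2} (x, t) := by
      refine upperSemicontinuousWithinAt_sum fun i _ => ?_
      have h2 : UpperSemicontinuousWithinAt (fun q : Spc m × ℝ => y q.1 (q.2 - i * δ))
          {q | t ≤ q.2} (x, t) := by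
        intro c hc
        have h3 : Tendsto (fun q : Spc m × ℝ => (q.1, q.2 - i * δ)) (𝓝[{q | t ≤ q.2}] (x, t))
            (𝓝[{q | t - i * δ ≤ q.2}] (x, t - i * δ)) := by
          refine tendsto_nhdsWithin_of_tendsto_nhds_of_eventually_within _ ?_ ?_
          · have : Continuous fun q : Spc m × ℝ => (q.1, q.2 - i * δ) := by fun_prop
            exact (this.tendsto (x, t)).mono_left nhdsWithin_le_nhds
          · filter_upwards [self_mem_nhdsWithin] with q hq
            exact sub_le_sub_right (show t ≤ q.2 from hq) _
        exact h3.eventually (hyusc x (hKB hx) (hKF x hx) _ c hc)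
      have h4 := h2.add (hφcont.neg.continuousWithinAt (x := (x, t))
        (s := {q | t ≤ q.2})).upperSemicontinuousWithinAt
      simp only [sub_eq_add_neg] at h4 ⊢
      exact h4
    intro c hc
    exact (h1 c hc).filter_mono (nhdsWithin_mono _ Set.inter_subset_right)
  · rintro ⟨x, t⟩ ⟨hx, ht'⟩ hθ hmax
    have hxF := hKF x hx
    have hxx₀ : x ≠ x₀ := fun h0 => hxF (h0 ▸ hx₀)
    have hφpos : 0 < φ (x, t) := by
      have : 0 < ‖x - x₀‖ := norm_pos_iff.2 (sub_ne_zero.2 hxx₀)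
      have h1 : 0 ≤ C * (t - t₀) := mul_nonneg hC0.le (sub_nonneg.2 ht'.1)
      exact mul_pos hk0 (by positivity)
    rw [hvsum] at hθ
    have hYle := hsumle x hx t ht'
    simp only at hθ
    have hstrict : ε * h < I x := by
      have h1 : N * (φ (x, t) + 2 * ε) ≤ N * (I x / h + ε) := by linarith
      have h2 := le_of_mul_le_mul_left h1 hNr
      have h3 : ε < I x / h := by linarith
      rwa [lt_div_iff₀ hh] at h3
    have htt₀ : t₀ < t := by
      refine lt_of_le_of_ne ht'.1 fun h0 => ?_
      have h1 : ∑ i ∈ Finset.range N, y x (t - i * δ) = 0 :=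
        Finset.sum_eq_zero fun i hi => hyinit x (hKB hx) _ (by linarith [(hidx i hi).1])
      rw [h1] at hθ
      have := mul_pos hNr hε
      have := mul_pos hNr hφpos
      linarith
    have hball : x ∈ Metric.ball x₀ ρ := by
      by_contra hnot
      have h1 : ρ ≤ ‖x - x₀‖ := by simpa [dist_eq_norm] using hnot
      have h2 : M ≤ φ (x, t) := by
        have h3 : ρ ^ 2 ≤ ‖x - x₀‖ ^ 2 := by gcongr
        have h4 : 0 ≤ C * (t - t₀) := mul_nonneg hC0.le (sub_nonneg.2 ht'.1)
        calc M = k * ρ ^ 2 := by rw [hk]; field_simp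
          _ ≤ k * (‖x - x₀‖ ^ 2 + C * (t - t₀)) := by gcongr; linarith
      have h5 : ∑ i ∈ Finset.range N, y x (t - i * δ) ≤ ∑ i ∈ Finset.range N, M :=
        Finset.sum_le_sum fun i _ => hyM x (hKB hx) _
      simp only [Finset.sum_const, Finset.card_range, nsmul_eq_mul] at h5
      have := mul_pos hNr hε
      have h6 : N * M ≤ N * φ (x, t) := by gcongr
      linarith
    have hBnhds : B ∈ 𝓝 x := mem_of_superset (Metric.isOpen_ball.mem_nhds hball)
      Metric.ball_subset_closedBall
    have hKnhds : ∀ᶠ z in 𝓝 x, z ∈ K := by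
      have h1 : ContinuousAt I x := hIcont.continuousAt hBnhds
      filter_upwards [hBnhds, h1.eventually (lt_mem_nhds hstrict)] with z h2 h3
      exact ⟨h2, h3.le⟩
    set P : Finset ℕ := (Finset.range N).filter fun i => 0 < u (x, timeClamp t₀ t₁ (t - i * δ))
      with hP
    have hPmem : ∀ i ∈ P, t - i * δ ∈ Set.Ioc t₀ t := by
      intro i hi
      rw [hP, Finset.mem_filter] at hi
      refine ⟨?_, by linarith [(hidx i hi.1).1]⟩
      by_contra! h1
      rw [timeClamp_of_le h1] at hi
      exact absurd hi.2 (not_lt.2 (hinit x (hKB hx)))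
    have hPIcc : ∀ i ∈ P, t - i * δ ∈ Set.Icc t₀ t₁ := fun i hi =>
      ⟨(hPmem i hi).1.le, (hPmem i hi).2.trans (ht'.2.trans hτ.2)⟩
    set Yp : Spc m × ℝ → ℝ := fun q => ∑ i ∈ P, u (q.1, q.2 - i * δ) with hYp
    have hYple : ∀ z s, (∀ i ∈ P, s - i * δ ∈ Set.Icc t₀ t₁) →
        Yp (z, s) ≤ ∑ i ∈ Finset.range N, y z (s - i * δ) := by
      intro z s hz
      calc Yp (z, s) ≤ ∑ i ∈ P, y z (s - i * δ) := Finset.sum_le_sum fun i hi => by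
            simp only [hy, timeClamp_of_mem (hz i hi)]; exact le_max_left _ _
        _ ≤ _ := Finset.sum_le_sum_of_subset_of_nonneg (Finset.filter_subset _ _)
            fun i _ _ => hy0 _ _
    have hYpeq : Yp (x, t) = ∑ i ∈ Finset.range N, y x (t - i * δ) := by
      change ∑ i ∈ P, u (x, t - i * δ) = _
      rw [hP, Finset.sum_filter]
      refine Finset.sum_congr rfl fun i hi => ?_
      split_ifs with h1
      · have : i ∈ P := by rw [hP, Finset.mem_filter]; exact ⟨hi, h1⟩
        rw [timeClamp_of_mem (hPIcc i this)] at h1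
        simp only [hy, timeClamp_of_mem (hPIcc i this)]
        exact (max_eq_left h1.le).symm
      · exact (max_eq_right (not_lt.1 h1)).symm
    have hlocmax : IsLocalMax (fun z => Yp (z, t) - N * φ (z, t)) x := by
      filter_upwards [hKnhds] with z hz
      have h1 := hmax (z, t) ⟨hz, ht'⟩ rfl
      rw [hvsum, hvsum] at h1
      have h2 := hYple z t hPIcc
      rw [hYpeq]
      simp only at h1
      linarith
    have hsol : ∀ i ∈ P, ContDiffAt ℝ 2 (fun z => u (z, t - i * δ)) x ∧
        HasDerivAt (fun s => u (x, s)) (Lop A u (x, t - i * δ)) (t - i * δ) :=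
      fun i hi => hu (x, t - i * δ) ⟨hKB hx, hPIcc i hi⟩
    have hYC2 : ContDiffAt ℝ 2 (fun z => Yp (z, t)) x :=
      ContDiffAt.sum fun i hi => (hsol i hi).1
    have hφC2' : ContDiffAt ℝ 2 (fun z => φ (z, t)) x := by
      change ContDiffAt ℝ 2 (fun z => k * (‖z - x₀‖ ^ 2 + C * (t - t₀))) x
      exact contDiffAt_const.mul ((contDiff_norm_sub_sq x₀).contDiffAt.add contDiffAt_const)
    have hφC2 : ContDiffAt ℝ 2 (fun z => N * φ (z, t)) x := contDiffAt_const.mul hφC2'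
    have htr := (hA.isEllipticMatrix x).traceHess_nonpos hlam (hYC2.sub hφC2) hlocmax
    rw [traceHess_sub _ hYC2 hφC2, traceHess_const_mul _ _ hφC2'] at htr
    have htrY : traceHess (A x) (fun z => Yp (z, t)) x = ∑ i ∈ P, Lop A u (x, t - i * δ) :=
      traceHess_sum _ _ fun i hi => (hsol i hi).1
    have htrφ : traceHess (A x) (fun z => φ (z, t)) x ≤ k * (2 * (m + 1) * Lam) := by
      change traceHess (A x) (fun z => k * (‖z - x₀‖ ^ 2 + C * (t - t₀))) x ≤ _
      exact hA.traceHess_paraboloid_le hk0.le x x₀ (C * (t - t₀))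
    have hderiv : HasDerivAt (fun s => Yp (x, s) - N * φ (x, s))
        ((∑ i ∈ P, Lop A u (x, t - i * δ)) - N * (k * C)) t := by
      refine HasDerivAt.sub (HasDerivAt.fun_sum fun i hi => ?_) ?_
      · exact HasDerivAt.comp_sub_const (f := fun s => u (x, s)) t (i * δ) (hsol i hi).2
      · have h1 : HasDerivAt (fun s => C * (s - t₀)) C t := by
          simpa using ((hasDerivAt_id t).sub_const t₀).const_mul C
        exact ((h1.const_add (‖x - x₀‖ ^ 2)).const_mul k).const_mul (N : ℝ)
    have hneg : (∑ i ∈ P, Lop A u (x, t - i * δ)) - N * (k * C) < 0 := by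
      rw [htrY] at htr
      have h1 : N * traceHess (A x) (fun z => φ (z, t)) x ≤ N * (k * (2 * (m + 1) * Lam)) := by
        gcongr
      have h2 : N * (k * C) = N * (k * (2 * (m + 1) * Lam)) + N * k := by rw [hC]; ring
      have := mul_pos hNr hk0
      linarith
    have hev1 : ∀ᶠ s in 𝓝[<] t, Yp (x, t) - N * φ (x, t) < Yp (x, s) - N * φ (x, s) := by
      have h1 := (hasDerivAt_iff_tendsto_slope.1 hderiv).eventually (gt_mem_nhds hneg)
      have h2 : ∀ᶠ s in 𝓝[<] t, slope (fun s => Yp (x, s) - N * φ (x, s)) t s < 0 :=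
        h1.filter_mono (nhdsWithin_mono _ fun s hs => ne_of_lt hs)
      filter_upwards [h2, self_mem_nhdsWithin] with s hs hst
      rw [slope_def_field] at hs
      have h3 : s - t < 0 := sub_neg.2 hst
      by_contra! h4
      exact absurd hs (not_lt.2 (div_nonneg_of_nonpos (by linarith) h3.le))
    have hev2 : ∀ᶠ s in 𝓝[<] t, ∀ i ∈ P, t₀ < s - i * δ := by
      rw [Filter.eventually_all_finset]
      intro i hi
      have h1 : ContinuousAt (fun s : ℝ => s - i * δ) t := by fun_prop
      exact (h1.eventually (lt_mem_nhds (hPmem i hi).1)).filter_mono nhdsWithin_le_nhds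
    have hev3 : ∀ᶠ s in 𝓝[<] t, s ∈ Set.Ioo t₀ t := Ioo_mem_nhdsLT htt₀
    obtain ⟨s, h1, h2, h3⟩ := (hev1.and (hev2.and hev3)).exists
    refine ⟨(x, s), ⟨hx, h3.1.le, h3.2.le.trans ht'.2⟩, h3.2, ?_⟩
    rw [hvsum]
    have h4 := hYple x s fun i hi => ⟨(h2 i hi).le, by
      have := (hPIcc i hi).2
      linarith [h3.2]⟩
    rw [hYpeq] at h1
    simp only
    linarith

end ForwardRegularity

section ForwardSemicontinuity

open Filter Topology

theorem exists_isOpen_inter_subset_of_subset_iUnion {X : Type*} [TopologicalSpace X] [T2Space X]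
    [LocallyCompactSpace X] {S : Set X} (hS : IsLocallyClosed S) (hne : S.Nonempty)
    {E : ℕ → Set X} (hcover : S ⊆ ⋃ k, E k)
    (hclosed : ∀ k, ∀ p ∈ S, p ∈ closure (S ∩ E k) → p ∈ E k) :
    ∃ k, ∃ p ∈ S, ∃ V, IsOpen V ∧ p ∈ V ∧ S ∩ V ⊆ E k := by
  have : LocallyCompactSpace S := hS.locallyCompactSpace
  have : Nonempty S := hne.to_subtype
  obtain ⟨k, z, hz⟩ := nonempty_interior_of_iUnion_of_closed
    (f := fun k => ((↑) : S → X) ⁻¹' E k) (fun k => by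
      refine isClosed_of_closure_subset fun z hz => hclosed k z z.2 ?_
      have h1 := closure_subtype.1 hz
      rwa [Subtype.image_preimage_coe] at h1)
    (by
      refine Set.eq_univ_of_forall fun z => ?_
      obtain ⟨k, hk⟩ := Set.mem_iUnion.1 (hcover z.2)
      exact Set.mem_iUnion.2 ⟨k, hk⟩)
  obtain ⟨V, hV, hVeq⟩ := isOpen_induced_iff.1 (isOpen_interior
    (s := ((↑) : S → X) ⁻¹' E k))
  refine ⟨k, z, z.2, V, hV, ?_, fun x hx => ?_⟩
  · have : z ∈ ((↑) : S → X) ⁻¹' V := by rw [hVeq]; exact hz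
    exact this
  · have : (⟨x, hx.1⟩ : S) ∈ interior (((↑) : S → X) ⁻¹' E k) := by
      rw [← hVeq]; exact hx.2
    have h2 : (⟨x, hx.1⟩ : S) ∈ ((↑) : S → X) ⁻¹' E k := interior_subset this
    exact h2

variable {m : ℕ} {lam Lam : ℝ} {A : Spc m → Matrix (Fin (m + 1)) (Fin (m + 1)) ℝ}

theorem SolvesL.const_sub {w : Spc m × ℝ → ℝ} {Ω : Set (Spc m × ℝ)} (hw : SolvesL A w Ω) (c : ℝ) :
    SolvesL A (fun p => c - w p) Ω := by
  intro p hp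
  obtain ⟨h1, h2⟩ := hw p hp
  refine ⟨contDiffAt_const.sub h1, ?_⟩
  have h3 : Lop A (fun p => c - w p) p = -Lop A w p := by
    rw [Lop_eq_traceHess, Lop_eq_traceHess]
    rw [traceHess_sub _ contDiffAt_const h1, traceHess_const, zero_sub]
  rw [h3]
  exact h2.const_sub c

theorem exists_ball_prod_Ioo_subset {V : Set (Spc m × ℝ)} (hV : IsOpen V) {p : Spc m × ℝ}
    (hp : p ∈ V) : ∃ R > 0, Metric.ball p.1 R ×ˢ Set.Ioo (p.2 - R) (p.2 + R) ⊆ V := by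
  obtain ⟨R, hR, h⟩ := Metric.isOpen_iff.1 hV p hp
  refine ⟨R, hR, fun q hq => h ?_⟩
  rw [Metric.mem_ball, Prod.dist_eq, max_lt_iff, Real.dist_eq, abs_lt]
  exact ⟨hq.1, by linarith [hq.2.1], by linarith [hq.2.2]⟩

theorem SolvesL.lowerSemicontinuousWithinAt_of_slope_bound (hlam : 0 ≤ lam) (hLam : 0 ≤ Lam)
    (hA : IsElliptic lam Lam A) {w : Spc m × ℝ → ℝ} {Ω S U : Set (Spc m × ℝ)}
    (hw : SolvesL A w Ω) {M κ : ℝ} (hM : ∀ p ∈ Ω, -M ≤ w p) (hκ : 0 ≤ κ)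
    (hgood : ∀ p ∈ Ω, p ∉ S → LowerSemicontinuousWithinAt w {q | p.2 ≤ q.2} p)
    (hU : IsOpen U) (hUΩ : U ⊆ Ω)
    (hslope : ∀ p ∈ S ∩ U, ∀ s, (p.1, s) ∈ U → |w (p.1, s) - w p| ≤ κ * |s - p.2|)
    {p : Spc m × ℝ} (hpS : p ∈ S) (hpU : p ∈ U) :
    LowerSemicontinuousWithinAt w {q | p.2 ≤ q.2} p := by
  intro c hc
  obtain ⟨x₀, t₀⟩ := p
  set ε : ℝ := (w (x₀, t₀) - c) / 4 with hε
  have hε0 : 0 < ε := div_pos (sub_pos.2 hc) (by norm_num)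
  obtain ⟨R, hR, hRU⟩ := exists_ball_prod_Ioo_subset hU hpU
  simp only at hRU
  have hcont : ∀ᶠ x in 𝓝 x₀, w (x₀, t₀) - ε < w (x, t₀) :=
    (hw _ (hUΩ hpU)).1.continuousAt.eventually (lt_mem_nhds (by simp only; linarith))
  obtain ⟨ρ', hρ', hρ'w⟩ := Metric.eventually_nhds_iff.1 hcont
  obtain ⟨ρ, hρ, hρlt⟩ := exists_between (lt_min hρ' hR)
  obtain ⟨hρρ', hρR⟩ := lt_min_iff.1 hρlt
  obtain ⟨τ, hτ, hτlt⟩ := exists_between (lt_min hR (div_pos hε0 (show 0 < κ + 1 by linarith)))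
  obtain ⟨hτR, hτε⟩ := lt_min_iff.1 hτlt
  have hκτ : κ * τ ≤ ε := by
    rw [lt_div_iff₀ (by linarith)] at hτε
    nlinarith
  have hbox : ∀ x ∈ Metric.closedBall x₀ ρ, ∀ t ∈ Set.Icc t₀ (t₀ + τ), (x, t) ∈ U :=
    fun x hx t ht => hRU ⟨(Metric.mem_closedBall.1 hx).trans_lt hρR,
      by simp only; linarith [ht.1], by simp only; linarith [ht.2]⟩
  have hinit : ∀ x ∈ Metric.closedBall x₀ ρ, w (x₀, t₀) - ε < w (x, t₀) := fun x hx =>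
    hρ'w ((Metric.mem_closedBall.1 hx).trans_lt hρρ')
  set F : Set (Spc m) := {x | x ∈ Metric.closedBall x₀ ρ ∧
    ∃ t ∈ Set.Icc t₀ (t₀ + τ), (x, t) ∈ S} with hF
  have hdist : ∀ s ∈ Set.Icc t₀ (t₀ + τ), ∀ t ∈ Set.Icc t₀ (t₀ + τ), κ * |s - t| ≤ ε :=
    fun s hs t ht => by
      refine le_trans (mul_le_mul_of_nonneg_left ?_ hκ) hκτ
      rw [abs_le]
      constructor <;> linarith [hs.1, hs.2, ht.1, ht.2]
  have ht₀ : t₀ ∈ Set.Icc t₀ (t₀ + τ) := ⟨le_rfl, by linarith⟩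
  have hFw : ∀ x ∈ F, ∀ s ∈ Set.Icc t₀ (t₀ + τ), w (x₀, t₀) - 3 * ε - w (x, s) ≤ 0 := by
    rintro x ⟨hx, t, ht, hxt⟩ s hs
    have h1 := (abs_le.1 ((hslope (x, t) ⟨hxt, hbox x hx t ht⟩ s (hbox x hx s hs)).trans
      (hdist s hs t ht))).1
    have h2 := (abs_le.1 ((hslope (x, t) ⟨hxt, hbox x hx t ht⟩ t₀ (hbox x hx t₀ ht₀)).trans
      (hdist t₀ ht₀ t ht))).2
    linarith [hinit x hx]
  have hmain := le_paraboloid_of_forward_usc hlam hLam hA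
    (u := fun p => (w (x₀, t₀) - 3 * ε) - w p) (M := max (w (x₀, t₀) - 3 * ε + M) 1) hρ
    (show t₀ ≤ t₀ + τ by linarith) (lt_max_of_lt_right one_pos)
    (show x₀ ∈ F from ⟨Metric.mem_closedBall_self hρ.le, t₀, ht₀, hpS⟩)
    (fun q hq => (hw.const_sub _) q (hUΩ (hbox q.1 hq.1 q.2 hq.2)))
    (fun x hx t ht => le_max_of_le_left (by linarith [hM _ (hUΩ (hbox x hx t ht))]))
    (fun x hx => by linarith [hinit x hx]) hFw
    (fun x hx hxF t ht c' hc' => by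
      have h1 : (x, t) ∉ S := fun h => hxF ⟨hx, t, ht, h⟩
      have h2 := hgood (x, t) (hUΩ (hbox x hx t ht)) h1 (w (x₀, t₀) - 3 * ε - c')
        (by simp only at hc'; linarith)
      filter_upwards [h2] with q hq
      linarith)
  have hφ : ContinuousAt (fun q : Spc m × ℝ => max (w (x₀, t₀) - 3 * ε + M) 1 / ρ ^ 2 *
      (‖q.1 - x₀‖ ^ 2 + (2 * (m + 1) * Lam + 1) * (q.2 - t₀))) (x₀, t₀) := by fun_prop
  have hsmall : ∀ᶠ q in 𝓝 (x₀, t₀), max (w (x₀, t₀) - 3 * ε + M) 1 / ρ ^ 2 *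
      (‖q.1 - x₀‖ ^ 2 + (2 * (m + 1) * Lam + 1) * (q.2 - t₀)) < ε :=
    hφ.eventually (gt_mem_nhds (by simpa using hε0))
  have hball : ∀ᶠ q : Spc m × ℝ in 𝓝 (x₀, t₀), q.1 ∈ Metric.closedBall x₀ ρ :=
    continuousAt_fst.eventually (Metric.closedBall_mem_nhds x₀ hρ)
  have htime : ∀ᶠ q : Spc m × ℝ in 𝓝 (x₀, t₀), q.2 < t₀ + τ :=
    continuousAt_snd.eventually (gt_mem_nhds (by simp only; linarith))
  filter_upwards [nhdsWithin_le_nhds hsmall, nhdsWithin_le_nhds hball,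
    nhdsWithin_le_nhds htime, self_mem_nhdsWithin] with q h1 h2 h3 h4
  have h5 := hmain q.1 h2 q.2 ⟨h4, h3.le⟩
  have h6 : w (q.1, q.2) = w q := rfl
  linarith

/-- A pointwise solution which is bounded below is lower semicontinuous forward in time, even
though no joint continuity in space and time is assumed. -/
theorem SolvesL.lowerSemicontinuousWithinAt (hlam : 0 ≤ lam) (hLam : 0 ≤ Lam)
    (hA : IsElliptic lam Lam A) {w : Spc m × ℝ → ℝ} {Ω : Set (Spc m × ℝ)} (hΩ : IsOpen Ω)
    (hw : SolvesL A w Ω) {M : ℝ} (hM : ∀ p ∈ Ω, -M ≤ w p) :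
    ∀ p ∈ Ω, LowerSemicontinuousWithinAt w {q | p.2 ≤ q.2} p := by
  set G : Set (Spc m × ℝ) := {p | LowerSemicontinuousWithinAt w {q | p.2 ≤ q.2} p} with hG
  suffices hsub : Ω ⊆ interior G from fun p hp => interior_subset (hsub hp)
  by_contra hnot
  obtain ⟨p₀, hp₀, hp₀G⟩ := Set.not_subset.1 hnot
  obtain ⟨R, hR, hRΩ⟩ := exists_ball_prod_Ioo_subset hΩ hp₀
  set W : Set (Spc m × ℝ) := Metric.ball p₀.1 R ×ˢ Set.Ioo (p₀.2 - R) (p₀.2 + R) with hW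
  have hWopen : IsOpen W := Metric.isOpen_ball.prod isOpen_Ioo
  have hp₀W : p₀ ∈ W := ⟨Metric.mem_ball_self hR, by linarith, by linarith⟩
  set S : Set (Spc m × ℝ) := W ∩ (interior G)ᶜ with hS
  have hSlc : IsLocallyClosed S :=
    hWopen.isLocallyClosed.inter isOpen_interior.isClosed_compl.isLocallyClosed
  have hline : ∀ p ∈ W, ∀ s ∈ Set.Ioo (p₀.2 - R) (p₀.2 + R), (p.1, s) ∈ W :=
    fun p hp s hs => ⟨hp.1, hs⟩
  set E : ℕ → Set (Spc m × ℝ) := fun k => {p | ∀ s ∈ Set.Ioo (p₀.2 - R) (p₀.2 + R),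
    |s - p.2| < 1 / (k + 1) → |w (p.1, s) - w p| ≤ k * |s - p.2|} with hE
  have hcover : S ⊆ ⋃ k, E k := by
    intro p hp
    have hd := (hw p (hRΩ hp.1)).2
    have hO := hd.differentiableAt.isBigO_sub
    obtain ⟨c, hc⟩ := hO.bound
    obtain ⟨δ, hδ, hδc⟩ := Metric.eventually_nhds_iff.1 hc
    obtain ⟨k₁, hk₁⟩ := exists_nat_gt c
    obtain ⟨k₂, hk₂⟩ := exists_nat_one_div_lt hδ
    refine Set.mem_iUnion.2 ⟨max k₁ k₂, fun s _ hs => ?_⟩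
    have h1 : (1 : ℝ) / ((max k₁ k₂ : ℕ) + 1) ≤ 1 / (k₂ + 1) := by
      have : (k₂ : ℝ) ≤ (max k₁ k₂ : ℕ) := by exact_mod_cast le_max_right _ _
      gcongr
    have h2 := hδc (y := s) (by rw [Real.dist_eq]; linarith)
    rw [Real.norm_eq_abs, Real.norm_eq_abs] at h2
    refine h2.trans ?_
    have h3 : (k₁ : ℝ) ≤ (max k₁ k₂ : ℕ) := by exact_mod_cast le_max_left _ _
    exact mul_le_mul_of_nonneg_right (by linarith) (abs_nonneg _)
  have hclosed : ∀ k, ∀ p ∈ S, p ∈ closure (S ∩ E k) → p ∈ E k := by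
    rintro k ⟨x, t⟩ hp hcl s hs hst
    have : NeBot (𝓝[S ∩ E k] (x, t)) := mem_closure_iff_nhdsWithin_neBot.1 hcl
    have hfst : Tendsto (fun q : Spc m × ℝ => q.1) (𝓝[S ∩ E k] (x, t)) (𝓝 x) :=
      (continuous_fst.tendsto (x, t)).mono_left nhdsWithin_le_nhds
    have hsnd : Tendsto (fun q : Spc m × ℝ => q.2) (𝓝[S ∩ E k] (x, t)) (𝓝 t) :=
      (continuous_snd.tendsto (x, t)).mono_left nhdsWithin_le_nhds
    have hws : ∀ σ ∈ Set.Ioo (p₀.2 - R) (p₀.2 + R),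
        Tendsto (fun q : Spc m × ℝ => w (q.1, σ)) (𝓝[S ∩ E k] (x, t)) (𝓝 (w (x, σ))) :=
      fun σ hσ => (hw (x, σ) (hRΩ (hline _ hp.1 σ hσ))).1.continuousAt.tendsto.comp hfst
    have hlim1 := ((hws s hs).sub (hws t hp.1.2)).abs
    have hlim2 : Tendsto (fun q : Spc m × ℝ => (k : ℝ) * |s - q.2| + k * |t - q.2|)
        (𝓝[S ∩ E k] (x, t)) (𝓝 ((k : ℝ) * |s - t| + k * |t - t|)) :=
      (((tendsto_const_nhds.sub hsnd).abs).const_mul _).add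
        (((tendsto_const_nhds.sub hsnd).abs).const_mul _)
    have hle := le_of_tendsto_of_tendsto hlim1 hlim2 (by
      have e1 : ∀ᶠ q : Spc m × ℝ in 𝓝[S ∩ E k] (x, t), |s - q.2| < 1 / (k + 1) :=
        ((tendsto_const_nhds.sub hsnd).abs).eventually (gt_mem_nhds hst)
      have e2 : ∀ᶠ q : Spc m × ℝ in 𝓝[S ∩ E k] (x, t), |t - q.2| < 1 / (k + 1) :=
        ((tendsto_const_nhds.sub hsnd).abs).eventually
          (gt_mem_nhds (by simp only [sub_self, abs_zero]; positivity))
      filter_upwards [e1, e2, self_mem_nhdsWithin] with q h1 h2 h3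
      have h4 := h3.2 s hs h1
      have h5 := h3.2 t hp.1.2 h2
      calc |w (q.1, s) - w (q.1, t)|
          = |(w (q.1, s) - w q) - (w (q.1, t) - w q)| := by ring_nf
        _ ≤ |w (q.1, s) - w q| + |w (q.1, t) - w q| := abs_sub _ _
        _ ≤ _ := add_le_add h4 h5)
    simpa using hle
  obtain ⟨k, p₁, hp₁, V, hV, hp₁V, hVE⟩ :=
    exists_isOpen_inter_subset_of_subset_iUnion hSlc ⟨p₀, hp₀W, hp₀G⟩ hcover hclosed
  obtain ⟨r, hr, hrV⟩ := exists_ball_prod_Ioo_subset (hV.inter hWopen) ⟨hp₁V, hp₁.1⟩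
  set r' : ℝ := min r (1 / (2 * (k + 1))) with hr'
  have hr'0 : 0 < r' := lt_min hr (by positivity)
  set U : Set (Spc m × ℝ) := Metric.ball p₁.1 r' ×ˢ Set.Ioo (p₁.2 - r') (p₁.2 + r') with hU
  have hUopen : IsOpen U := Metric.isOpen_ball.prod isOpen_Ioo
  have hUV : U ⊆ V ∩ W := fun q hq => hrV ⟨Metric.ball_subset_ball (min_le_left _ _) hq.1,
    by linarith [hq.2.1, min_le_left r (1 / (2 * ((k : ℝ) + 1)))],
    by linarith [hq.2.2, min_le_left r (1 / (2 * ((k : ℝ) + 1)))]⟩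
  have hgood : ∀ p ∈ W, p ∉ S → LowerSemicontinuousWithinAt w {q | p.2 ≤ q.2} p := by
    intro p hp hpS
    by_contra h
    exact hpS ⟨hp, fun h' => h (interior_subset h')⟩
  refine hp₁.2 (mem_interior.2 ⟨U, fun p hp => ?_, hUopen, Metric.mem_ball_self hr'0,
    by linarith, by linarith⟩)
  by_cases hpS : p ∈ S
  · refine SolvesL.lowerSemicontinuousWithinAt_of_slope_bound hlam hLam hA
      (fun q hq => hw q (hRΩ hq)) (fun q hq => hM q (hRΩ hq)) (Nat.cast_nonneg k) hgood hUopen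
      (fun q hq => (hUV hq).2) (fun q hq s hs => ?_) hpS hp
    refine hVE ⟨hq.1, (hUV hq.2).1⟩ s (hUV hs).2.2 ?_
    have h1 : r' ≤ 1 / (2 * (k + 1)) := min_le_right _ _
    have h2 : (1 : ℝ) / (2 * (k + 1)) = 1 / (k + 1) / 2 := by field_simp
    have h3 := hq.2.2
    have h4 := hs.2
    simp only at h4
    rw [abs_lt]
    constructor <;> linarith [h3.1, h3.2, h4.1, h4.2]
  · exact hgood p (hUV hp).2 hpS

end ForwardSemicontinuity

section GradientImage

open Filter Topology MeasureTheory

variable {m : ℕ}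

theorem abs_hessEntry_le_of_isLocalMax {F : Spc m → ℝ} {x : Spc m} (hF : ContDiffAt ℝ 2 F x)
    (hmax : IsLocalMax F x) (i j : Fin (m + 1)) :
    |hessEntry F x i j| ≤ -∑ k, hessEntry F x k k := by
  have hneg := fderiv_fderiv_nonpos_of_isLocalMax hF hmax
  have hdiag : ∀ k, hessEntry F x k k ≤ 0 := fun k => by rw [hessEntry_eq hF]; exact hneg _
  have hsingle : ∀ k, ∑ l, hessEntry F x l l ≤ hessEntry F x k k := fun k => by
    rw [← Finset.add_sum_erase _ _ (Finset.mem_univ k)]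
    linarith [Finset.sum_nonpos fun l (_ : l ∈ Finset.univ.erase k) => hdiag l]
  have h1 := hneg (eVec m i + eVec m j)
  have h2 := hneg (eVec m i - eVec m j)
  simp only [map_add, map_sub, add_apply, sub_apply, ← hessEntry_eq hF] at h1 h2
  rw [hessEntry_symm hF j i] at h1 h2
  rw [abs_le]
  constructor <;> linarith [hsingle i, hsingle j]

/-- The gradient of `F`, in coordinates. -/
def gradMap (F : Spc m → ℝ) (x : Spc m) : Spc m := ∑ i, fderiv ℝ F x (eVec m i) • eVec m i

/-- The linear map sending a functional to the vector of its coordinates. -/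
def coordVec (m : ℕ) : (Spc m →L[ℝ] ℝ) →L[ℝ] Spc m :=
  ∑ i, (ContinuousLinearMap.apply ℝ ℝ (eVec m i)).smulRight (eVec m i)

theorem coordVec_apply (l : Spc m →L[ℝ] ℝ) : coordVec m l = ∑ i, l (eVec m i) • eVec m i := by
  simp [coordVec, sum_apply]

theorem gradMap_eq_of_fderiv_eq_inner {F : Spc m → ℝ} {x p : Spc m}
    (h : fderiv ℝ F x = innerSL ℝ p) : gradMap F x = p := by
  have h1 : gradMap F x = ∑ i, p i • eVec m i := by
    simp [gradMap, h, eVec, EuclideanSpace.inner_single_right]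
  rw [h1, sum_smul_eVec]

theorem hasFDerivAt_gradMap {F : Spc m → ℝ} {x : Spc m} (hF : ContDiffAt ℝ 2 F x) :
    HasFDerivAt (gradMap F) ((coordVec m).comp (fderiv ℝ (fderiv ℝ F) x)) x := by
  have h1 : gradMap F = fun y => coordVec m (fderiv ℝ F y) := funext fun y =>
    (coordVec_apply _).symm
  rw [h1]
  exact (coordVec m).hasFDerivAt.comp x (differentiableAt_fderiv_of_contDiffAt hF).hasFDerivAt

theorem abs_det_coordVec_comp_le {F : Spc m → ℝ} {x : Spc m} (hF : ContDiffAt ℝ 2 F x) {c : ℝ}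
    (hc : ∀ i j, |hessEntry F x i j| ≤ c) :
    |((coordVec m).comp (fderiv ℝ (fderiv ℝ F) x)).det| ≤ (m + 1).factorial * c ^ (m + 1) := by
  set D := (coordVec m).comp (fderiv ℝ (fderiv ℝ F) x) with hD
  set b := (EuclideanSpace.basisFun (Fin (m + 1)) ℝ).toBasis with hb
  have hentry : ∀ i j, LinearMap.toMatrix b b (D : Spc m →ₗ[ℝ] Spc m) i j = hessEntry F x j i := by
    intro i j
    rw [LinearMap.toMatrix_apply, hessEntry_eq hF]
    simp only [hD, hb, ContinuousLinearMap.coe_coe, ContinuousLinearMap.comp_apply,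
      coordVec_apply, OrthonormalBasis.coe_toBasis, EuclideanSpace.basisFun_apply,
      OrthonormalBasis.coe_toBasis_repr_apply, EuclideanSpace.basisFun_repr]
    have := congrArg (fun z : Spc m => z i) (sum_smul_eVec fun k =>
      fderiv ℝ (fderiv ℝ F) x (EuclideanSpace.single j 1) (eVec m k))
    exact this
  have h1 : D.det = (LinearMap.toMatrix b b (D : Spc m →ₗ[ℝ] Spc m)).det := by
    rw [LinearMap.det_toMatrix]
  rw [h1]
  have h2 := Matrix.det_le (A := LinearMap.toMatrix b b (D : Spc m →ₗ[ℝ] Spc m))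
    (abv := IsAbsoluteValue.toAbsoluteValue (abs : ℝ → ℝ)) (x := c)
    (fun i j => by
      change |LinearMap.toMatrix b b (D : Spc m →ₗ[ℝ] Spc m) i j| ≤ c
      rw [hentry]; exact hc j i)
  simpa using h2

theorem volume_image_gradMap_le {F : Spc m → ℝ} {U S : Set (Spc m)} (hU : IsOpen U)
    (hF : ∀ x ∈ U, ContDiffAt ℝ 2 F x) (hSU : S ⊆ U) {c : ℝ} (hc0 : 0 < c)
    (hc : ∀ x ∈ S, ∀ i j, |hessEntry F x i j| ≤ c) :
    volume (gradMap F '' S) ≤ ENNReal.ofReal (2 * ((m + 1).factorial * c ^ (m + 1))) * volume U := by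
  set C : ℝ := (m + 1).factorial * c ^ (m + 1) with hC
  have hC0 : 0 < C := by positivity
  set D : Spc m → Spc m →L[ℝ] Spc m := fun x => (coordVec m).comp (fderiv ℝ (fderiv ℝ F) x) with hD
  have hcont : ContinuousOn (fun x => |(D x).det|) U := by
    intro x hx
    refine ContinuousAt.continuousWithinAt ?_
    have h1 : ContinuousAt (fderiv ℝ (fderiv ℝ F)) x :=
      (((hF x hx).fderiv_right (m := 1) (by norm_num)).fderiv_right (m := 0)
        (by norm_num)).continuousAt
    have h2 : ContinuousAt D x := continuousAt_const.clm_comp h1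
    exact (ContinuousLinearMap.continuous_det.continuousAt.comp h2).abs
  set V : Set (Spc m) := U ∩ (fun x => |(D x).det|) ⁻¹' Set.Iio (2 * C) with hV
  have hVopen : IsOpen V := hcont.isOpen_inter_preimage hU isOpen_Iio
  have hSV : S ⊆ V := fun x hx => ⟨hSU hx, by
    have := abs_det_coordVec_comp_le (hF x (hSU hx)) (hc x hx)
    exact lt_of_le_of_lt this (by linarith)⟩
  calc volume (gradMap F '' S) ≤ volume (gradMap F '' V) := measure_mono (Set.image_mono hSV)
    _ ≤ ∫⁻ x in V, ENNReal.ofReal |(D x).det| := 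
        addHaar_image_le_lintegral_abs_det_fderiv volume hVopen.measurableSet fun x hx =>
          (hasFDerivAt_gradMap (hF x hx.1)).hasFDerivWithinAt
    _ ≤ ∫⁻ _x in V, ENNReal.ofReal (2 * C) :=
        setLIntegral_mono' hVopen.measurableSet fun x hx => ENNReal.ofReal_le_ofReal hx.2.le
    _ = ENNReal.ofReal (2 * C) * volume V := by rw [setLIntegral_const]
    _ ≤ _ := by gcongr; exact Set.inter_subset_left

theorem ofReal_le_volume_of_slope_bound {N : ℝ → ℝ} {a b θ κ : ℝ} {E : Set ℝ} (hab : a ≤ b)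
    (hκ : 0 < κ)
    (husc : ∀ t ∈ Set.Icc a b, ∀ c, N t < c → ∀ᶠ s in 𝓝[Set.Icc t b] t, N s < c)
    (ha : N a < θ)
    (hout : ∀ t ∈ Set.Ioc a b, θ ≤ N t → t ∉ E → ∃ s ∈ Set.Ico a t, N t ≤ N s)
    (hin : ∀ t ∈ Set.Ioc a b, θ ≤ N t → ∀ᶠ s in 𝓝[<] t, N t - κ * (t - s) ≤ N s) :
    ENNReal.ofReal ((N b - θ) / κ) ≤ volume E := by
  by_contra! hlt
  obtain ⟨O, hEO, hO, hvol⟩ := Set.exists_isOpen_lt_of_lt E _ hlt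
  have hOtop : volume O ≠ ⊤ := (hvol.trans ENNReal.ofReal_lt_top).ne
  set φ : ℝ → ℝ := fun t => volume.real (O ∩ Set.Iic t) with hφ
  have hφmono : Monotone φ := fun s t hst => measureReal_mono
    (Set.inter_subset_inter_right _ (Set.Iic_subset_Iic.2 hst))
    (ne_top_of_le_ne_top hOtop (measure_mono Set.inter_subset_left))
  have hφ0 : ∀ t, 0 ≤ φ t := fun t => measureReal_nonneg
  have hφO : φ b ≤ volume.real O := measureReal_mono Set.inter_subset_left hOtop
  have hfinal := lt_of_forall_slice_max (X := Unit) (S := Set.univ ×ˢ Set.Icc a b)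
    (isCompact_univ.prod isCompact_Icc) (v := fun q => N q.2 - κ * φ q.2) (θ := θ) ?_ ?_
    ((), b) ⟨trivial, hab, le_rfl⟩
  · have h1 : (N b - θ) / κ < φ b := by
      rw [div_lt_iff₀ hκ]
      simp only at hfinal
      linarith
    rw [← ofReal_measureReal hOtop, ENNReal.ofReal_lt_ofReal_iff_of_nonneg measureReal_nonneg]
      at hvol
    linarith
  · rintro ⟨_, t⟩ ⟨_, ht⟩ c hc
    have h1 := husc t ht (c + κ * φ t) (by simp only at hc; linarith)
    have h2 : Tendsto (fun q : Unit × ℝ => q.2)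
        (𝓝[Set.univ ×ˢ Set.Icc a b ∩ {q | t ≤ q.2}] ((), t)) (𝓝[Set.Icc t b] t) := by
      refine tendsto_nhdsWithin_of_tendsto_nhds_of_eventually_within _
        ((continuous_snd.tendsto _).mono_left nhdsWithin_le_nhds) ?_
      filter_upwards [self_mem_nhdsWithin] with q hq
      exact ⟨hq.2, hq.1.2.2⟩
    filter_upwards [h2.eventually h1, self_mem_nhdsWithin] with q hq hq2
    have := mul_le_mul_of_nonneg_left (hφmono hq2.2) hκ.le
    linarith
  · rintro ⟨_, t⟩ ⟨_, ht⟩ hθ _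
    simp only at hθ
    have hNθ : θ ≤ N t := by linarith [mul_nonneg hκ.le (hφ0 t)]
    have hat : a < t := lt_of_le_of_ne ht.1 fun h => by rw [← h] at hNθ; linarith
    by_cases htE : t ∈ E
    · have h1 : ∀ᶠ s in 𝓝[<] t, Set.Icc s t ⊆ O := by
        obtain ⟨ε, hε, h⟩ := Metric.isOpen_iff.1 hO t (hEO htE)
        filter_upwards [Ioo_mem_nhdsLT (show t - ε < t by linarith)] with s hs z hz
        refine h ?_
        rw [Metric.mem_ball, Real.dist_eq, abs_lt]
        constructor <;> linarith [hs.1, hs.2, hz.1, hz.2]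
      obtain ⟨s, h2, h3, h4⟩ := (h1.and ((hin t ⟨hat, ht.2⟩ hNθ).and
        (Ioo_mem_nhdsLT hat))).exists
      refine ⟨((), s), ⟨trivial, h4.1.le, h4.2.le.trans ht.2⟩, h4.2, ?_⟩
      have h5 : φ s + (t - s) ≤ φ t := by
        have h6 : volume.real (Set.Ioc s t) = t - s := by
          rw [Real.volume_real_Ioc_of_le h4.2.le]
        have h8 : Disjoint (O ∩ Set.Iic s) (Set.Ioc s t) := by
          rw [Set.disjoint_left]
          rintro z hz hz2
          exact absurd hz2.1 (not_lt.2 hz.2)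
        rw [← h6, hφ, ← measureReal_union h8 measurableSet_Ioc
          (ne_top_of_le_ne_top hOtop (measure_mono Set.inter_subset_left)) measure_Ioc_lt_top.ne]
        refine measureReal_mono ?_
          (ne_top_of_le_ne_top hOtop (measure_mono Set.inter_subset_left))
        rintro z (hz | hz)
        · exact ⟨hz.1, hz.2.trans h4.2.le⟩
        · exact ⟨h2 ⟨hz.1.le, hz.2⟩, hz.2⟩
      simp only
      have h7 := mul_le_mul_of_nonneg_left h5 hκ.le
      linarith
    · obtain ⟨s, hs, hNs⟩ := hout t ⟨hat, ht.2⟩ hNθ htE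
      refine ⟨((), s), ⟨trivial, hs.1, hs.2.le.trans ht.2⟩, hs.2, ?_⟩
      have := mul_le_mul_of_nonneg_left (hφmono hs.2.le) hκ.le
      simp only
      linarith

end GradientImage

section Growth

open Filter Topology MeasureTheory

variable {m : ℕ} {lam Lam : ℝ} {A : Spc m → Matrix (Fin (m + 1)) (Fin (m + 1)) ℝ}

/-- A function with values in `[0, 1]` on a backward parabolic cylinder of radius `ρ` which solves
the equation where it is positive, and whose positivity set has small volume at each time. -/
structure IsSmallSupportSubsolution (A : Spc m → Matrix (Fin (m + 1)) (Fin (m + 1)) ℝ)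
    (y : Spc m → ℝ → ℝ) (x₀ : Spc m) (ρ t₀ κ : ℝ) : Prop where
  radius_pos : 0 < ρ
  nonneg : ∀ x ∈ Metric.closedBall x₀ ρ, ∀ t ∈ Set.Icc (t₀ - ρ ^ 2) t₀, 0 ≤ y x t
  le_one : ∀ x ∈ Metric.closedBall x₀ ρ, ∀ t ∈ Set.Icc (t₀ - ρ ^ 2) t₀, y x t ≤ 1
  continuousAt_space : ∀ x ∈ Metric.closedBall x₀ ρ, ∀ t ∈ Set.Icc (t₀ - ρ ^ 2) t₀,
    ContinuousAt (fun z => y z t) x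
  continuousOn_time : ∀ x ∈ Metric.closedBall x₀ ρ, ContinuousOn (y x) (Set.Icc (t₀ - ρ ^ 2) t₀)
  forward_usc : ∀ x ∈ Metric.closedBall x₀ ρ, ∀ t ∈ Set.Icc (t₀ - ρ ^ 2) t₀,
    UpperSemicontinuousWithinAt (fun q : Spc m × ℝ => y q.1 q.2) {q | t ≤ q.2 ∧ q.2 ≤ t₀} (x, t)
  solves : ∀ x ∈ Metric.ball x₀ ρ, ∀ t ∈ Set.Ioc (t₀ - ρ ^ 2) t₀, 0 < y x t →
    ContDiffAt ℝ 2 (fun z => y z t) x ∧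
      HasDerivWithinAt (y x) (traceHess (A x) (fun z => y z t) x) (Set.Iic t) t
  volume_le : ∀ t ∈ Set.Ioc (t₀ - ρ ^ 2) t₀,
    volume {x ∈ Metric.ball x₀ ρ | 0 < y x t} ≤ ENNReal.ofReal (κ * ρ ^ (m + 1))

/-- The function `y` lowered by a parabolic paraboloid. -/
def paraFun (y : Spc m → ℝ → ℝ) (x₀ : Spc m) (ρ t₀ : ℝ) (x : Spc m) (t : ℝ) : ℝ :=
  y x t - (1 / ρ ^ 2) * (‖x - x₀‖ ^ 2 + (t₀ - t))

/-- The maximum over the ball of `paraFun` tilted by the slope `p`. -/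
def slideMax (y : Spc m → ℝ → ℝ) (x₀ : Spc m) (ρ t₀ : ℝ) (q : Spc m × ℝ) : ℝ :=
  ⨆ x : Metric.closedBall x₀ ρ, (paraFun y x₀ ρ t₀ x (timeClamp (t₀ - ρ ^ 2) t₀ q.2) -
    inner ℝ q.1 ((x : Spc m) - x₀))

variable {y : Spc m → ℝ → ℝ} {x₀ : Spc m} {ρ t₀ κ : ℝ}

namespace IsSmallSupportSubsolution

theorem clamp_mem (ρ t₀ t : ℝ) :
    timeClamp (t₀ - ρ ^ 2) t₀ t ∈ Set.Icc (t₀ - ρ ^ 2) t₀ :=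
  timeClamp_mem (sub_le_self _ (sq_nonneg _)) t

theorem paraFun_le {x : Spc m} {t : ℝ} (ht : t ∈ Set.Icc (t₀ - ρ ^ 2) t₀) :
    paraFun y x₀ ρ t₀ x t ≤ y x t := by
  have h1 : 0 ≤ (1 / ρ ^ 2) * (‖x - x₀‖ ^ 2 + (t₀ - t)) :=
    mul_nonneg (by positivity) (add_nonneg (sq_nonneg _) (sub_nonneg.2 ht.2))
  rw [paraFun]
  linarith

theorem neg_inner_le (p : Spc m) {x : Spc m} (hx : x ∈ Metric.closedBall x₀ ρ) :
    -inner ℝ p (x - x₀) ≤ ‖p‖ * ρ := by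
  have h1 := abs_le.1 (abs_real_inner_le_norm p (x - x₀))
  have h2 : ‖x - x₀‖ ≤ ρ := by rwa [← dist_eq_norm]
  have h3 := mul_le_mul_of_nonneg_left h2 (norm_nonneg p)
  linarith [h1.1]

theorem bddAbove (h : IsSmallSupportSubsolution A y x₀ ρ t₀ κ) (q : Spc m × ℝ) :
    BddAbove (Set.range fun x : Metric.closedBall x₀ ρ =>
      (paraFun y x₀ ρ t₀ x (timeClamp (t₀ - ρ ^ 2) t₀ q.2) - inner ℝ q.1 ((x : Spc m) - x₀))) := by
  refine ⟨1 + ‖q.1‖ * ρ, ?_⟩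
  rintro _ ⟨x, rfl⟩
  have h1 := paraFun_le (y := y) (x₀ := x₀) (x := (x : Spc m)) (clamp_mem ρ t₀ q.2)
  have h2 := h.le_one x x.2 _ (clamp_mem ρ t₀ q.2)
  have h3 := neg_inner_le q.1 x.2
  simp only
  linarith

theorem continuousOn_paraFun (h : IsSmallSupportSubsolution A y x₀ ρ t₀ κ) {t : ℝ}
    (ht : t ∈ Set.Icc (t₀ - ρ ^ 2) t₀) (p : Spc m) :
    ContinuousOn (fun x => paraFun y x₀ ρ t₀ x t - inner ℝ p (x - x₀))
      (Metric.closedBall x₀ ρ) := by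
  intro x hx
  refine ContinuousAt.continuousWithinAt ?_
  have h1 := h.continuousAt_space x hx t ht
  unfold paraFun
  fun_prop

theorem le_slideMax (h : IsSmallSupportSubsolution A y x₀ ρ t₀ κ) {x : Spc m}
    (hx : x ∈ Metric.closedBall x₀ ρ) {t : ℝ} (ht : t ∈ Set.Icc (t₀ - ρ ^ 2) t₀) (p : Spc m) :
    paraFun y x₀ ρ t₀ x t - inner ℝ p (x - x₀) ≤ slideMax y x₀ ρ t₀ (p, t) := by
  have h1 := le_ciSup (h.bddAbove (p, t)) (⟨x, hx⟩ : Metric.closedBall x₀ ρ)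
  simp only [timeClamp_of_mem ht] at h1
  rw [slideMax]
  simpa only [timeClamp_of_mem ht] using h1

theorem exists_eq_slideMax (h : IsSmallSupportSubsolution A y x₀ ρ t₀ κ) {t : ℝ}
    (ht : t ∈ Set.Icc (t₀ - ρ ^ 2) t₀) (p : Spc m) :
    ∃ x ∈ Metric.closedBall x₀ ρ,
      slideMax y x₀ ρ t₀ (p, t) = paraFun y x₀ ρ t₀ x t - inner ℝ p (x - x₀) := by
  obtain ⟨x, hx, hmax⟩ := (isCompact_closedBall x₀ ρ).exists_isMaxOn
    ⟨x₀, Metric.mem_closedBall_self h.radius_pos.le⟩ (h.continuousOn_paraFun ht p)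
  refine ⟨x, hx, le_antisymm ?_ (h.le_slideMax hx ht p)⟩
  have : Nonempty (Metric.closedBall x₀ ρ) := ⟨⟨x, hx⟩⟩
  refine ciSup_le fun z => ?_
  simp only [timeClamp_of_mem ht]
  exact hmax z.2

theorem lowerSemicontinuous_slideMax (h : IsSmallSupportSubsolution A y x₀ ρ t₀ κ) :
    LowerSemicontinuous (slideMax y x₀ ρ t₀) := by
  refine lowerSemicontinuous_ciSup h.bddAbove fun x => Continuous.lowerSemicontinuous ?_
  have h1 : Continuous fun q : Spc m × ℝ => timeClamp (t₀ - ρ ^ 2) t₀ q.2 :=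
    (continuous_timeClamp _ _).comp continuous_snd
  have h2 : Continuous fun q : Spc m × ℝ => y x (timeClamp (t₀ - ρ ^ 2) t₀ q.2) :=
    (h.continuousOn_time x x.2).comp_continuous h1 fun q => clamp_mem ρ t₀ q.2
  exact (h2.sub (continuous_const.mul (continuous_const.add (continuous_const.sub h1)))).sub
    (continuous_fst.inner continuous_const)

theorem forward_usc_slideMax (h : IsSmallSupportSubsolution A y x₀ ρ t₀ κ) (p : Spc m) {t : ℝ}
    (ht : t ∈ Set.Icc (t₀ - ρ ^ 2) t₀) {c : ℝ} (hc : slideMax y x₀ ρ t₀ (p, t) < c) :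
    ∀ᶠ s in 𝓝[Set.Icc t t₀] t, slideMax y x₀ ρ t₀ (p, s) < c := by
  have key : ∀ᶠ s in 𝓝 t, ∀ x ∈ Metric.closedBall x₀ ρ, s ∈ Set.Icc t t₀ →
      paraFun y x₀ ρ t₀ x s - inner ℝ p (x - x₀) < c := by
    refine (isCompact_closedBall x₀ ρ).eventually_forall_of_forall_eventually fun x hx => ?_
    have hlt := (h.le_slideMax hx ht p).trans_lt hc
    obtain ⟨c', hc', hc'c⟩ := exists_between hlt
    set φ : Spc m × ℝ → ℝ := fun q => (1 / ρ ^ 2) * (‖q.1 - x₀‖ ^ 2 + (t₀ - q.2)) +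
      inner ℝ p (q.1 - x₀) with hφ
    have hφc : Continuous φ := by fun_prop
    have h1 := h.forward_usc x hx t ht (c' + φ (x, t))
      (by simp only [hφ]; rw [paraFun] at hc'; linarith)
    have h2 : ∀ᶠ q in 𝓝 (x, t), φ (x, t) - (c - c') < φ q :=
      hφc.continuousAt.eventually (lt_mem_nhds (by linarith))
    have h3 := (eventually_nhdsWithin_iff.1 h1).and h2
    have hswap : Tendsto (fun z : ℝ × Spc m => (z.2, z.1)) (𝓝 (t, x)) (𝓝 (x, t)) :=
      (continuous_swap (X := ℝ) (Y := Spc m)).tendsto (t, x)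
    filter_upwards [hswap.eventually h3] with z hz hs
    have h4 := hz.1 hs
    have h5 := hz.2
    simp only [hφ] at h4 h5
    rw [paraFun]
    linarith
  filter_upwards [nhdsWithin_le_nhds key, self_mem_nhdsWithin] with s hs hst
  obtain ⟨x, hx, hxeq⟩ := h.exists_eq_slideMax ⟨ht.1.trans hst.1, hst.2⟩ p
  rw [hxeq]
  exact hs x hx hst

theorem traceHess_paraFun (y : Spc m → ℝ → ℝ) (M : Matrix (Fin (m + 1)) (Fin (m + 1)) ℝ)
    (x₀ : Spc m) (ρ t₀ t : ℝ) {x : Spc m} (hy : ContDiffAt ℝ 2 (fun z => y z t) x) :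
    ContDiffAt ℝ 2 (fun z => paraFun y x₀ ρ t₀ z t) x ∧
      traceHess M (fun z => paraFun y x₀ ρ t₀ z t) x =
        traceHess M (fun z => y z t) x - (1 / ρ ^ 2) * (2 * ∑ i, M i i) := by
  have h1 : ContDiffAt ℝ 2 (fun z : Spc m => ‖z - x₀‖ ^ 2) x :=
    (contDiff_norm_sub_sq x₀).contDiffAt
  have h2 : ContDiffAt ℝ 2 (fun _ : Spc m => t₀ - t) x := contDiffAt_const
  have h3 : ContDiffAt ℝ 2 (fun z : Spc m => ‖z - x₀‖ ^ 2 + (t₀ - t)) x := h1.add h2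
  have h4 : ContDiffAt ℝ 2 (fun z : Spc m => (1 / ρ ^ 2) * (‖z - x₀‖ ^ 2 + (t₀ - t))) x :=
    contDiffAt_const.mul h3
  refine ⟨hy.sub h4, ?_⟩
  change traceHess M (fun z => y z t - (1 / ρ ^ 2) * (‖z - x₀‖ ^ 2 + (t₀ - t))) x = _
  rw [traceHess_sub _ hy h4, traceHess_const_mul _ _ h3, traceHess_add _ h1 h2,
    traceHess_norm_sub_sq, traceHess_const, add_zero]

theorem exists_contact (h : IsSmallSupportSubsolution A y x₀ ρ t₀ κ)
    (hA : IsElliptic lam Lam A) {p : Spc m} (hp : ‖p‖ * ρ < 1 / 8) {t : ℝ}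
    (ht : t ∈ Set.Icc (t₀ - ρ ^ 2) t₀) (hN : 1 / 4 ≤ slideMax y x₀ ρ t₀ (p, t)) :
    t₀ - ρ ^ 2 < t ∧ ∃ x ∈ Metric.ball x₀ ρ, 0 < y x t ∧
      ContDiffAt ℝ 2 (fun z => paraFun y x₀ ρ t₀ z t) x ∧
      gradMap (fun z => paraFun y x₀ ρ t₀ z t) x = p ∧
      (∀ i j, |hessEntry (fun z => paraFun y x₀ ρ t₀ z t) x i j| ≤
        -∑ k, hessEntry (fun z => paraFun y x₀ ρ t₀ z t) x k k) ∧
      slideMax y x₀ ρ t₀ (p, t) = paraFun y x₀ ρ t₀ x t - inner ℝ p (x - x₀) ∧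
      ∃ d, HasDerivWithinAt (fun s => paraFun y x₀ ρ t₀ x s) d (Set.Iic t) t ∧
        d ≤ lam * (∑ k, hessEntry (fun z => paraFun y x₀ ρ t₀ z t) x k k) +
          (2 * (m + 1) * Lam + 1) / ρ ^ 2 := by
  have hρ := h.radius_pos
  obtain ⟨x, hx, hxeq⟩ := h.exists_eq_slideMax ht p
  have hin := neg_inner_le p hx
  have hψ : 1 / 8 < paraFun y x₀ ρ t₀ x t := by linarith
  have hypos : 0 < y x t := by linarith [paraFun_le (y := y) (x₀ := x₀) (x := x) ht]
  have hy1 := h.le_one x hx t ht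
  have hρ2 : 0 < ρ ^ 2 := by positivity
  have hsmall : ‖x - x₀‖ ^ 2 + (t₀ - t) < ρ ^ 2 := by
    by_contra! hge
    rw [paraFun] at hψ
    have h1 : 1 ≤ (1 / ρ ^ 2) * (‖x - x₀‖ ^ 2 + (t₀ - t)) := by
      rw [one_div, ← div_eq_inv_mul, le_div_iff₀ hρ2]; linarith
    linarith
  have hta : t₀ - ρ ^ 2 < t := by linarith [sq_nonneg ‖x - x₀‖]
  have hball : x ∈ Metric.ball x₀ ρ := by
    rw [Metric.mem_ball, dist_eq_norm]
    exact lt_of_pow_lt_pow_left₀ 2 hρ.le (by linarith [ht.2])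
  obtain ⟨hC2, hderiv⟩ := h.solves x hball t ⟨hta, ht.2⟩ hypos
  obtain ⟨hψC2, htr⟩ := traceHess_paraFun y (A x) x₀ ρ t₀ t hC2
  have hlin : ContDiffAt ℝ 2 (fun z : Spc m => inner ℝ p (z - x₀)) x :=
    (contDiff_const.inner ℝ (contDiff_id.sub contDiff_const)).contDiffAt
  have hlocmax : IsLocalMax (fun z => paraFun y x₀ ρ t₀ z t - inner ℝ p (z - x₀)) x := by
    filter_upwards [Metric.isOpen_ball.mem_nhds hball] with z hz
    rw [← hxeq]
    exact h.le_slideMax (Metric.ball_subset_closedBall hz) ht p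
  have hhess : ∀ i j, hessEntry (fun z => paraFun y x₀ ρ t₀ z t - inner ℝ p (z - x₀)) x i j =
      hessEntry (fun z => paraFun y x₀ ρ t₀ z t) x i j := fun i j => by
    rw [hessEntry_sub hψC2 hlin, hessEntry_inner_sub, sub_zero]
  refine ⟨hta, x, hball, hypos, hψC2, ?_, fun i j => ?_, hxeq, ?_⟩
  · refine gradMap_eq_of_fderiv_eq_inner ?_
    have h1 := hlocmax.fderiv_eq_zero
    have h2 : HasFDerivAt (fun z : Spc m => inner ℝ p (z - x₀)) (innerSL ℝ p) x :=
      (innerSL ℝ p).hasFDerivAt.comp x ((hasFDerivAt_id x).sub_const x₀)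
    have h3 := (hψC2.differentiableAt (by norm_num)).hasFDerivAt.sub h2
    have h4 := h3.fderiv
    rw [show ((fun z => paraFun y x₀ ρ t₀ z t) - fun z : Spc m => inner ℝ p (z - x₀)) =
      fun z => paraFun y x₀ ρ t₀ z t - inner ℝ p (z - x₀) from rfl, h1] at h4
    exact sub_eq_zero.1 h4.symm
  · have h1 := abs_hessEntry_le_of_isLocalMax (hψC2.sub hlin) hlocmax i j
    simpa only [hhess] using h1
  · refine ⟨traceHess (A x) (fun z => y z t) x + 1 / ρ ^ 2, ?_, ?_⟩
    · have h1 : HasDerivAt (fun s => (1 / ρ ^ 2) * (‖x - x₀‖ ^ 2 + (t₀ - s))) (1 / ρ ^ 2 * (-1)) t :=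
        (((hasDerivAt_id t).const_sub t₀).const_add _).const_mul _
      have h2 := hderiv.sub h1.hasDerivWithinAt
      rw [show traceHess (A x) (fun z => y z t) x + 1 / ρ ^ 2 =
        traceHess (A x) (fun z => y z t) x - 1 / ρ ^ 2 * (-1) by ring]
      exact h2
    · have h1 : traceHess (A x) (fun z => paraFun y x₀ ρ t₀ z t) x ≤
          lam * ∑ k, hessEntry (fun z => paraFun y x₀ ρ t₀ z t) x k k := by
        refine (hA.isEllipticMatrix x).traceHess_le fun ξ => ?_
        have h2 := sum_hessEntry_nonpos_of_isLocalMax (hψC2.sub hlin) hlocmax ξ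
        simpa only [hhess] using h2
      rw [htr] at h1
      have h3 := (hA.isEllipticMatrix x).sum_diag_le
      have h4 : (1 / ρ ^ 2) * (2 * ∑ i, A x i i) ≤ (1 / ρ ^ 2) * (2 * ((m + 1) * Lam)) := by
        gcongr
      have h5 : (2 * (m + 1) * Lam + 1) / ρ ^ 2 = (1 / ρ ^ 2) * (2 * ((m + 1) * Lam)) + 1 / ρ ^ 2 := by
        ring
      linarith

end IsSmallSupportSubsolution

end Growth

section GrowthLemma

open Filter Topology MeasureTheory

theorem HasDerivWithinAt.eventually_sub_mul_lt {f : ℝ → ℝ} {d c t : ℝ}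
    (h : HasDerivWithinAt f d (Set.Iic t) t) (hdc : d < c) :
    ∀ᶠ s in 𝓝[<] t, f t - c * (t - s) < f s := by
  have h1 := (hasDerivWithinAt_iff_tendsto_slope' (Set.self_notMem_Iio (a := t))).1
    (h.mono Set.Iio_subset_Iic_self)
  filter_upwards [h1.eventually (gt_mem_nhds hdc), self_mem_nhdsWithin] with s hs hst
  have h2 : s - t < 0 := sub_neg.2 hst
  rw [slope_def_field, div_lt_iff_of_neg h2] at hs
  linarith

variable {m : ℕ} {lam Lam : ℝ} {A : Spc m → Matrix (Fin (m + 1)) (Fin (m + 1)) ℝ}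

/-- The pairs (slope, time) at which `slideMax` is large and does not increase backward in time. -/
def creepSet (y : Spc m → ℝ → ℝ) (x₀ : Spc m) (ρ t₀ : ℝ) : Set (Spc m × ℝ) :=
  {q | ‖q.1‖ * ρ < 1 / 8} ∩ ({q | q.2 ∈ Set.Ioc (t₀ - ρ ^ 2) t₀} ∩
    ({q | 1 / 4 ≤ slideMax y x₀ ρ t₀ q} ∩ ⋂ k : ℕ, ⋃ s : ℚ, {q | q.2 - 1 / (k + 1) < s} ∩
      ({q | (s : ℝ) < q.2} ∩ {q | slideMax y x₀ ρ t₀ (q.1, (s : ℝ)) < slideMax y x₀ ρ t₀ q})))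

variable {y : Spc m → ℝ → ℝ} {x₀ : Spc m} {ρ t₀ κ : ℝ}

namespace IsSmallSupportSubsolution

theorem measurableSet_creepSet (h : IsSmallSupportSubsolution A y x₀ ρ t₀ κ) :
    MeasurableSet (creepSet y x₀ ρ t₀) := by
  have hN : Measurable (slideMax y x₀ ρ t₀) := h.lowerSemicontinuous_slideMax.measurable
  have hNs : ∀ s : ℚ, Measurable fun q : Spc m × ℝ => slideMax y x₀ ρ t₀ (q.1, (s : ℝ)) :=
    fun s => hN.comp (measurable_fst.prodMk measurable_const)
  refine (measurableSet_lt (measurable_fst.norm.mul_const ρ) measurable_const).inter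
    ((measurable_snd measurableSet_Ioc).inter ((measurableSet_le measurable_const hN).inter
      (MeasurableSet.iInter fun k => MeasurableSet.iUnion fun s =>
        (measurableSet_lt (measurable_snd.sub_const _) measurable_const).inter
          ((measurableSet_lt measurable_const measurable_snd).inter
            (measurableSet_lt (hNs s) hN)))))

theorem le_volume_creepSet_slope (h : IsSmallSupportSubsolution A y x₀ ρ t₀ κ) (hlam : 0 ≤ lam)
    (hLam : 0 ≤ Lam) (hA : IsElliptic lam Lam A) (hy : 1 / 2 < y x₀ t₀) {p : Spc m}
    (hp : ‖p‖ * ρ < 1 / 8) :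
    ENNReal.ofReal (1 / 4 / (2 * (2 * (m + 1) * Lam + 1) / ρ ^ 2)) ≤
      volume (Prod.mk p ⁻¹' creepSet y x₀ ρ t₀) := by
  have hρ := h.radius_pos
  set C : ℝ := 2 * (m + 1) * Lam + 1 with hC
  have hC0 : 0 < C := by positivity
  have hκ : 0 < 2 * C / ρ ^ 2 := by positivity
  have ht₀ : t₀ ∈ Set.Icc (t₀ - ρ ^ 2) t₀ := ⟨sub_le_self _ (sq_nonneg _), le_rfl⟩
  have hb : 1 / 2 < slideMax y x₀ ρ t₀ (p, t₀) := by
    have h1 := h.le_slideMax (Metric.mem_closedBall_self hρ.le) ht₀ p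
    simp only [paraFun, sub_self, norm_zero, inner_zero_right, ne_eq, OfNat.ofNat_ne_zero,
      not_false_eq_true, zero_pow, add_zero, mul_zero, sub_zero] at h1
    linarith
  have hmain := ofReal_le_volume_of_slope_bound (N := fun t => slideMax y x₀ ρ t₀ (p, t))
    (θ := 1 / 4) (E := Prod.mk p ⁻¹' creepSet y x₀ ρ t₀) (sub_le_self _ (sq_nonneg _)) hκ
    (fun t ht c hc => h.forward_usc_slideMax p ht hc)
    (by
      by_contra! hge
      exact lt_irrefl _ (h.exists_contact hA hp ⟨le_rfl, sub_le_self _ (sq_nonneg _)⟩ hge).1)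
    (fun t ht hθ hE => by
      have h1 : ∃ k : ℕ, ∀ s : ℚ, t - 1 / (k + 1) < s → (s : ℝ) < t →
          slideMax y x₀ ρ t₀ (p, t) ≤ slideMax y x₀ ρ t₀ (p, (s : ℝ)) := by
        by_contra! hcon
        refine hE ⟨hp, ht, hθ, Set.mem_iInter.2 fun k => ?_⟩
        obtain ⟨s, hs1, hs2, hs3⟩ := hcon k
        exact Set.mem_iUnion.2 ⟨s, hs1, hs2, hs3⟩
      obtain ⟨k, hk⟩ := h1
      have hk0 : (0 : ℝ) < 1 / (k + 1) := by positivity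
      obtain ⟨s, hs1, hs2⟩ := exists_rat_btwn (max_lt ht.1 (show t - 1 / ((k : ℝ) + 1) < t by linarith))
      rw [max_lt_iff] at hs1
      exact ⟨s, ⟨hs1.1.le, hs2⟩, hk s hs1.2 hs2⟩)
    (fun t ht hθ => by
      obtain ⟨_, x, hx, _, _, _, hhess, heq, d, hd, hdle⟩ :=
        h.exists_contact hA hp ⟨ht.1.le, ht.2⟩ hθ
      have htr : ∑ k, hessEntry (fun z => paraFun y x₀ ρ t₀ z t) x k k ≤ 0 := by
        have := (abs_nonneg _).trans (hhess 0 0)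
        linarith
      have hdlt : d < 2 * C / ρ ^ 2 := by
        have h1 := mul_nonpos_of_nonneg_of_nonpos hlam htr
        have h2 : 0 < C / ρ ^ 2 := by positivity
        have h3 : 2 * C / ρ ^ 2 = C / ρ ^ 2 + C / ρ ^ 2 := by ring
        linarith
      filter_upwards [hd.eventually_sub_mul_lt hdlt, Ioo_mem_nhdsLT ht.1] with s h1 h2
      have h3 := h.le_slideMax (Metric.ball_subset_closedBall hx) ⟨h2.1.le, h2.2.le.trans ht.2⟩ p
      rw [heq]
      linarith)
  refine le_trans (ENNReal.ofReal_le_ofReal ?_) hmain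
  gcongr
  linarith

theorem volume_creepSet_time_le (h : IsSmallSupportSubsolution A y x₀ ρ t₀ κ) (hlam : 0 < lam)
    (hLam : 0 ≤ Lam) (hA : IsElliptic lam Lam A) {t : ℝ} (ht : t ∈ Set.Ioc (t₀ - ρ ^ 2) t₀) :
    volume ((fun p => (p, t)) ⁻¹' creepSet y x₀ ρ t₀) ≤
      ENNReal.ofReal (2 * ((m + 1).factorial * ((2 * (m + 1) * Lam + 1) / (lam * ρ ^ 2)) ^ (m + 1))) *
        ENNReal.ofReal (κ * ρ ^ (m + 1)) := by
  have hρ := h.radius_pos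
  set C : ℝ := 2 * (m + 1) * Lam + 1 with hC
  have hC0 : 0 < C := by positivity
  have htI : t ∈ Set.Icc (t₀ - ρ ^ 2) t₀ := ⟨ht.1.le, ht.2⟩
  set U : Set (Spc m) := {x ∈ Metric.ball x₀ ρ | 0 < y x t} with hU
  have hUopen : IsOpen U := by
    have h1 : ContinuousOn (fun x => y x t) (Metric.ball x₀ ρ) := fun x hx =>
      (h.continuousAt_space x (Metric.ball_subset_closedBall hx) t htI).continuousWithinAt
    exact h1.isOpen_inter_preimage Metric.isOpen_ball isOpen_Ioi
  set S : Set (Spc m) := {x ∈ U | ∀ i j, |hessEntry (fun z => paraFun y x₀ ρ t₀ z t) x i j| ≤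
    C / (lam * ρ ^ 2)} with hS
  have hsub : (fun p => (p, t)) ⁻¹' creepSet y x₀ ρ t₀ ⊆
      gradMap (fun z => paraFun y x₀ ρ t₀ z t) '' S := by
    rintro p ⟨hp, _, hθ, hcreep⟩
    obtain ⟨_, x, hx, hypos, _, hgrad, hhess, heq, d, hd, hdle⟩ :=
      h.exists_contact hA hp htI hθ
    refine ⟨x, ⟨⟨hx, hypos⟩, fun i j => (hhess i j).trans ?_⟩, hgrad⟩
    have hd0 : 0 ≤ d := by
      by_contra! hneg
      have hev : ∀ᶠ s in 𝓝[<] t, slideMax y x₀ ρ t₀ (p, t) < slideMax y x₀ ρ t₀ (p, s) := by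
        filter_upwards [hd.eventually_sub_mul_lt hneg, Ioo_mem_nhdsLT ht.1] with s h1 h2
        have h3 := h.le_slideMax (Metric.ball_subset_closedBall hx)
          ⟨h2.1.le, h2.2.le.trans ht.2⟩ p
        rw [heq]
        linarith
      obtain ⟨l, hl, hlt⟩ := (mem_nhdsLT_iff_exists_Ioo_subset).1 hev
      obtain ⟨k, hk⟩ := exists_nat_one_div_lt (show (0:ℝ) < t - l from sub_pos.2 hl)
      obtain ⟨s, hs1, hs2, hs3⟩ := Set.mem_iUnion.1 (Set.mem_iInter.1 hcreep k)
      have hs1' : t - 1 / ((k : ℝ) + 1) < s := hs1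
      have h4 : slideMax y x₀ ρ t₀ (p, t) < slideMax y x₀ ρ t₀ (p, s) :=
        hlt (show (s : ℝ) ∈ Set.Ioo l t from ⟨by linarith, hs2⟩)
      exact lt_asymm hs3 h4
    have h1 : lam * -∑ k, hessEntry (fun z => paraFun y x₀ ρ t₀ z t) x k k ≤ C / ρ ^ 2 := by
      linarith
    rw [mul_comm lam, ← div_div, le_div_iff₀ hlam]
    · linarith
  calc volume ((fun p => (p, t)) ⁻¹' creepSet y x₀ ρ t₀)
      ≤ volume (gradMap (fun z => paraFun y x₀ ρ t₀ z t) '' S) := measure_mono hsub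
    _ ≤ _ := volume_image_gradMap_le hUopen
        (fun x hx => (traceHess_paraFun y (A x) x₀ ρ t₀ t (h.solves x hx.1 t ht hx.2).1).1)
        (fun x hx => hx.1) (by positivity) fun x hx => hx.2
    _ ≤ _ := by gcongr; exact h.volume_le t ht

end IsSmallSupportSubsolution

/-- If the positivity set of a subsolution with values in `[0, 1]` is small enough at each time,
then the subsolution is at most `1 / 2` at the top centre of the cylinder. -/
theorem exists_growth_constant (m : ℕ) {lam Lam : ℝ} (hlam : 0 < lam) (hLam : 0 ≤ Lam) :
    ∃ κ > 0, ∀ (A : Spc m → Matrix (Fin (m + 1)) (Fin (m + 1)) ℝ), IsElliptic lam Lam A →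
      ∀ (y : Spc m → ℝ → ℝ) (x₀ : Spc m) (ρ t₀ : ℝ),
        IsSmallSupportSubsolution A y x₀ ρ t₀ κ → y x₀ t₀ ≤ 1 / 2 := by
  set C : ℝ := 2 * (m + 1) * Lam + 1 with hC
  have hC0 : 0 < C := by positivity
  set ω : ℝ := volume.real (Metric.ball (0 : Spc m) 1) with hω
  have hωtop : volume (Metric.ball (0 : Spc m) 1) ≠ ⊤ := measure_ball_lt_top.ne
  have hω0 : 0 < ω := ENNReal.toReal_pos (Metric.measure_ball_pos _ _ one_pos).ne' hωtop
  set κ : ℝ := ω / (32 * C * 8 ^ (m + 1) * ((m + 1).factorial * (C / lam) ^ (m + 1))) with hκ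
  have hκ0 : 0 < κ := by positivity
  refine ⟨κ, hκ0, fun A hA y x₀ ρ t₀ h => ?_⟩
  by_contra! hy
  have hρ := h.radius_pos
  set E := creepSet y x₀ ρ t₀ with hE
  set c₁ : ℝ := 1 / 4 / (2 * C / ρ ^ 2) with hc₁
  set c₂ : ℝ := 2 * ((m + 1).factorial * (C / (lam * ρ ^ 2)) ^ (m + 1)) * (κ * ρ ^ (m + 1)) with hc₂
  have hc₁0 : 0 < c₁ := by positivity
  have hc₂0 : 0 < c₂ := by positivity
  have hlower : ENNReal.ofReal (c₁ * ((1 / (8 * ρ)) ^ (m + 1) * ω)) ≤ volume E := by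
    have hball : volume (Metric.ball (0 : Spc m) (1 / (8 * ρ))) =
        ENNReal.ofReal ((1 / (8 * ρ)) ^ (m + 1) * ω) := by
      rw [Measure.addHaar_ball _ _ (by positivity), ENNReal.ofReal_mul (by positivity), hω,
        ofReal_measureReal hωtop]
      simp
    rw [ENNReal.ofReal_mul hc₁0.le, ← hball, ← setLIntegral_const, Measure.volume_eq_prod,
      Measure.prod_apply h.measurableSet_creepSet]
    refine le_trans (setLIntegral_mono' Metric.isOpen_ball.measurableSet fun p hp => ?_)
      (setLIntegral_le_lintegral _ _)
    refine h.le_volume_creepSet_slope hlam.le hLam hA hy ?_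
    rw [mem_ball_zero_iff, lt_div_iff₀ (by positivity)] at hp
    linarith
  have hupper : volume E ≤ ENNReal.ofReal (c₂ * ρ ^ 2) := by
    rw [Measure.volume_eq_prod, Measure.prod_apply_symm h.measurableSet_creepSet]
    calc ∫⁻ t, volume ((fun p => (p, t)) ⁻¹' E)
        ≤ ∫⁻ t, (Set.Ioc (t₀ - ρ ^ 2) t₀).indicator (fun _ => ENNReal.ofReal c₂) t := by
          refine lintegral_mono fun t => ?_
          by_cases ht : t ∈ Set.Ioc (t₀ - ρ ^ 2) t₀
          · rw [Set.indicator_of_mem ht, hc₂, ENNReal.ofReal_mul (by positivity)]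
            exact h.volume_creepSet_time_le hlam hLam hA ht
          · have hempty : (fun p => (p, t)) ⁻¹' E = ∅ :=
              Set.eq_empty_of_forall_notMem fun p hp => ht hp.2.1
            rw [hempty, measure_empty]
            exact zero_le
      _ = ENNReal.ofReal (c₂ * ρ ^ 2) := by
          rw [lintegral_indicator measurableSet_Ioc, setLIntegral_const, Real.volume_Ioc,
            ENNReal.ofReal_mul hc₂0.le]
          congr 2
          ring
  have hreal := (ENNReal.ofReal_le_ofReal_iff (by positivity)).1 (hlower.trans hupper)
  have hL : c₁ * ((1 / (8 * ρ)) ^ (m + 1) * ω) = 2 * (c₂ * ρ ^ 2) := by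
    rw [hc₁, hc₂, hκ, div_pow, div_pow, div_pow, mul_pow, mul_pow, one_pow,
      show (ρ ^ 2) ^ (m + 1) = ρ ^ (m + 1) * ρ ^ (m + 1) by ring]
    have hfac : ((m + 1).factorial : ℝ) ≠ 0 := by positivity
    have hP : ρ ^ (m + 1) ≠ 0 := by positivity
    have hQ : C ^ (m + 1) ≠ 0 := by positivity
    have hR : lam ^ (m + 1) ≠ 0 := by positivity
    have hT : (8 : ℝ) ^ (m + 1) ≠ 0 := by positivity
    generalize ((m + 1).factorial : ℝ) = fac at *
    generalize ρ ^ (m + 1) = P at *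
    generalize C ^ (m + 1) = Q at *
    generalize lam ^ (m + 1) = R at *
    generalize (8 : ℝ) ^ (m + 1) = T at *
    field_simp
    norm_num
  have : 0 < c₂ * ρ ^ 2 := by positivity
  linarith

end GrowthLemma

section TubeComparison

open Filter Topology

variable {m : ℕ} {lam Lam : ℝ} {A : Spc m → Matrix (Fin (m + 1)) (Fin (m + 1)) ℝ}

/-- The bump supported in the tube of radius `d` around the segment `X(t) = x₀ + (t₀ - t) • V`. -/
def tubeBump (x₀ V : Spc m) (t₀ t₁ d μ : ℝ) (q : Spc m × ℝ) : ℝ :=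
  Real.exp (-(μ * ((q.2 - t₁) / d ^ 2))) * (1 - ‖q.1 - (x₀ + (t₀ - q.2) • V)‖ ^ 2 / d ^ 2) ^ 2

theorem continuous_tubeBump (x₀ V : Spc m) (t₀ t₁ d μ : ℝ) :
    Continuous (tubeBump x₀ V t₀ t₁ d μ) := by
  unfold tubeBump
  fun_prop

theorem contDiff_tubeBump (x₀ V : Spc m) (t₀ t₁ d μ t : ℝ) :
    ContDiff ℝ 2 fun z => tubeBump x₀ V t₀ t₁ d μ (z, t) := by
  change ContDiff ℝ 2 fun z => Real.exp (-(μ * ((t - t₁) / d ^ 2))) *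
    (1 - ‖z - (x₀ + (t₀ - t) • V)‖ ^ 2 / d ^ 2) ^ 2
  exact contDiff_const.mul ((contDiff_const.sub ((contDiff_norm_sub_sq _).div_const _)).pow 2)

theorem traceHess_tubeBump (M : Matrix (Fin (m + 1)) (Fin (m + 1)) ℝ) (x₀ V : Spc m)
    (t₀ t₁ d μ : ℝ) (x : Spc m) (t : ℝ) {z : Spc m} (hz : z = x - (x₀ + (t₀ - t) • V)) :
    traceHess M (fun z => tubeBump x₀ V t₀ t₁ d μ (z, t)) x =
      Real.exp (-(μ * ((t - t₁) / d ^ 2))) * ((-4 / d ^ 2 * (1 - ‖z‖ ^ 2 / d ^ 2)) * ∑ i, M i i +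
        8 / d ^ 4 * ∑ i, ∑ j, z i * M i j * z j) := by
  set X : Spc m := x₀ + (t₀ - t) • V with hX
  set E : ℝ := Real.exp (-(μ * ((t - t₁) / d ^ 2))) with hE
  have h2 : ContDiffAt ℝ 2 (fun y : Spc m => ‖y - X‖ ^ 2) x := (contDiff_norm_sub_sq X).contDiffAt
  have h4 : ContDiffAt ℝ 2 (fun y : Spc m => (‖y - X‖ ^ 2) ^ 2) x := h2.pow 2
  have h2c : ContDiffAt ℝ 2 (fun y : Spc m => (-2 * E / d ^ 2) * ‖y - X‖ ^ 2) x :=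
    contDiffAt_const.mul h2
  have h4c : ContDiffAt ℝ 2 (fun y : Spc m => (E / d ^ 4) * (‖y - X‖ ^ 2) ^ 2) x :=
    contDiffAt_const.mul h4
  have h24 : ContDiffAt ℝ 2 (fun y : Spc m => (-2 * E / d ^ 2) * ‖y - X‖ ^ 2 +
    (E / d ^ 4) * (‖y - X‖ ^ 2) ^ 2) x := h2c.add h4c
  have heq : (fun y => tubeBump x₀ V t₀ t₁ d μ (y, t)) = fun y : Spc m =>
      ((-2 * E / d ^ 2) * ‖y - X‖ ^ 2 + (E / d ^ 4) * (‖y - X‖ ^ 2) ^ 2) + E := by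
    funext y
    simp only [tubeBump, ← hX, ← hE]
    ring
  have hzX : ∀ i, x i - X i = z i := fun i => by rw [hz]; simp
  rw [heq, traceHess_add _ h24 contDiffAt_const, traceHess_const, traceHess_add _ h2c h4c,
    traceHess_const_mul _ _ h2, traceHess_const_mul _ _ h4, traceHess_norm_sub_sq,
    traceHess_norm_sub_pow_four, ← hz]
  simp only [hzX]
  ring

theorem hasDerivAt_tubeBump (x₀ V : Spc m) (t₀ t₁ d μ : ℝ) (x : Spc m) (t : ℝ) {z : Spc m}
    (hz : z = x - (x₀ + (t₀ - t) • V)) :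
    HasDerivAt (fun s => tubeBump x₀ V t₀ t₁ d μ (x, s))
      (Real.exp (-(μ * ((t - t₁) / d ^ 2))) * (-(μ / d ^ 2) * (1 - ‖z‖ ^ 2 / d ^ 2) ^ 2 -
        4 / d ^ 2 * (1 - ‖z‖ ^ 2 / d ^ 2) * inner ℝ z V)) t := by
  have h1 : HasDerivAt (fun s => x - (x₀ + (t₀ - s) • V)) V t := by
    have := ((((hasDerivAt_id t).const_sub t₀).smul_const V).const_add x₀).const_sub x
    simpa using this
  have h2 := h1.norm_sq
  have h3 : HasDerivAt (fun s => -(μ * ((s - t₁) / d ^ 2))) (-(μ * (1 / d ^ 2))) t :=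
    ((((hasDerivAt_id t).sub_const t₁).div_const (d ^ 2)).const_mul μ).neg
  have h4 := h3.exp.fun_mul (((h2.div_const (d ^ 2)).const_sub 1).fun_pow 2)
  refine h4.congr_deriv ?_
  rw [← hz]
  push_cast
  ring

/-- The bump is a strict subsolution inside the tube. -/
theorem tubeBump_strict (hlam : 0 < lam) (hA : IsElliptic lam Lam A) {V z : Spc m} {d μ : ℝ}
    (hd : 0 < d) (hμ : (8 * lam + 4 * ((m + 1) * Lam) + 4 * (d * ‖V‖)) ^ 2 < 32 * lam * μ)
    (hzd : ‖z‖ < d) (x : Spc m) :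
    -(μ / d ^ 2) * (1 - ‖z‖ ^ 2 / d ^ 2) ^ 2 - 4 / d ^ 2 * (1 - ‖z‖ ^ 2 / d ^ 2) * inner ℝ z V <
      (-4 / d ^ 2 * (1 - ‖z‖ ^ 2 / d ^ 2)) * ∑ i, A x i i +
        8 / d ^ 4 * ∑ i, ∑ j, z i * A x i j * z j := by
  set T := ∑ i, A x i i with hT
  have hTle : T ≤ (m + 1) * Lam := (hA.isEllipticMatrix x).sum_diag_le
  have hQ := (hA.2 x z).1
  set Q := ∑ i, ∑ j, z i * A x i j * z j with hQdef
  set q : ℝ := 1 - ‖z‖ ^ 2 / d ^ 2 with hq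
  have hN : ‖z‖ ^ 2 = d ^ 2 * (1 - q) := by rw [hq]; field_simp; ring
  have hq0 : 0 < q := by
    rw [hq, sub_pos, div_lt_one (by positivity)]
    exact pow_lt_pow_left₀ hzd (norm_nonneg _) (by norm_num)
  have hin : -(d * ‖V‖) ≤ inner ℝ z V := by
    have h1 := (abs_le.1 (abs_real_inner_le_norm z V)).1
    have h2 : ‖z‖ * ‖V‖ ≤ d * ‖V‖ := by gcongr
    linarith
  have hμ0 : 0 < μ := by
    by_contra! h
    nlinarith [sq_nonneg (8 * lam + 4 * ((m + 1) * Lam) + 4 * (d * ‖V‖))]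
  have hkey : 0 < μ * q ^ 2 - (8 * lam + 4 * ((m + 1) * Lam) + 4 * (d * ‖V‖)) * q + 8 * lam := by
    set s := 8 * lam + 4 * ((m + 1) * Lam) + 4 * (d * ‖V‖) with hs
    have h1 : 0 < 4 * μ * (μ * q ^ 2 - s * q + 8 * lam) := by
      nlinarith [sq_nonneg (2 * μ * q - s)]
    exact pos_of_mul_pos_right h1 (by positivity)
  have h1 : q * T ≤ q * ((m + 1) * Lam) := by gcongr
  have h2 : q * -(d * ‖V‖) ≤ q * inner ℝ z V := by gcongr
  have hfin : 0 < 1 / d ^ 2 * (μ * q ^ 2 + 4 * (q * inner ℝ z V) - 4 * (q * T) +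
      8 * (Q / d ^ 2)) := by
    have h3 : lam * (1 - q) ≤ Q / d ^ 2 := by
      rw [le_div_iff₀ (by positivity)]
      calc lam * (1 - q) * d ^ 2 = lam * ‖z‖ ^ 2 := by rw [hN]; ring
        _ ≤ Q := hQ
    refine mul_pos (by positivity) ?_
    linarith
  have heq : (-4 / d ^ 2 * q) * T + 8 / d ^ 4 * Q - (-(μ / d ^ 2) * q ^ 2 -
      4 / d ^ 2 * q * inner ℝ z V) = 1 / d ^ 2 * (μ * q ^ 2 + 4 * (q * inner ℝ z V) - 4 * (q * T) +
      8 * (Q / d ^ 2)) := by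
    field_simp
    ring
  linarith

/-- Propagation of a lower bound along a tube. -/
theorem SolvesL.exp_le_of_tube (hlam : 0 < lam) (hA : IsElliptic lam Lam A)
    {w : Spc m × ℝ → ℝ} {Ω : Set (Spc m × ℝ)} (hw : SolvesL A w Ω) {x₀ V : Spc m}
    {t₀ t₁ d μ F : ℝ} (hd : 0 < d) (ht : t₁ ≤ t₀) (hF : 0 < F)
    (hμ : (8 * lam + 4 * ((m + 1) * Lam) + 4 * (d * ‖V‖)) ^ 2 < 32 * lam * μ)
    (htube : ∀ x t, t ∈ Set.Icc t₁ t₀ → ‖x - (x₀ + (t₀ - t) • V)‖ ≤ d → (x, t) ∈ Ω)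
    (hlsc : ∀ p ∈ Ω, p.2 < t₀ → LowerSemicontinuousWithinAt w {q | p.2 ≤ q.2} p)
    (hge : ∀ p ∈ Ω, -1 ≤ w p)
    (hinit : ∀ x, ‖x - (x₀ + (t₀ - t₁) • V)‖ ≤ d → F ≤ w (x, t₁)) :
    F * Real.exp (-(μ * ((t₀ - t₁) / d ^ 2))) ≤ w (x₀, t₀) + 1 := by
  set S : Set (Spc m × ℝ) :=
    {p | p.2 ∈ Set.Icc t₁ t₀ ∧ ‖p.1 - (x₀ + (t₀ - p.2) • V)‖ ≤ d} with hSdef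
  have hSΩ : ∀ p ∈ S, p ∈ Ω := fun p hp => htube p.1 p.2 hp.1 hp.2
  have hScl : IsClosed S :=
    (isClosed_Icc.preimage continuous_snd).inter (isClosed_le (f := fun p : Spc m × ℝ => ‖p.1 - (x₀ + (t₀ - p.2) • V)‖)
      (g := fun _ => d) (by fun_prop) continuous_const)
  have hS : IsCompact S := by
    refine ((isCompact_closedBall x₀ (d + (t₀ - t₁) * ‖V‖)).prod
      (isCompact_Icc (a := t₁) (b := t₀))).of_isClosed_subset hScl fun p hp => ⟨?_, hp.1⟩
    rw [mem_closedBall_iff_norm]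
    have h1 : p.1 - x₀ = (p.1 - (x₀ + (t₀ - p.2) • V)) + (t₀ - p.2) • V := by abel
    rw [h1]
    refine (norm_add_le _ _).trans (add_le_add hp.2 ?_)
    rw [norm_smul, Real.norm_eq_abs, abs_of_nonneg (sub_nonneg.2 hp.1.2)]
    have := hp.1.1
    gcongr
  set ψ := tubeBump x₀ V t₀ t₁ d μ with hψ
  have hψc : Continuous ψ := continuous_tubeBump x₀ V t₀ t₁ d μ
  set v : Spc m × ℝ → ℝ := fun p => F * ψ p - (w p + 1) with hv
  have hψ0 : ψ (x₀, t₀) = Real.exp (-(μ * ((t₀ - t₁) / d ^ 2))) := by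
    simp [hψ, tubeBump]
  have hmem₀ : (x₀, t₀) ∈ S := ⟨⟨ht, le_rfl⟩, by simpa using hd.le⟩
  refine le_of_forall_pos_lt_add fun θ hθ => ?_
  suffices h : ∀ p ∈ S, v p < θ by
    have h1 := h _ hmem₀
    simp only [hv, hψ0] at h1
    linarith
  refine lt_of_forall_slice_max hS ?_ ?_
  · rintro ⟨x, t⟩ hp c hc
    have hpΩ := hSΩ _ hp
    have hc' : F * ψ (x, t) - 1 - c < w (x, t) := by
      simp only [hv] at hc
      linarith
    obtain ⟨e, he1, he2⟩ := exists_between hc'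
    have h1 : ∀ᶠ q in 𝓝[S ∩ {q | t ≤ q.2}] (x, t), F * ψ q - 1 - c < e := by
      have h2 : Continuous fun q => F * ψ q - 1 - c := by fun_prop
      exact ((h2.tendsto (x, t)).eventually (gt_mem_nhds he1)).filter_mono nhdsWithin_le_nhds
    have h2 : ∀ᶠ q in 𝓝[S ∩ {q | t ≤ q.2}] (x, t), e < w q := by
      rcases lt_or_eq_of_le hp.1.2 with hlt | heq
      · exact (hlsc _ hpΩ hlt e he2).filter_mono (nhdsWithin_mono _ Set.inter_subset_right)
      · have h3 := (hw _ hpΩ).1.continuousAt.eventually (lt_mem_nhds he2)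
        have h4 := ((continuous_fst.tendsto (x, t)).eventually h3).filter_mono
          (nhdsWithin_le_nhds (s := S ∩ {q | t ≤ q.2}))
        filter_upwards [h4, self_mem_nhdsWithin] with q hq1 hq2
        have h5 : q.2 = t := le_antisymm (hq2.1.1.2.trans heq.symm.le) hq2.2
        have h6 : q = (q.1, t) := Prod.ext rfl h5
        rw [h6]
        exact hq1
    filter_upwards [h1, h2] with q hq1 hq2
    simp only [hv]
    linarith
  · rintro ⟨x, t⟩ hp hθv hmax
    have hpΩ := hSΩ _ hp
    obtain ⟨htI, hxd⟩ := hp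
    simp only at htI hxd
    have hge1 := hge _ hpΩ
    simp only [hv] at hθv
    set z : Spc m := x - (x₀ + (t₀ - t) • V) with hz
    have hzd : ‖z‖ < d := by
      refine lt_of_le_of_ne hxd fun h => ?_
      have : ψ (x, t) = 0 := by
        have hd2 : d ^ 2 ≠ 0 := by positivity
        simp [hψ, tubeBump, ← hz, h, div_self hd2]
      rw [this] at hθv
      linarith
    have htt : t₁ < t := by
      refine lt_of_le_of_ne htI.1 fun h => ?_
      have h1 : ψ (x, t) ≤ 1 := by
        have h2 : ψ (x, t) = (1 - ‖z‖ ^ 2 / d ^ 2) ^ 2 := by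
          have h0 : ψ (x, t) = Real.exp (-(μ * ((t - t₁) / d ^ 2))) *
            (1 - ‖z‖ ^ 2 / d ^ 2) ^ 2 := rfl
          rw [h0, sub_eq_zero.2 h.symm]
          simp
        have h3 : ‖z‖ ^ 2 / d ^ 2 ≤ 1 := by
          rw [div_le_one (by positivity)]
          gcongr
        have h4 : 0 ≤ ‖z‖ ^ 2 / d ^ 2 := by positivity
        rw [h2]
        exact pow_le_one₀ (by linarith) (by linarith)
      have h2 : F ≤ w (x, t) := by
        rw [← h]
        refine hinit x ?_
        rw [h]
        exact hxd
      have h3 : F * ψ (x, t) ≤ F * 1 := by gcongr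
      linarith
    have hcont : Continuous fun p : Spc m × ℝ => ‖p.1 - (x₀ + (t₀ - p.2) • V)‖ := by fun_prop
    have hnear : ∀ᶠ p in 𝓝 (x, t), ‖p.1 - (x₀ + (t₀ - p.2) • V)‖ < d :=
      (hcont.tendsto (x, t)).eventually (gt_mem_nhds hzd)
    have hwx : ContDiffAt ℝ 2 (fun y => w (y, t)) x := (hw _ hpΩ).1
    have hψx : ContDiffAt ℝ 2 (fun y => ψ (y, t)) x :=
      (contDiff_tubeBump x₀ V t₀ t₁ d μ t).contDiffAt
    have hFψx : ContDiffAt ℝ 2 (fun y => F * ψ (y, t)) x := contDiffAt_const.mul hψx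
    have hw1 : ContDiffAt ℝ 2 (fun y => w (y, t) + 1) x := hwx.add contDiffAt_const
    have hloc : IsLocalMax (fun y => F * ψ (y, t) - (w (y, t) + 1)) x := by
      have h1 : Continuous fun y : Spc m => (y, t) := by fun_prop
      filter_upwards [(h1.tendsto x).eventually hnear] with y hy
      exact hmax (y, t) ⟨htI, hy.le⟩ rfl
    have htr := (hA.isEllipticMatrix x).traceHess_nonpos hlam.le (hFψx.sub hw1) hloc
    rw [traceHess_sub _ hFψx hw1, traceHess_const_mul _ _ hψx,
      traceHess_add _ hwx contDiffAt_const, traceHess_const, traceHess_tubeBump _ _ _ _ _ _ _ _ _ hz]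
      at htr
    have hder : HasDerivAt (fun s => F * ψ (x, s) - (w (x, s) + 1)) _ t :=
      ((hasDerivAt_tubeBump x₀ V t₀ t₁ d μ x t hz).const_mul F).sub ((hw _ hpΩ).2.add_const 1)
    have hstrict := tubeBump_strict hlam hA hd hμ hzd x
    rw [Lop_eq_traceHess] at hder
    have hneg := mul_lt_mul_of_pos_left hstrict
      (mul_pos hF (Real.exp_pos (-(μ * ((t - t₁) / d ^ 2)))))
    rw [mul_assoc, mul_assoc F] at hneg
    have hev := hder.hasDerivWithinAt (s := Set.Iic t) |>.eventually_sub_mul_lt (c := 0)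
      (by linarith)
    have hev2 : ∀ᶠ s in 𝓝[<] t, ‖x - (x₀ + (t₀ - s) • V)‖ < d := by
      have h1 : Continuous fun s : ℝ => (x, s) := by fun_prop
      exact ((h1.tendsto t).eventually hnear).filter_mono nhdsWithin_le_nhds
    obtain ⟨s, h1, h2, h3⟩ := (hev.and (hev2.and (Ioo_mem_nhdsLT htt))).exists
    refine ⟨(x, s), ⟨⟨h3.1.le, h3.2.le.trans htI.2⟩, h2.le⟩, h3.2, ?_⟩
    simp only [hv]
    linarith

end TubeComparison

section HolderTube

open Filter Topology

variable {m : ℕ} {lam Lam : ℝ} {A : Spc m → Matrix (Fin (m + 1)) (Fin (m + 1)) ℝ}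

@[simp]
theorem xprime_apply (x : Spc m) (i : Fin m) : xprime x i = x i.castSucc := rfl

theorem continuous_xprime : Continuous (xprime : Spc m → Spc' m) :=
  (PiLp.continuous_toLp 2 _).comp (continuous_pi fun i => by fun_prop)

theorem continuous_xlast : Continuous (xlast : Spc m → ℝ) := by
  unfold xlast
  fun_prop

theorem norm_xprime_sub_le (x y : Spc m) : ‖xprime x - xprime y‖ ≤ ‖x - y‖ := by
  rw [EuclideanSpace.norm_eq, EuclideanSpace.norm_eq]
  refine Real.sqrt_le_sqrt ?_
  rw [Fin.sum_univ_castSucc]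
  simpa using sq_nonneg _

theorem abs_xlast_sub_le (x y : Spc m) : |xlast x - xlast y| ≤ ‖x - y‖ := by
  have := PiLp.norm_apply_le (x - y) (Fin.last m)
  simpa [xlast] using this

theorem abs_apply_sub_le (x y : Spc m) (i : Fin (m + 1)) : |x i - y i| ≤ ‖x - y‖ := by
  have := PiLp.norm_apply_le (x - y) i
  simpa using this

theorem continuous_hGamma {g : Spc' m → ℝ → ℝ}
    (hg : Continuous fun q : Spc' m × ℝ => g q.1 q.2) : Continuous (hGamma g) := by
  have h1 : Continuous fun p : Spc m × ℝ => (xprime p.1, p.2) :=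
    (continuous_xprime.comp continuous_fst).prodMk continuous_snd
  exact (continuous_xlast.comp continuous_fst).sub (hg.comp h1)

theorem mem_CylBH_iff {g : Spc' m → ℝ → ℝ} {r : ℝ} {p : Spc m × ℝ} :
    p ∈ CylBH g r ↔ (∀ i : Fin m, |p.1 i.castSucc| < r) ∧ -r < p.2 ∧ p.2 ≤ 0 ∧
      0 < hGamma g p ∧ hGamma g p < r := by
  have h1 : ∀ i : Fin m, (-r < xprime p.1 i ∧ xprime p.1 i < r) ↔ |p.1 i.castSucc| < r :=
    fun i => abs_lt.symm
  have h2 : g (xprime p.1) p.2 < xlast p.1 ↔ 0 < hGamma g p := sub_pos.symm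
  have h3 : xlast p.1 < g (xprime p.1) p.2 + r ↔ hGamma g p < r := sub_lt_iff_lt_add'.symm
  rw [CylBH, Set.mem_ofPred_eq, h2, h3]
  simp only [h1]

theorem mem_ASetH_iff {g : Spc' m → ℝ → ℝ} {β r : ℝ} {p : Spc m × ℝ} :
    p ∈ ASetH g β r ↔ p ∈ CylBH g r ∧ r ^ β ≤ hGamma g p := by
  rw [ASetH, Set.mem_sep_iff, hGamma, le_sub_iff_add_le']

theorem isOpen_CylBH_inter {g : Spc' m → ℝ → ℝ}
    (hg : Continuous fun q : Spc' m × ℝ => g q.1 q.2) (r : ℝ) :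
    IsOpen (CylBH g r ∩ {p | p.2 < 0}) := by
  have heq : CylBH g r ∩ {p | p.2 < 0} = {p | ∀ i : Fin m, |p.1 i.castSucc| < r} ∩
      ({p | -r < p.2} ∩ ({p | p.2 < 0} ∩ ({p | 0 < hGamma g p} ∩ {p | hGamma g p < r}))) := by
    ext p
    simp only [Set.mem_inter_iff, mem_CylBH_iff, Set.mem_ofPred_eq]
    constructor
    · rintro ⟨⟨h1, h2, -, h4, h5⟩, h6⟩
      exact ⟨h1, h2, h6, h4, h5⟩
    · rintro ⟨h1, h2, h3, h4, h5⟩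
      exact ⟨⟨h1, h2, h3.le, h4, h5⟩, h3⟩
  have hG := continuous_hGamma hg
  rw [heq]
  refine IsOpen.inter ?_ ((isOpen_lt continuous_const continuous_snd).inter
    ((isOpen_lt continuous_snd continuous_const).inter
      ((isOpen_lt continuous_const hG).inter (isOpen_lt hG continuous_const))))
  simp only [Set.ofPred_forall]
  refine isOpen_iInter_of_finite fun i => ?_
  exact isOpen_lt (f := fun p : Spc m × ℝ => |p.1 i.castSucc|) (by fun_prop) continuous_const

theorem lowerSemicontinuousWithinAt_of_mem_CylBH (hlam : 0 ≤ lam) (hLam : 0 ≤ Lam)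
    (hA : IsElliptic lam Lam A) {g : Spc' m → ℝ → ℝ}
    (hg : Continuous fun q : Spc' m × ℝ => g q.1 q.2) {r : ℝ} {w : Spc m × ℝ → ℝ}
    (hw : SolvesL A w (CylBH g r)) (hge : ∀ p ∈ CylBH g r, -1 ≤ w p) {p : Spc m × ℝ}
    (hp : p ∈ CylBH g r) (hp0 : p.2 < 0) :
    LowerSemicontinuousWithinAt w {q | p.2 ≤ q.2} p :=
  SolvesL.lowerSemicontinuousWithinAt hlam hLam hA (isOpen_CylBH_inter hg r)
    (fun q hq => hw q hq.1) (fun q hq => hge q hq.1) p ⟨hp, hp0⟩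

/-- Oscillation of the height function along the tube of radius `σ² r^{β/α}` and duration
`σ⁴ r^{β(1+1/α)}`. -/
theorem abs_sub_le_of_holderSemi {g : Spc' m → ℝ → ℝ} {α β K σ r : ℝ} (hα : 1 / 2 < α)
    (hK : 0 ≤ K) (hg : HolderSemi α (α / (1 + α)) K g) (hσ : 0 < σ) (hσ1 : σ ≤ 1) (hr : 0 < r)
    {x' y' : Spc' m} {t s : ℝ} (hx : ‖x' - y'‖ ≤ σ ^ 2 * r ^ (β / α))
    (ht : |t - s| ≤ σ ^ 4 * r ^ (β * (1 + 1 / α))) :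
    |g x' t - g y' s| ≤ 2 * K * σ * r ^ β := by
  have hα0 : 0 < α := by linarith
  have h1 : ‖x' - y'‖ ^ α ≤ σ * r ^ β := by
    calc ‖x' - y'‖ ^ α ≤ (σ ^ 2 * r ^ (β / α)) ^ α := by gcongr
      _ = σ ^ (2 * α) * r ^ β := by
        rw [Real.mul_rpow (by positivity) (by positivity), ← Real.rpow_natCast, ← Real.rpow_mul hσ.le,
          ← Real.rpow_mul hr.le, div_mul_cancel₀ _ hα0.ne']
        norm_num
      _ ≤ σ ^ (1 : ℝ) * r ^ β := by
        gcongr ?_ * _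
        exact Real.rpow_le_rpow_of_exponent_ge hσ hσ1 (by linarith)
      _ = σ * r ^ β := by rw [Real.rpow_one]
  have h2 : |t - s| ^ (α / (1 + α)) ≤ σ * r ^ β := by
    calc |t - s| ^ (α / (1 + α)) ≤ (σ ^ 4 * r ^ (β * (1 + 1 / α))) ^ (α / (1 + α)) := by gcongr
      _ = σ ^ (4 * (α / (1 + α))) * r ^ β := by
        rw [Real.mul_rpow (by positivity) (by positivity), ← Real.rpow_natCast, ← Real.rpow_mul hσ.le,
          ← Real.rpow_mul hr.le]
        have : β * (1 + 1 / α) * (α / (1 + α)) = β := by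
          field_simp
          ring
        rw [this]
        norm_num
      _ ≤ σ ^ (1 : ℝ) * r ^ β := by
        gcongr ?_ * _
        refine Real.rpow_le_rpow_of_exponent_ge hσ hσ1 ?_
        rw [← mul_div_assoc, le_div_iff₀ (by linarith)]
        linarith
      _ = σ * r ^ β := by rw [Real.rpow_one]
  calc |g x' t - g y' s| ≤ K * (‖x' - y'‖ ^ α + |t - s| ^ (α / (1 + α))) := hg x' y' t s
    _ ≤ K * (σ * r ^ β + σ * r ^ β) := by gcongr
    _ = 2 * K * σ * r ^ β := by ring

/-- Positivity propagates down to height `(r/2)^β`. -/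
theorem one_le_of_mem_ASetH (hlam : 0 < lam) (hLam : 0 ≤ Lam) (hA : IsElliptic lam Lam A)
    {g : Spc' m → ℝ → ℝ} (hgc : Continuous fun q : Spc' m × ℝ => g q.1 q.2) {α β K σ μ r : ℝ}
    (hα : 1 / 2 < α) (hα1 : α ≤ 1) (hβ : 0 < β) (hK : 0 ≤ K)
    (hg : HolderSemi α (α / (1 + α)) K g)
    (hσ0 : 0 < σ) (hσ1 : σ ≤ 1) (hσ : (2 * K + 1) * σ ≤ (1 / 2) ^ β / 2) (hμ0 : 0 < μ)
    (hμ : (8 * lam + 4 * ((m + 1) * Lam) + 4 * (2 / σ ^ 2)) ^ 2 < 32 * lam * μ)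
    (hr : 0 < r) (hr1 : r < 1) (hrβ : 5 * r ^ β < r) {w : Spc m × ℝ → ℝ}
    (hw : SolvesL A w (CylBH g r)) (hge : ∀ p ∈ CylBH g r, -1 ≤ w p)
    (hA_ge : ∀ p ∈ ASetH g β r, Real.exp ((μ + 1) * r ^ (β * (1 - 1 / α))) ≤ w p) :
    ∀ p ∈ ASetH g β (r / 2), 1 ≤ w p := by
  have hα0 : 0 < α := by linarith
  rintro ⟨x₀, t₀⟩ hp
  obtain ⟨hp, hph⟩ := mem_ASetH_iff.1 hp
  obtain ⟨hpi, hpt, hpt0, -, hpr⟩ := mem_CylBH_iff.1 hp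
  simp only at hpi hpt hpt0
  set s : ℝ := r ^ β with hs
  have hs0 : 0 < s := Real.rpow_pos_of_pos hr _
  have hγ : 1 ≤ r ^ (β * (1 - 1 / α)) := by
    refine Real.one_le_rpow_of_pos_of_le_one_of_nonpos hr hr1.le ?_
    have : 1 ≤ 1 / α := by rw [le_div_iff₀ hα0]; linarith
    exact mul_nonpos_of_nonneg_of_nonpos hβ.le (by linarith)
  rcases le_or_gt s (hGamma g (x₀, t₀)) with hhigh | hlow
  · have hmem : (x₀, t₀) ∈ ASetH g β r := mem_ASetH_iff.2
      ⟨mem_CylBH_iff.2 ⟨fun i => (hpi i).trans (by linarith), by simp only; linarith, hpt0,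
        hs0.trans_le hhigh, by linarith⟩, hhigh⟩
    refine le_trans (Real.one_le_exp ?_) (hA_ge _ hmem)
    positivity
  set d : ℝ := σ ^ 2 * r ^ (β / α) with hd
  set T : ℝ := σ ^ 4 * r ^ (β * (1 + 1 / α)) with hT
  have hd0 : 0 < d := by positivity
  have hT0 : 0 < T := by positivity
  have hds : d ≤ σ * s := by
    have h1 : r ^ (β / α) ≤ s := by
      refine Real.rpow_le_rpow_of_exponent_ge hr hr1.le ?_
      rw [le_div_iff₀ hα0]
      nlinarith
    have h2 : σ ^ 2 ≤ σ := by nlinarith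
    exact mul_le_mul h2 h1 (by positivity) hσ0.le
  have hTs : T ≤ s := by
    have h1 : r ^ (β * (1 + 1 / α)) ≤ s := by
      refine Real.rpow_le_rpow_of_exponent_ge hr hr1.le ?_
      have : 0 ≤ β * (1 / α) := by positivity
      linarith
    calc T ≤ 1 * s := mul_le_mul (pow_le_one₀ hσ0.le hσ1) h1 (by positivity) zero_le_one
      _ = s := one_mul s
  have hσs : σ * s ≤ s := mul_le_of_le_one_left hs0.le hσ1
  have hhalf : (r / 2) ^ β = (1 / 2) ^ β * s := by
    rw [div_eq_mul_one_div, Real.mul_rpow hr.le (by norm_num), mul_comm]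
  have hhalf1 : (1 / 2 : ℝ) ^ β ≤ 1 := Real.rpow_le_one (by norm_num) (by norm_num) hβ.le
  have hhalf0 : 0 < (1 / 2 : ℝ) ^ β := by positivity
  set V : Spc m := (2 * s / T) • eVec m (Fin.last m) with hV
  have hVnorm : ‖V‖ = 2 * s / T := by
    rw [hV, norm_smul, Real.norm_of_nonneg (by positivity), eVec, PiLp.norm_single]
    simp
  have hX' : ∀ t, ∀ i : Fin m, (x₀ + (t₀ - t) • V) i.castSucc = x₀ i.castSucc := fun t i => by
    have : i.castSucc ≠ Fin.last m := (Fin.castSucc_lt_last i).ne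
    simp [hV, eVec, this]
  have hXn : ∀ t, xlast (x₀ + (t₀ - t) • V) = xlast x₀ + 2 * s * ((t₀ - t) / T) := fun t => by
    simp [hV, eVec, xlast]
    ring
  have hXp : ∀ t, xprime (x₀ + (t₀ - t) • V) = xprime x₀ := fun t => by
    ext i
    exact hX' t i
  have hheight : ∀ x t, t ∈ Set.Icc (t₀ - T) t₀ → ‖x - (x₀ + (t₀ - t) • V)‖ ≤ d →
      |hGamma g (x, t) - (hGamma g (x₀, t₀) + 2 * s * ((t₀ - t) / T))| ≤ (1 / 2) ^ β / 2 * s := by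
    intro x t ht hx
    have h1 : |g (xprime x) t - g (xprime x₀) t₀| ≤ 2 * K * σ * s := by
      refine abs_sub_le_of_holderSemi hα hK hg hσ0 hσ1 hr ?_ ?_
      · rw [← hXp t]
        exact (norm_xprime_sub_le _ _).trans hx
      · rw [abs_le]
        constructor <;> linarith [ht.1, ht.2]
    have h2 := (abs_xlast_sub_le x (x₀ + (t₀ - t) • V)).trans (hx.trans hds)
    rw [hXn] at h2
    have h3 : hGamma g (x, t) - (hGamma g (x₀, t₀) + 2 * s * ((t₀ - t) / T)) =
        (xlast x - (xlast x₀ + 2 * s * ((t₀ - t) / T))) - (g (xprime x) t - g (xprime x₀) t₀) := by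
      simp only [hGamma]
      ring
    rw [h3]
    refine (abs_sub _ _).trans ?_
    have h4 := mul_le_mul_of_nonneg_right hσ hs0.le
    linarith
  have hcyl : ∀ x t, t ∈ Set.Icc (t₀ - T) t₀ → ‖x - (x₀ + (t₀ - t) • V)‖ ≤ d →
      (x, t) ∈ CylBH g r := by
    intro x t ht hx
    have hh := abs_le.1 (hheight x t ht hx)
    have hτ0 : 0 ≤ 2 * s * ((t₀ - t) / T) :=
      mul_nonneg (by positivity) (div_nonneg (by linarith [ht.2]) hT0.le)
    have hτ1 : 2 * s * ((t₀ - t) / T) ≤ 2 * s * 1 := by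
      have : (t₀ - t) / T ≤ 1 := by
        rw [div_le_one hT0]
        linarith [ht.1]
      gcongr
    have hc0 : 0 < (1 / 2 : ℝ) ^ β * s := by positivity
    have hc1 : (1 / 2 : ℝ) ^ β * s ≤ 1 * s := by gcongr
    refine mem_CylBH_iff.2 ⟨fun i => ?_, ?_, ht.2.trans hpt0, ?_, ?_⟩
    · have h1 := (abs_apply_sub_le x (x₀ + (t₀ - t) • V) i.castSucc).trans hx
      rw [hX'] at h1
      have h2 := abs_sub_abs_le_abs_sub (x i.castSucc) (x₀ i.castSucc)
      have h3 := hpi i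
      simp only
      linarith
    · have := ht.1
      simp only
      linarith
    · linarith [hh.1]
    · linarith [hh.2]
  have hTd : T / d ^ 2 = r ^ (β * (1 - 1 / α)) := by
    rw [hT, hd, mul_pow, ← Real.rpow_natCast (r ^ (β / α)), ← Real.rpow_mul hr.le,
      ← pow_mul, mul_div_mul_left _ _ (by positivity), ← Real.rpow_sub hr]
    congr 1
    push_cast
    ring
  have hdV : d * ‖V‖ = 2 / σ ^ 2 := by
    have h1 : r ^ (β * (1 + 1 / α)) = r ^ (β / α) * s := by
      rw [hs, ← Real.rpow_add hr]
      congr 1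
      ring
    have h2 : 0 < r ^ (β / α) := by positivity
    rw [hVnorm, hT, hd, h1]
    field_simp
  have hfinal := SolvesL.exp_le_of_tube (x₀ := x₀) (V := V) (t₀ := t₀) (t₁ := t₀ - T) (d := d)
    (μ := μ) hlam hA hw hd0 (by linarith) (Real.exp_pos ((μ + 1) * r ^ (β * (1 - 1 / α))))
    (by rw [hdV]; exact hμ) ?_ ?_ hge ?_
  · rw [sub_sub_cancel, hTd, ← Real.exp_add] at hfinal
    have h1 : Real.exp 1 ≤ Real.exp ((μ + 1) * r ^ (β * (1 - 1 / α)) +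
        -(μ * r ^ (β * (1 - 1 / α)))) := by
      rw [Real.exp_le_exp]
      linarith
    have h2 := Real.add_one_le_exp 1
    linarith
  · exact hcyl
  · exact fun p hp hlt => lowerSemicontinuousWithinAt_of_mem_CylBH hlam.le hLam hA hgc hw hge hp
      (hlt.trans_le hpt0)
  · intro x hx
    have hmem : t₀ - T ∈ Set.Icc (t₀ - T) t₀ := ⟨le_rfl, by linarith⟩
    refine hA_ge _ (mem_ASetH_iff.2 ⟨hcyl x _ hmem hx, ?_⟩)
    have hh := (abs_le.1 (hheight x _ hmem hx)).1
    rw [sub_sub_cancel, div_self hT0.ne'] at hh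
    have hc0 : 0 < (1 / 2 : ℝ) ^ β * s := by positivity
    linarith

end HolderTube

section Decay

open Filter Topology MeasureTheory

variable {m : ℕ} {lam Lam : ℝ} {A : Spc m → Matrix (Fin (m + 1)) (Fin (m + 1)) ℝ}

/-- Volume of a layer of height `s` above a continuous graph over a cube. -/
theorem volume_graph_layer_le {G : Spc' m → ℝ} (hG : Continuous G) (c : Fin m → ℝ) {ρ s : ℝ}
    (hρ : 0 ≤ ρ) :
    volume {x : Spc m | (∀ i : Fin m, |x i.castSucc - c i| ≤ ρ) ∧ G (xprime x) < xlast x ∧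
      xlast x < G (xprime x) + s} ≤ ENNReal.ofReal (s * (2 * ρ) ^ m) := by
  set Q : Set (Fin m → ℝ) := Set.Icc (fun i => c i - ρ) fun i => c i + ρ with hQ
  set S : Set (ℝ × (Fin m → ℝ)) :=
    {q | q.2 ∈ Q ∧ G (WithLp.toLp 2 q.2) < q.1 ∧ q.1 < G (WithLp.toLp 2 q.2) + s} with hS
  have hGc : Continuous fun q : ℝ × (Fin m → ℝ) => G (WithLp.toLp 2 q.2) :=
    hG.comp ((PiLp.continuous_toLp 2 _).comp continuous_snd)
  have hSm : MeasurableSet S :=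
    (measurable_snd measurableSet_Icc).inter
      ((measurableSet_lt hGc.measurable measurable_fst).inter
        (measurableSet_lt measurable_fst (hGc.add continuous_const).measurable))
  have hmp := (volume_preserving_piFinSuccAbove (fun _ : Fin (m + 1) => ℝ) (Fin.last m)).comp
    (PiLp.volume_preserving_ofLp (Fin (m + 1)))
  have hpre : {x : Spc m | (∀ i : Fin m, |x i.castSucc - c i| ≤ ρ) ∧ G (xprime x) < xlast x ∧
      xlast x < G (xprime x) + s} =
      (MeasurableEquiv.piFinSuccAbove (fun _ : Fin (m + 1) => ℝ) (Fin.last m) ∘ WithLp.ofLp) ⁻¹'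
        S := by
    ext x
    have h1 : (MeasurableEquiv.piFinSuccAbove (fun _ : Fin (m + 1) => ℝ) (Fin.last m) ∘
        WithLp.ofLp) x = (xlast x, fun i : Fin m => x i.castSucc) := by
      refine Prod.ext rfl (funext fun i => ?_)
      change x ((Fin.last m).succAbove i) = _
      rw [Fin.succAbove_last]
    rw [Set.mem_preimage, h1]
    have h2 : (fun i : Fin m => x i.castSucc) ∈ Q ↔ ∀ i : Fin m, |x i.castSucc - c i| ≤ ρ := by
      rw [hQ, Set.mem_Icc, Pi.le_def, Pi.le_def, ← forall_and]
      refine forall_congr' fun i => ?_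
      rw [abs_le]
      constructor <;> rintro ⟨h3, h4⟩ <;> constructor <;> linarith
    simp only [hS, Set.mem_ofPred_eq, h2]
    rfl
  rw [hpre, hmp.measure_preimage hSm.nullMeasurableSet, Measure.volume_eq_prod,
    Measure.prod_apply_symm hSm]
  calc ∫⁻ b, volume ((fun a => (a, b)) ⁻¹' S)
      ≤ ∫⁻ b, Q.indicator (fun _ => ENNReal.ofReal s) b := by
        refine lintegral_mono fun b => ?_
        by_cases hb : b ∈ Q
        · rw [Set.indicator_of_mem hb]
          calc volume ((fun a => (a, b)) ⁻¹' S)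
              ≤ volume (Set.Ioo (G (WithLp.toLp 2 b)) (G (WithLp.toLp 2 b) + s)) :=
                measure_mono fun a ha => ha.2
            _ = ENNReal.ofReal s := by rw [Real.volume_Ioo, add_sub_cancel_left]
        · have : (fun a => (a, b)) ⁻¹' S = ∅ :=
            Set.eq_empty_of_forall_notMem fun a ha => hb ha.1
          rw [this, measure_empty]
          exact zero_le
    _ = ENNReal.ofReal s * volume Q := by
        rw [lintegral_indicator measurableSet_Icc, setLIntegral_const]
    _ = ENNReal.ofReal s * ENNReal.ofReal (2 * ρ) ^ m := by
        rw [hQ, Real.volume_Icc_pi]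
        simp only [add_sub_sub_cancel, ← two_mul, Finset.prod_const, Finset.card_univ,
          Fintype.card_fin]
    _ = ENNReal.ofReal (s * (2 * ρ) ^ m) := by
        rw [← ENNReal.ofReal_pow (by positivity), ENNReal.ofReal_mul' (by positivity)]

/-- The negative part of `w`, extended by zero outside `Ω`. -/
def extNegPart (w : Spc m × ℝ → ℝ) (Ω : Set (Spc m × ℝ)) (p : Spc m × ℝ) : ℝ :=
  if p ∈ Ω then max (-w p) 0 else 0

theorem extNegPart_nonneg (w : Spc m × ℝ → ℝ) (Ω : Set (Spc m × ℝ)) (p : Spc m × ℝ) :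
    0 ≤ extNegPart w Ω p := by
  unfold extNegPart
  split_ifs
  exacts [le_max_right _ _, le_rfl]

theorem extNegPart_of_mem {w : Spc m × ℝ → ℝ} {Ω : Set (Spc m × ℝ)} {p : Spc m × ℝ}
    (hp : p ∈ Ω) : extNegPart w Ω p = max (-w p) 0 := if_pos hp

theorem extNegPart_of_notMem {w : Spc m × ℝ → ℝ} {Ω : Set (Spc m × ℝ)} {p : Spc m × ℝ}
    (hp : p ∉ Ω) : extNegPart w Ω p = 0 := if_neg hp

theorem extNegPart_pos {w : Spc m × ℝ → ℝ} {Ω : Set (Spc m × ℝ)} {p : Spc m × ℝ}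
    (hp : 0 < extNegPart w Ω p) : p ∈ Ω ∧ w p < 0 := by
  by_cases h : p ∈ Ω
  · rw [extNegPart_of_mem h] at hp
    refine ⟨h, ?_⟩
    rcases lt_max_iff.1 hp with h1 | h1
    · linarith
    · exact absurd h1 (lt_irrefl _)
  · exact absurd hp (by rw [extNegPart_of_notMem h]; exact lt_irrefl _)

variable {g : Spc' m → ℝ → ℝ} {β r : ℝ} {w : Spc m × ℝ → ℝ}

theorem continuousAt_extNegPart_or_mem (hg : Continuous fun q : Spc' m × ℝ => g q.1 q.2)
    (hrβ : r ^ β < r)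
    (hvan : VanishesOn (fun q => max (-w q) 0) (CylBH g r) (graphSet g))
    (hpos : ∀ p ∈ ASetH g β r, 0 < w p) {p : Spc m × ℝ} (hp : ∀ i : Fin m, |p.1 i.castSucc| < r)
    (hp1 : -r < p.2) (hp2 : p.2 ≤ 0) :
    ContinuousAt (extNegPart w (CylBH g r)) p ∨ p ∈ CylBH g r := by
  have hG : ContinuousAt (hGamma g) p := (continuous_hGamma hg).continuousAt
  have hzero : (∀ᶠ q in 𝓝 p, extNegPart w (CylBH g r) q = 0) →
      ContinuousAt (extNegPart w (CylBH g r)) p := fun h =>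
    (continuousAt_const (y := (0 : ℝ))).congr (h.mono fun q hq => hq.symm)
  rcases lt_trichotomy (hGamma g p) 0 with h | h | h
  · left
    refine hzero ?_
    filter_upwards [hG.eventually (gt_mem_nhds h)] with q hq
    exact extNegPart_of_notMem fun hq' => lt_asymm hq (mem_CylBH_iff.1 hq').2.2.2.1
  · left
    have hnot : p ∉ CylBH g r := fun hq => (mem_CylBH_iff.1 hq).2.2.2.1.ne' h
    have hlim : Tendsto (fun q => max (-w q) 0) (𝓝[CylBH g r] p) (𝓝 0) := by
      by_cases hcl : p ∈ closure (CylBH g r)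
      · exact hvan p ⟨sub_eq_zero.1 h, hcl⟩
      · rw [notMem_closure_iff_nhdsWithin_eq_bot.1 hcl]
        exact tendsto_bot
    rw [ContinuousAt, extNegPart_of_notMem hnot]
    refine Metric.tendsto_nhds.2 fun ε hε => ?_
    have h1 := Metric.tendsto_nhds.1 hlim ε hε
    filter_upwards [eventually_nhdsWithin_iff.1 h1] with q hq
    by_cases hqm : q ∈ CylBH g r
    · rw [extNegPart_of_mem hqm]
      exact hq hqm
    · rw [extNegPart_of_notMem hqm, dist_self]
      exact hε
  · rcases lt_or_ge (hGamma g p) r with h' | h'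
    · exact Or.inr (mem_CylBH_iff.2 ⟨hp, hp1, hp2, h, h'⟩)
    · left
      refine hzero ?_
      filter_upwards [hG.eventually (lt_mem_nhds (hrβ.trans_le h'))] with q hq
      by_cases hqm : q ∈ CylBH g r
      · rw [extNegPart_of_mem hqm]
        have := hpos q (mem_ASetH_iff.2 ⟨hqm, hq.le⟩)
        exact max_eq_right (by linarith)
      · exact extNegPart_of_notMem hqm

theorem eventually_mem_CylBH (hg : Continuous fun q : Spc' m × ℝ => g q.1 q.2)
    {p : Spc m × ℝ} (hp : p ∈ CylBH g r) : ∀ᶠ q in 𝓝 p, q.2 ≤ 0 → q ∈ CylBH g r := by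
  obtain ⟨h1, h2, -, h4, h5⟩ := mem_CylBH_iff.1 hp
  have hG : ContinuousAt (hGamma g) p := (continuous_hGamma hg).continuousAt
  have e1 : ∀ᶠ q : Spc m × ℝ in 𝓝 p, ∀ i : Fin m, |q.1 i.castSucc| < r :=
    eventually_all.2 fun i => by
      have : Continuous fun q : Spc m × ℝ => |q.1 i.castSucc| := by fun_prop
      exact (this.tendsto p).eventually (gt_mem_nhds (h1 i))
  filter_upwards [e1, (continuous_snd.tendsto p).eventually (lt_mem_nhds h2),
    hG.eventually (lt_mem_nhds h4), hG.eventually (gt_mem_nhds h5)] with q q1 q2 q4 q5 q3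
  exact mem_CylBH_iff.2 ⟨q1, q2, q3, q4, q5⟩

theorem eventually_mem_CylBH_space (hg : Continuous fun q : Spc' m × ℝ => g q.1 q.2)
    {x : Spc m} {t : ℝ} (hp : (x, t) ∈ CylBH g r) : ∀ᶠ z in 𝓝 x, (z, t) ∈ CylBH g r := by
  have h1 : Continuous fun z : Spc m => (z, t) := by fun_prop
  filter_upwards [(h1.tendsto x).eventually (eventually_mem_CylBH hg hp)] with z hz
  exact hz (mem_CylBH_iff.1 hp).2.2.1

theorem eventually_mem_CylBH_time (hg : Continuous fun q : Spc' m × ℝ => g q.1 q.2)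
    {x : Spc m} {t : ℝ} (hp : (x, t) ∈ CylBH g r) :
    ∀ᶠ s in 𝓝[Set.Iic 0] t, (x, s) ∈ CylBH g r := by
  have h1 : Continuous fun s : ℝ => (x, s) := by fun_prop
  filter_upwards [((h1.tendsto t).eventually (eventually_mem_CylBH hg hp)).filter_mono
    nhdsWithin_le_nhds, self_mem_nhdsWithin] with s hs hs0
  exact hs hs0

theorem continuousAt_extNegPart_space (hg : Continuous fun q : Spc' m × ℝ => g q.1 q.2)
    (hw : SolvesL A w (CylBH g r)) {x : Spc m} {t : ℝ}
    (h : ContinuousAt (extNegPart w (CylBH g r)) (x, t) ∨ (x, t) ∈ CylBH g r) :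
    ContinuousAt (fun z => extNegPart w (CylBH g r) (z, t)) x := by
  rcases h with h | h
  · exact ContinuousAt.comp (f := fun z => (z, t)) h (by fun_prop)
  · have h1 : ContinuousAt (fun z => max (-w (z, t)) 0) x :=
      (hw _ h).1.continuousAt.neg.max continuousAt_const
    refine h1.congr ?_
    filter_upwards [eventually_mem_CylBH_space hg h] with z hz
    exact (extNegPart_of_mem hz).symm

theorem continuousWithinAt_extNegPart_time (hg : Continuous fun q : Spc' m × ℝ => g q.1 q.2)
    (hw : SolvesL A w (CylBH g r)) {x : Spc m} {t : ℝ}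
    (h : ContinuousAt (extNegPart w (CylBH g r)) (x, t) ∨ (x, t) ∈ CylBH g r) :
    ContinuousWithinAt (fun s => extNegPart w (CylBH g r) (x, s)) (Set.Iic 0) t := by
  rcases h with h | h
  · exact (ContinuousAt.comp (f := fun s : ℝ => (x, s)) h (by fun_prop)).continuousWithinAt
  · have h1 : ContinuousAt (fun s => max (-w (x, s)) 0) t :=
      (hw _ h).2.continuousAt.neg.max continuousAt_const
    refine h1.continuousWithinAt.congr_of_eventuallyEq ?_ (extNegPart_of_mem h)
    filter_upwards [eventually_mem_CylBH_time hg h] with s hs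
    exact extNegPart_of_mem hs

theorem forward_usc_extNegPart (hlam : 0 ≤ lam) (hLam : 0 ≤ Lam) (hA : IsElliptic lam Lam A)
    (hg : Continuous fun q : Spc' m × ℝ => g q.1 q.2) (hw : SolvesL A w (CylBH g r))
    (hge : ∀ p ∈ CylBH g r, -1 ≤ w p) {x : Spc m} {t : ℝ}
    (h : ContinuousAt (extNegPart w (CylBH g r)) (x, t) ∨ (x, t) ∈ CylBH g r) :
    UpperSemicontinuousWithinAt (extNegPart w (CylBH g r)) {q | t ≤ q.2 ∧ q.2 ≤ 0} (x, t) := by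
  rcases h with h | h
  · exact h.continuousWithinAt.upperSemicontinuousWithinAt
  · have ht0 := (mem_CylBH_iff.1 h).2.2.1
    simp only at ht0
    rcases ht0.lt_or_eq with hlt | heq
    · intro c hc
      rw [extNegPart_of_mem h, max_lt_iff] at hc
      have h1 := lowerSemicontinuousWithinAt_of_mem_CylBH hlam hLam hA hg hw hge h hlt
      have h2 : ∀ᶠ q in 𝓝[{q | t ≤ q.2 ∧ q.2 ≤ 0}] (x, t), -c < w q :=
        (h1 (-c) (by linarith)).filter_mono (nhdsWithin_mono _ fun q hq => hq.1)
      filter_upwards [h2, (eventually_mem_CylBH hg h).filter_mono nhdsWithin_le_nhds,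
        self_mem_nhdsWithin] with q h3 h4 h5
      rw [extNegPart_of_mem (h4 h5.2)]
      exact max_lt (by linarith) hc.2
    · intro c hc
      have h1 := (continuousAt_extNegPart_space hg hw (Or.inr h)).eventually (gt_mem_nhds hc)
      filter_upwards [((continuous_fst.tendsto (x, t)).eventually h1).filter_mono
        nhdsWithin_le_nhds, self_mem_nhdsWithin] with q hq1 hq2
      have h5 : q = (q.1, t) := Prod.ext rfl (le_antisymm (hq2.2.trans heq.symm.le) hq2.1)
      rw [h5]
      exact hq1

theorem SolvesL.const_mul_extNegPart (hg : Continuous fun q : Spc' m × ℝ => g q.1 q.2)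
    (hw : SolvesL A w (CylBH g r)) {x : Spc m} {t : ℝ} (b : ℝ)
    (hpos : 0 < extNegPart w (CylBH g r) (x, t)) :
    ContDiffAt ℝ 2 (fun z => b * extNegPart w (CylBH g r) (z, t)) x ∧
      HasDerivWithinAt (fun s => b * extNegPart w (CylBH g r) (x, s))
        (traceHess (A x) (fun z => b * extNegPart w (CylBH g r) (z, t)) x) (Set.Iic t) t := by
  obtain ⟨hmem, hneg⟩ := extNegPart_pos hpos
  have ht0 := (mem_CylBH_iff.1 hmem).2.2.1
  simp only at ht0
  have hwx : ContDiffAt ℝ 2 (fun z => w (z, t)) x := (hw _ hmem).1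
  have hval : ∀ q ∈ CylBH g r, w q < 0 → b * extNegPart w (CylBH g r) q = -b * w q :=
    fun q hq hq0 => by
      rw [extNegPart_of_mem hq, max_eq_left (by linarith)]
      ring
  have hx : (fun z => b * extNegPart w (CylBH g r) (z, t)) =ᶠ[𝓝 x] fun z => -b * w (z, t) := by
    filter_upwards [eventually_mem_CylBH_space hg hmem,
      hwx.continuousAt.eventually (gt_mem_nhds hneg)] with z h1 h2
    exact hval _ h1 h2
  have ht : (fun s => b * extNegPart w (CylBH g r) (x, s)) =ᶠ[𝓝[Set.Iic t] t]
      fun s => -b * w (x, s) := by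
    filter_upwards [(eventually_mem_CylBH_time hg hmem).filter_mono
      (nhdsWithin_mono _ (Set.Iic_subset_Iic.2 ht0)),
      ((hw _ hmem).2.continuousAt.eventually (gt_mem_nhds hneg)).filter_mono
        nhdsWithin_le_nhds] with s h1 h2
    exact hval _ h1 h2
  refine ⟨(contDiffAt_const.mul hwx).congr_of_eventuallyEq hx, ?_⟩
  rw [traceHess_congr _ hx, traceHess_const_mul _ _ hwx]
  exact ((hw _ hmem).2.const_mul (-b)).hasDerivWithinAt.congr_of_eventuallyEq ht
    (hval _ hmem hneg)

/-- The negative part of `w` is halved on each inward step of size `ρ`. -/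
theorem neg_half_pow_le (hlam : 0 ≤ lam) (hLam : 0 ≤ Lam) (hA : IsElliptic lam Lam A)
    {κ ρ : ℝ} (hκ : ∀ (y : Spc m → ℝ → ℝ) (x₀ : Spc m) (t₀ : ℝ),
      IsSmallSupportSubsolution A y x₀ ρ t₀ κ → y x₀ t₀ ≤ 1 / 2)
    (hg : Continuous fun q : Spc' m × ℝ => g q.1 q.2) (hrβ : r ^ β < r)
    (hρ : 0 < ρ) (hρ1 : ρ ≤ 1) (hρκ : 2 ^ m * r ^ β ≤ κ * ρ) (hw : SolvesL A w (CylBH g r))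
    (hvan : VanishesOn (fun q => max (-w q) 0) (CylBH g r) (graphSet g))
    (hpos : ∀ p ∈ ASetH g β r, 0 < w p) (hge : ∀ p ∈ CylBH g r, -1 ≤ w p) (j : ℕ) :
    ∀ p ∈ CylBH g r, (∀ i : Fin m, |p.1 i.castSucc| < r - j * ρ) → -r + j * ρ < p.2 →
      -(1 / 2) ^ j ≤ w p := by
  induction j with
  | zero => simpa using fun x t hp _ _ => hge (x, t) hp
  | succ j ih =>
    rintro ⟨x₀, t₀⟩ hp hpi hpt
    push_cast at hpi hpt
    obtain ⟨-, -, hpt0, -, -⟩ := mem_CylBH_iff.1 hp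
    simp only at hpt0
    set Ω := CylBH g r with hΩ
    set Y := extNegPart w Ω with hY
    have hjρ : 0 ≤ j * ρ := by positivity
    have hρ2 : ρ ^ 2 ≤ ρ := by nlinarith
    have hbox : ∀ x ∈ Metric.closedBall x₀ ρ, ∀ t ∈ Set.Icc (t₀ - ρ ^ 2) t₀,
        (∀ i : Fin m, |x i.castSucc| < r - j * ρ) ∧ -r + j * ρ < t ∧ t ≤ 0 := by
      intro x hx t ht
      refine ⟨fun i => ?_, by linarith [ht.1], ht.2.trans hpt0⟩
      have h1 := (abs_apply_sub_le x x₀ i.castSucc).trans (mem_closedBall_iff_norm.1 hx)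
      have h2 := abs_sub_abs_le_abs_sub (x i.castSucc) (x₀ i.castSucc)
      linarith [hpi i]
    have hreg : ∀ x ∈ Metric.closedBall x₀ ρ, ∀ t ∈ Set.Icc (t₀ - ρ ^ 2) t₀,
        ContinuousAt Y (x, t) ∨ (x, t) ∈ Ω := by
      intro x hx t ht
      obtain ⟨h1, h2, h3⟩ := hbox x hx t ht
      exact continuousAt_extNegPart_or_mem hg hrβ hvan hpos
        (fun i => (h1 i).trans_le (by linarith)) (by simp only; linarith) h3
    have hsmall : IsSmallSupportSubsolution A (fun x t => 2 ^ j * Y (x, t)) x₀ ρ t₀ κ := by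
      refine ⟨hρ, fun x hx t ht => mul_nonneg (by positivity) (extNegPart_nonneg _ _ _),
        fun x hx t ht => ?_, fun x hx t ht => ?_, fun x hx t ht => ?_, fun x hx t ht => ?_,
        fun x hx t ht hpos' => ?_, fun t ht => ?_⟩
      · have hle : Y (x, t) ≤ (1 / 2) ^ j := by
          by_cases hm : (x, t) ∈ Ω
          · obtain ⟨h1, h2, h3⟩ := hbox x hx t ht
            have h4 := ih _ hm h1 h2
            rw [hY, extNegPart_of_mem hm]
            exact max_le (by linarith) (by positivity)
          · rw [hY, extNegPart_of_notMem hm]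
            positivity
        calc 2 ^ j * Y (x, t) ≤ 2 ^ j * (1 / 2) ^ j := by gcongr
          _ = 1 := by rw [← mul_pow]; norm_num
      · exact continuousAt_const.mul (continuousAt_extNegPart_space hg hw (hreg x hx t ht))
      · exact continuousWithinAt_const.mul
          ((continuousWithinAt_extNegPart_time hg hw (hreg x hx t ht)).mono
            fun s hs => hs.2.trans hpt0)
      · intro c hc
        have h1 := (forward_usc_extNegPart hlam hLam hA hg hw hge (hreg x hx t ht)).mono
          (t := {q | t ≤ q.2 ∧ q.2 ≤ t₀}) fun q hq => ⟨hq.1, hq.2.trans hpt0⟩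
        have h2 : (0 : ℝ) < 2 ^ j := by positivity
        filter_upwards [h1 (c / 2 ^ j) ((lt_div_iff₀' h2).2 hc)] with q hq
        exact (lt_div_iff₀' h2).1 hq
      · exact hw.const_mul_extNegPart hg (2 ^ j) (pos_of_mul_pos_right hpos' (by positivity))
      · have hGc : Continuous fun x' : Spc' m => g x' t :=
          hg.comp (continuous_id.prodMk continuous_const)
        refine (measure_mono fun x hx => ?_).trans ((volume_graph_layer_le hGc
          (fun i => x₀ i.castSucc) (s := r ^ β) hρ.le).trans (ENNReal.ofReal_le_ofReal ?_))
        · obtain ⟨hx1, hx2⟩ := hx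
          obtain ⟨hm, hneg⟩ := extNegPart_pos
            (pos_of_mul_pos_right hx2 (by positivity : (0 : ℝ) ≤ 2 ^ j))
          refine ⟨fun i => (abs_apply_sub_le x x₀ i.castSucc).trans
            (mem_ball_iff_norm.1 hx1).le, hm.2.2.2.1, ?_⟩
          by_contra! hcon
          exact lt_asymm hneg (hpos _ ⟨hm, hcon⟩)
        · calc r ^ β * (2 * ρ) ^ m = 2 ^ m * r ^ β * ρ ^ m := by ring
            _ ≤ κ * ρ * ρ ^ m := by gcongr
            _ = κ * ρ ^ (m + 1) := by ring
    have hfin := hκ _ x₀ t₀ hsmall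
    simp only [hY, extNegPart_of_mem hp] at hfin
    have h1 : 2 ^ j * -w (x₀, t₀) ≤ 2 ^ j * max (-w (x₀, t₀)) 0 := by
      gcongr
      exact le_max_left _ _
    have h2 : 2 ^ j * (1 / 2 : ℝ) ^ (j + 1) = 1 / 2 := by
      rw [pow_succ, ← mul_assoc, ← mul_pow]
      norm_num
    have h3 : (2 : ℝ) ^ j * -w (x₀, t₀) ≤ 2 ^ j * (1 / 2) ^ (j + 1) := by linarith
    have h4 := le_of_mul_le_mul_left h3 (by positivity)
    linarith

end Decay

lemma exists_radius_forall_rpow_le {s ε δ : ℝ} (hs : 0 < s) (hε : 0 < ε) (hδ : 0 < δ) :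
    ∃ r₀ : ℝ, 0 < r₀ ∧ r₀ < 1 ∧ ∀ r : ℝ, 0 < r → r ≤ r₀ → r ^ s ≤ ε ∧ r ≤ δ := by
  refine ⟨min (1 / 2) (min (ε ^ s⁻¹) δ), ?_, ?_, fun r hr hle => ⟨?_, ?_⟩⟩
  · have := Real.rpow_pos_of_pos hε s⁻¹
    positivity
  · exact (min_le_left _ _).trans_lt (by norm_num)
  · calc r ^ s ≤ (ε ^ s⁻¹) ^ s := by
          gcongr
          exact hle.trans ((min_le_right _ _).trans (min_le_left _ _))
      _ = ε := Real.rpow_inv_rpow hε.le hs.ne'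
  · exact hle.trans ((min_le_right _ _).trans (min_le_right _ _))

lemma half_pow_floor_le {ρ r : ℝ} (hρ : 0 < ρ) (hr : 2 * ρ ≤ r) :
    (1 / 2 : ℝ) ^ ⌊r / (2 * ρ)⌋₊ ≤ Real.exp (-(Real.log 2 * (r / (4 * ρ)))) := by
  have h1 : 1 ≤ r / (2 * ρ) := by rwa [one_le_div (by positivity)]
  have h2 : r / (4 * ρ) ≤ ⌊r / (2 * ρ)⌋₊ := by
    have h3 : r / (4 * ρ) = r / (2 * ρ) / 2 := by field_simp; norm_num
    have h4 := Nat.lt_floor_add_one (r / (2 * ρ))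
    have h5 : (1 : ℝ) ≤ ⌊r / (2 * ρ)⌋₊ := by exact_mod_cast Nat.one_le_floor_iff _ |>.2 h1
    linarith
  have h6 : (1 / 2 : ℝ) = Real.exp (-Real.log 2) := by
    rw [Real.exp_neg, Real.exp_log two_pos, one_div]
  rw [h6, ← Real.exp_nat_mul, Real.exp_le_exp]
  nlinarith [Real.log_pos one_lt_two]

/-- **Key iterative lemma in Hölder domains** (Lemma 3.1). -/
theorem key_iterative_lemma_holder (m : ℕ) (hm : 1 ≤ m) (lam Lam K α : ℝ)
    (hlam : 0 < lam) (hlamLam : lam ≤ Lam) (hK : 0 < K)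
    (hα : 1 / 2 < α) (hα1 : α ≤ 1) :
    ∃ C₀ β c r₀ : ℝ, 0 < C₀ ∧ 1 < β ∧ 0 < c ∧ 0 < r₀ ∧ r₀ < 1 ∧
      ∀ (A : Spc m → Matrix (Fin (m + 1)) (Fin (m + 1)) ℝ), IsElliptic lam Lam A →
      ∀ g : Spc' m → ℝ → ℝ,
        Continuous (fun q : Spc' m × ℝ => g q.1 q.2) → g 0 0 = 0 →
        HolderSemi α (α / (1 + α)) K g →
      ∀ r : ℝ, 0 < r → r ≤ r₀ →
      ∀ w : Spc m × ℝ → ℝ,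
        SolvesL A w (CylBH g r) →
        VanishesOn (fun q => max (-w q) 0) (CylBH g r) (graphSet g) →
        (∀ p ∈ ASetH g β r, Real.exp (C₀ * r ^ (β * (1 - 1 / α))) ≤ w p) →
        (∀ p ∈ CylBH g r, -1 ≤ w p) →
        (∀ p ∈ ASetH g β (r / 2),
          Real.exp (C₀ * (r / 2) ^ (β * (1 - 1 / α))) * Real.exp (-(c * r ^ (1 - β))) ≤ w p) ∧
        (∀ p ∈ CylBH g (r / 2), -Real.exp (-(c * r ^ (1 - β))) ≤ w p) := by
  have hLam : 0 < Lam := hlam.trans_le hlamLam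
  have hα0 : 0 < α := by linarith
  have h2α : 0 < 2 * α - 1 := by linarith
  obtain ⟨κ, hκ0, hκ⟩ := exists_growth_constant m hlam hLam.le
  set β : ℝ := 2 * α / (2 * α - 1) with hβ
  have hβ1 : 1 < β := by rw [hβ, one_lt_div h2α]; linarith
  have hγ : β * (1 - 1 / α) = 2 - β := by rw [hβ]; field_simp; ring
  set σ : ℝ := (1 / 2) ^ β / 2 / (2 * K + 1) with hσ
  have hhalf : (1 / 2 : ℝ) ^ β ≤ 1 := Real.rpow_le_one (by norm_num) (by norm_num) (by linarith)
  have hσ0 : 0 < σ := by positivity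
  have hσ1 : σ ≤ 1 := by
    rw [hσ, div_le_one (by positivity)]
    linarith
  set B : ℝ := (8 * lam + 4 * ((m + 1) * Lam) + 4 * (2 / σ ^ 2)) ^ 2 with hB
  set μ : ℝ := (B + 1) / (32 * lam) with hμ
  have hμ0 : 0 < μ := by positivity
  have hBμ : B < 32 * lam * μ := by
    rw [hμ, mul_div_cancel₀ _ (by positivity)]
    linarith
  set M : ℝ := 2 ^ m / κ with hM
  have hM0 : 0 < M := by positivity
  have hlog : 0 < Real.log 2 := Real.log_pos one_lt_two
  set c : ℝ := Real.log 2 / (4 * M) with hc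
  have hc0 : 0 < c := by positivity
  set D : ℝ := (μ + 1) * (1 / 2) ^ (2 - β) with hD
  have hD0 : 0 < D := by positivity
  obtain ⟨r₀, hr₀0, hr₀1, hr₀⟩ := exists_radius_forall_rpow_le (s := β - 1)
    (ε := min (1 / 6) (1 / (2 * M))) (δ := c / D) (by linarith) (by positivity) (by positivity)
  refine ⟨μ + 1, β, c, r₀, by positivity, hβ1, hc0, hr₀0, hr₀1, ?_⟩
  intro A hA g hgc _ hg r hr hrr₀ w hw hvan hA_ge hge
  obtain ⟨hrε, hrδ⟩ := hr₀ r hr hrr₀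
  have hr1 : r < 1 := hrr₀.trans_lt hr₀1
  have hq0 : 0 < r ^ (β - 1) := Real.rpow_pos_of_pos hr _
  have hrβ : r ^ β = r * r ^ (β - 1) := by
    rw [← Real.rpow_one_add' hr.le (by linarith)]
    congr 1
    ring
  have hq6 : r ^ (β - 1) ≤ 1 / 6 := hrε.trans (min_le_left _ _)
  have hqM : M * r ^ (β - 1) ≤ 1 / 2 := by
    have := (le_div_iff₀ (by positivity)).1 (hrε.trans (min_le_right _ _))
    linarith
  have hpos_rβ : 0 < r ^ β := Real.rpow_pos_of_pos hr _
  have h5 : 5 * r ^ β < r := by rw [hrβ]; nlinarith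
  set ρ : ℝ := M * r ^ β with hρ
  have hρ0 : 0 < ρ := by positivity
  have hρr : 2 * ρ ≤ r := by rw [hρ, hrβ]; nlinarith
  have hexp : Real.log 2 * (r / (4 * ρ)) = c * r ^ (1 - β) := by
    rw [hc, hρ, Real.rpow_sub hr, Real.rpow_one]
    field_simp
  have hneg := neg_half_pow_le hlam.le hLam.le hA (fun y x₀ t₀ => hκ A hA y x₀ ρ t₀) hgc
    (by linarith : r ^ β < r) hρ0 (by linarith) (by rw [hρ, hM]; field_simp; rfl) hw hvan
    (fun p hp => (Real.exp_pos _).trans_le (hA_ge p hp)) hge ⌊r / (2 * ρ)⌋₊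
  have hone := one_le_of_mem_ASetH hlam hLam.le hA hgc hα hα1 (by linarith : 0 < β) hK.le hg hσ0
    hσ1 (by rw [hσ]; field_simp; rfl) hμ0 hBμ hr hr1 h5 hw hge hA_ge
  refine ⟨fun p hp => le_trans ?_ (hone p hp), fun p hp => le_trans ?_ (hneg p ?_ ?_ ?_)⟩
  · rw [hγ, ← Real.exp_add, Real.exp_le_one_iff, Real.div_rpow hr.le (by norm_num)]
    have hsplit : r ^ (2 - β) = r * r ^ (1 - β) := by
      rw [show 2 - β = (1 - β) + 1 by ring, Real.rpow_add_one hr.ne', mul_comm]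
    have h1 := (le_div_iff₀ hD0).1 hrδ
    have h2 : (μ + 1) * (r ^ (2 - β) / 2 ^ (2 - β)) = r * D * r ^ (1 - β) := by
      rw [hsplit, hD, Real.div_rpow zero_le_one zero_le_two, Real.one_rpow]
      ring
    rw [h2]
    have := mul_le_mul_of_nonneg_right h1 (Real.rpow_pos_of_pos hr (1 - β)).le
    linarith
  · rw [← hexp]
    exact neg_le_neg (half_pow_floor_le hρ0 hρr)
  all_goals
    obtain ⟨hpi, hpt, hpt0, hp0, hpr⟩ := mem_CylBH_iff.1 hp
    have hJ : ⌊r / (2 * ρ)⌋₊ * ρ ≤ r / 2 := by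
      have := (le_div_iff₀ (by positivity)).1 (Nat.floor_le (by positivity : 0 ≤ r / (2 * ρ)))
      linarith
  · exact mem_CylBH_iff.2 ⟨fun i => (hpi i).trans (by linarith), by linarith, hpt0, hp0,
      by linarith⟩
  · exact fun i => (hpi i).trans_le (by linarith)
  · linarith
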